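/- Let m ≥ 3 be an integer, R > 0, and set U = {x ∈ ℝ^m : |x| > R}. Suppose f : U → ℝ is smooth and satisfies: (i) Im det_ℂ(I_m + i·Hess f(x)) = 0 for all x ∈ U, where Hess f(x) is the m×m real symmetric matrix (∂²f/∂x_i∂x_j(x)) regarded as a complex matrix; and (ii) for every ρ ∈ (2−m, 0) and every multi-index β there is a constant C ≥ 0 such that |∂^β f(x)| ≤ C·|x|^{ρ−|β|} for all x ∈ U. Define F on the punctured ball {y ∈ ℝ^m : 0 < |y| < 1/R} by F(y) = |y|^{2−m}·f(y/|y|²). Then F extends to a real analytic function on the whole open ball {y ∈ ℝ^m : |y| < 1/R}; in particular F is well-defined and real analytic at y = 0. -/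

import Mathlib

namespace Lawlor
open MeasureTheory Set Filter Topology
open scoped Real ContDiff

abbrev XX (m : ℕ) := Fin m → ℝ
abbrev KK (m : ℕ) := Fin m → ℤ

section basics
variable {m : ℕ}

/-- cast of a lattice point -/
def kr (k : KK m) : XX m := fun i => (k i : ℝ)

/-- character -/
noncomputable def ech (ζ x : XX m) : ℂ := Complex.exp (2 * π * Complex.I * ((∑ i, ζ i * x i : ℝ) : ℂ))

lemma norm_ech (ζ x : XX m) : ‖ech ζ x‖ = 1 := by
  unfold ech
  rw [show 2 * (π:ℂ) * Complex.I * ((∑ i, ζ i * x i : ℝ) : ℂ) = ((2 * π * (∑ i, ζ i * x i) : ℝ) : ℂ) * Complex.I by push_cast; ring]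
  exact Complex.norm_exp_ofReal_mul_I _

lemma ech_add (ζ ξ x : XX m) : ech (ζ + ξ) x = ech ζ x * ech ξ x := by
  unfold ech
  rw [← Complex.exp_add]; congr 1
  simp only [Pi.add_apply, add_mul, Finset.sum_add_distrib]; push_cast; ring

lemma ech_zero (x : XX m) : ech 0 x = 1 := by simp [ech]

lemma ech_zero_right (ζ : XX m) : ech ζ 0 = 1 := by simp [ech]

lemma ech_neg_mul (ζ x : XX m) : ech (-ζ) x * ech ζ x = 1 := by
  rw [← ech_add]; simp [ech_zero]

lemma ech_smul (ε : ℝ) (ζ x : XX m) : ech (ε • ζ) x = ech ζ (ε • x) := by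
  unfold ech; congr 3; simp [mul_assoc, mul_left_comm]

lemma ech_symm (ζ x : XX m) : ech ζ x = ech x ζ := by
  unfold ech; congr 3; simp [mul_comm]

lemma kr_add (k l : KK m) : kr (k + l) = kr k + kr l := by ext i; simp [kr]
lemma kr_neg (k : KK m) : kr (-k) = - kr k := by ext i; simp [kr]
lemma kr_zero : kr (0 : KK m) = 0 := by ext i; simp [kr]
lemma norm_kr (k : KK m) : ‖kr k‖ = ‖k‖ := by
  simp only [Pi.norm_def, kr]; rfl

lemma continuous_ech (ζ : XX m) : Continuous (ech ζ) := by
  unfold ech; fun_prop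

lemma continuous_ech' (x : XX m) : Continuous (fun ζ => ech ζ x) := by
  unfold ech; fun_prop

lemma contDiff_ech (ζ : XX m) {n : WithTop ℕ∞} : ContDiff ℝ n (ech ζ) := by
  unfold ech
  apply ContDiff.cexp
  apply ContDiff.mul contDiff_const
  have h : ContDiff ℝ n (fun x : XX m => ∑ i, ζ i * x i) := by fun_prop
  exact Complex.ofRealCLM.contDiff.comp h

lemma hasFDerivAt_ech (ζ x : XX m) : HasFDerivAt (ech ζ)
    (∑ i, (2 * π * Complex.I * ζ i * ech ζ x) • (Complex.ofRealCLM ∘L (ContinuousLinearMap.proj i : XX m →L[ℝ] ℝ))) x := by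
  unfold ech
  have h1 : HasFDerivAt (fun x : XX m => ∑ i, ζ i * x i) (∑ i, ζ i • (ContinuousLinearMap.proj i : XX m →L[ℝ] ℝ)) x := by
    apply HasFDerivAt.fun_sum
    intro i _
    exact ((ContinuousLinearMap.proj i : XX m →L[ℝ] ℝ).hasFDerivAt).const_mul (ζ i)
  have h2 := ((Complex.ofRealCLM.hasFDerivAt.comp x h1).const_mul (2 * π * Complex.I)).cexp
  convert! h2 using 1
  ext v
  simp [Finset.mul_sum]
  apply Finset.sum_congr rfl; intros; ring

/-- directional derivative operator -/
noncomputable def DD (i : Fin m) (g : XX m → ℂ) (x : XX m) : ℂ := fderiv ℝ g x (Pi.single i 1)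

lemma DD_ech (i : Fin m) (ζ x : XX m) : DD i (ech ζ) x = 2 * π * Complex.I * ζ i * ech ζ x := by
  unfold DD
  rw [(hasFDerivAt_ech ζ x).fderiv]
  simp [Pi.single_apply, apply_ite Complex.ofReal]

/-- the open unit cell -/
def cell (m : ℕ) : Set (XX m) := Metric.ball 0 (1/2)

lemma isOpen_cell : IsOpen (cell m) := Metric.isOpen_ball

lemma cell_eq_pi : cell m = Set.pi univ (fun _ => Ioo (-(1/2):ℝ) (1/2)) := by
  unfold cell
  rw [ball_pi _ (by norm_num)]
  simp [Real.ball_eq_Ioo]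

lemma volume_cell : volume (cell m) = 1 := by
  unfold cell
  rw [Real.volume_pi_ball _ (by norm_num)]
  norm_num

instance : IsProbabilityMeasure (volume.restrict (cell m)) := ⟨by simp [volume_cell]⟩

/-- Fourier coefficients over the cell -/
noncomputable def coef (g : XX m → ℂ) (k : KK m) : ℂ := ∫ x in cell m, ech (-kr k) x * g x

def box (m : ℕ) : Set (XX m) := {x | ∀ i, x i ∈ Ioc (-(1/2):ℝ) (-(1/2)+1)}

lemma box_ae : box m =ᵐ[volume] cell m := by
  have h1 : box m = Set.pi univ (fun _ => Ioc (-(1/2):ℝ) (1/2)) := by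
    ext x; simp only [box, Set.mem_ofPred_eq, Set.mem_pi, Set.mem_univ, true_imp_iff]; norm_num
  rw [h1, cell_eq_pi]
  exact (Measure.univ_pi_Ioo_ae_eq_Icc (μ := fun _ : Fin m => (volume : Measure ℝ)) (f := fun _ => -(1/2:ℝ)) (g := fun _ => 1/2)).trans
    (Measure.univ_pi_Ioc_ae_eq_Icc (μ := fun _ : Fin m => (volume : Measure ℝ)) (f := fun _ => -(1/2:ℝ)) (g := fun _ => 1/2)).symm |>.symm

section torus
noncomputable local instance instMS : MeasureSpace UnitAddCircle := ⟨AddCircle.haarAddCircle⟩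
local instance instHaar : Measure.IsAddHaarMeasure (volume : Measure UnitAddCircle) :=
  inferInstanceAs (Measure.IsAddHaarMeasure AddCircle.haarAddCircle)
local instance instProb : IsProbabilityMeasure (volume : Measure UnitAddCircle) :=
  inferInstanceAs (IsProbabilityMeasure AddCircle.haarAddCircle)

noncomputable def tor (t : UnitAddTorus (Fin m)) : XX m := (UnitAddTorus.measurableEquivPiIoc (fun _ => -(1/2:ℝ)) t).1

lemma tor_emb : MeasurableEmbedding (tor (m := m)) := by
  apply MeasurableEmbedding.comp _ (MeasurableEquiv.measurableEmbedding _)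
  exact MeasurableEmbedding.subtype_coe (MeasurableSet.univ_pi' (fun i => measurableSet_Ioc))

lemma tor_mp : MeasurePreserving (tor (m := m)) volume (volume.restrict (cell m)) := by
  have h := UnitAddTorus.measurePreserving_equivPiIoc (fun _ : Fin m => -(1/2:ℝ))
  have h2 : MeasurePreserving (Subtype.val : {x : XX m // ∀ i, x i ∈ Ioc (-(1/2):ℝ) (-(1/2)+1)} → XX m)
     (Measure.comap Subtype.val volume) (volume.restrict (box m)) :=
    measurePreserving_subtype_coe (s := box m) (MeasurableSet.univ_pi' (fun i => measurableSet_Ioc))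
  rw [← Measure.restrict_congr_set box_ae]
  exact h2.comp h

lemma coe_tor (t : UnitAddTorus (Fin m)) (i : Fin m) : ((tor t i : ℝ) : UnitAddCircle) = t i := by
  have := congrFun ((UnitAddTorus.measurableEquivPiIoc (fun _ : Fin m => -(1/2:ℝ))).symm_apply_apply t) i
  exact this

lemma mFourier_tor (k : KK m) (t : UnitAddTorus (Fin m)) : UnitAddTorus.mFourier k t = ech (kr k) (tor t) := by
  unfold UnitAddTorus.mFourier ech
  simp only [ContinuousMap.coe_mk]
  conv_lhs => enter [2, i]; rw [← coe_tor t i, fourier_coe_apply]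
  rw [← Complex.exp_sum]; congr 1
  push_cast
  rw [Finset.mul_sum]
  apply Finset.sum_congr rfl; intros; simp [kr]; ring

lemma parseval {g : XX m → ℂ} (hg : MemLp g 2 (volume.restrict (cell m))) :
    HasSum (fun k => ‖coef g k‖ ^ 2) (∫ x in cell m, ‖g x‖ ^ 2) := by
  have hG : MemLp (g ∘ tor) 2 volume := hg.comp_measurePreserving tor_mp
  have h := UnitAddTorus.hasSum_sq_mFourierCoeff hG.toLp
  have e1 : ∫ t, ‖(hG.toLp : UnitAddTorus (Fin m) → ℂ) t‖ ^ 2 = ∫ x in cell m, ‖g x‖ ^ 2 := by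
    rw [← tor_mp.integral_comp tor_emb]
    apply integral_congr_ae
    filter_upwards [hG.coeFn_toLp] with t ht
    rw [ht]; rfl
  have e2 : ∀ k, UnitAddTorus.mFourierCoeff hG.toLp k = coef g k := by
    intro k
    unfold UnitAddTorus.mFourierCoeff coef
    rw [← tor_mp.integral_comp tor_emb]
    apply integral_congr_ae
    filter_upwards [hG.coeFn_toLp] with t ht
    rw [ht, mFourier_tor, kr_neg]; rfl
  rw [e1] at h
  simpa only [e2] using h

lemma integral_ech (k : KK m) : ∫ x in cell m, ech (kr k) x = if k = 0 then 1 else 0 := by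
  have h := orthonormal_iff_ite.mp (UnitAddTorus.orthonormal_mFourier (d := Fin m)) 0 k
  simp only [ContinuousMap.inner_toLp, ← UnitAddTorus.mFourier_neg, ← UnitAddTorus.mFourier_add] at h
  rw [← tor_mp.integral_comp tor_emb]
  simp only [← mFourier_tor]
  convert! h using 2
  · simp
  · simp [eq_comm]
end torus

end basics
end Lawlor

namespace Lawlor
open MeasureTheory Set Filter Topology
open scoped Real ContDiff

/-- Wiener algebra -/
def Wn (m : ℕ) : Type := lp (fun _ : KK m => ℂ) 1

noncomputable section wiener
variable {m : ℕ}

instance : NormedAddCommGroup (Wn m) := inferInstanceAs (NormedAddCommGroup (lp (fun _ : KK m => ℂ) 1))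
instance : NormedSpace ℂ (Wn m) := inferInstanceAs (NormedSpace ℂ (lp (fun _ : KK m => ℂ) 1))
instance : CompleteSpace (Wn m) := inferInstanceAs (CompleteSpace (lp (fun _ : KK m => ℂ) 1))

/-- coefficient -/
def co (b : Wn m) (k : KK m) : ℂ := (show lp (fun _ : KK m => ℂ) 1 from b) k

@[ext] lemma Wn.ext {a b : Wn m} (h : ∀ k, co a k = co b k) : a = b := lp.ext (funext h)

lemma co_add (a b : Wn m) (k) : co (a + b) k = co a k + co b k := rfl
lemma co_sub (a b : Wn m) (k) : co (a - b) k = co a k - co b k := rfl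
lemma co_neg (a : Wn m) (k) : co (-a) k = - co a k := rfl
lemma co_zero (k) : co (0 : Wn m) k = 0 := rfl
lemma co_smul (c : ℂ) (a : Wn m) (k) : co (c • a) k = c * co a k := rfl
lemma co_sum {ι : Type*} (s : Finset ι) (f : ι → Wn m) (k) : co (∑ i ∈ s, f i) k = ∑ i ∈ s, co (f i) k := by
  classical
  induction s using Finset.induction_on with
  | empty => simp [co_zero]
  | insert a s h ih => rw [Finset.sum_insert h, Finset.sum_insert h, co_add, ih]

lemma summable_co (b : Wn m) : Summable (fun k => ‖co b k‖) := by
  have := (lp.memℓp (show lp (fun _ : KK m => ℂ) 1 from b)).summable (by norm_num)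
  simp only [ENNReal.toReal_one, Real.rpow_one] at this
  exact this

lemma norm_eq_tsum (b : Wn m) : ‖b‖ = ∑' k, ‖co b k‖ := by
  have := lp.norm_eq_tsum_rpow (p := 1) (by norm_num) (show lp (fun _ : KK m => ℂ) 1 from b)
  simp only [ENNReal.toReal_one, Real.rpow_one, div_one] at this
  exact this

lemma norm_co_le (b : Wn m) (k) : ‖co b k‖ ≤ ‖b‖ := by
  rw [norm_eq_tsum]
  exact (summable_co b).le_tsum k (fun _ _ => norm_nonneg _)

/-- constructor -/
def mkW (c : KK m → ℂ) (h : Summable (fun k => ‖c k‖)) : Wn m :=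
  (⟨c, by apply memℓp_gen; simpa using h⟩ : lp (fun _ : KK m => ℂ) 1)

lemma co_mkW (c : KK m → ℂ) (h) (k) : co (mkW c h) k = c k := rfl

/-- the function represented by a coefficient sequence -/
def real (b : Wn m) (x : XX m) : ℂ := ∑' k, co b k * ech (kr k) x

lemma norm_term (b : Wn m) (x : XX m) (k) : ‖co b k * ech (kr k) x‖ = ‖co b k‖ := by
  rw [norm_mul, norm_ech, mul_one]

lemma summable_term (b : Wn m) (x : XX m) : Summable (fun k => co b k * ech (kr k) x) := by
  apply Summable.of_norm
  simpa only [norm_term] using summable_co b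

lemma norm_real_le (b : Wn m) (x) : ‖real b x‖ ≤ ‖b‖ := by
  rw [norm_eq_tsum]
  refine (norm_tsum_le_tsum_norm ?_).trans ?_
  · simpa only [norm_term] using summable_co b
  · simp only [norm_term]; exact le_rfl

lemma real_add (a b : Wn m) (x) : real (a + b) x = real a x + real b x := by
  unfold real
  rw [← (summable_term a x).tsum_add (summable_term b x)]
  simp only [co_add, add_mul]

lemma real_smul (c : ℂ) (b : Wn m) (x) : real (c • b) x = c * real b x := by
  unfold real
  rw [← tsum_mul_left]
  simp only [co_smul, mul_assoc]

lemma real_zero (x) : real (0 : Wn m) x = 0 := by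
  simp [real, co_zero]

lemma real_neg (b : Wn m) (x) : real (-b) x = - real b x := by
  rw [← neg_one_smul ℂ, real_smul]; ring

lemma real_sub (a b : Wn m) (x) : real (a - b) x = real a x - real b x := by
  rw [sub_eq_add_neg, real_add, real_neg]; ring

lemma continuous_real (b : Wn m) : Continuous (real b) := by
  unfold real
  apply continuous_tsum (fun k => continuous_const.mul (continuous_ech _)) (summable_co b)
  intro k x; exact (norm_term b x k).le

lemma coef_real (b : Wn m) (k) : coef (real b) k = co b k := by
  unfold coef real
  have h1 : ∀ x, ech (-kr k) x * ∑' l, co b l * ech (kr l) x = ∑' l, co b l * ech (kr (l - k)) x := by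
    intro x
    rw [← tsum_mul_left]
    congr 1; ext l
    rw [sub_eq_neg_add, kr_add, ech_add, kr_neg]; ring
  simp only [h1]
  rw [← integral_tsum_of_summable_integral_norm]
  · simp only [integral_const_mul, integral_ech]
    rw [tsum_eq_single k]
    · simp
    · intro l hl
      rw [if_neg (sub_ne_zero.2 hl), mul_zero]
  · intro l
    apply Integrable.const_mul
    apply Integrable.of_bound (C := 1) (continuous_ech _).aestronglyMeasurable
    simp [norm_ech]
  · simp only [norm_mul, norm_ech, mul_one, integral_const]
    simpa using summable_co b

lemma coef_congr {g h : XX m → ℂ} (H : EqOn g h (cell m)) (k) : coef g k = coef h k := by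
  unfold coef
  apply setIntegral_congr_fun isOpen_cell.measurableSet
  intro x hx; simp only; rw [H hx]

lemma real_inj {a b : Wn m} (h : EqOn (real a) (real b) (cell m)) : a = b := by
  ext k
  rw [← coef_real, ← coef_real]
  exact coef_congr h k

def eqv (m : ℕ) : KK m × KK m ≃ KK m × KK m where
  toFun p := (p.2, p.1 - p.2)
  invFun q := (q.1 + q.2, q.1)
  left_inv p := by ext <;> simp
  right_inv p := by ext <;> simp

lemma conv_summable (a b : Wn m) : Summable (fun p : KK m × KK m => ‖co a p.2‖ * ‖co b (p.1 - p.2)‖) := by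
  have h := (summable_co a).mul_of_nonneg (summable_co b) (fun _ => norm_nonneg _) (fun _ => norm_nonneg _)
  exact (eqv m).summable_iff.2 h

lemma conv_summable' (a b : Wn m) : Summable (fun n => ‖∑' k, co a k * co b (n - k)‖) := by
  have h := conv_summable a b
  refine Summable.of_nonneg_of_le (fun _ => norm_nonneg _) (fun n => ?_) h.prod
  refine (norm_tsum_le_tsum_norm ?_).trans ?_
  · simpa only [norm_mul] using h.prod_factor n
  · simp only [norm_mul]; exact le_rfl

instance : Mul (Wn m) := ⟨fun a b => mkW (fun n => ∑' k, co a k * co b (n - k)) (conv_summable' a b)⟩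

lemma co_mul (a b : Wn m) (n) : co (a * b) n = ∑' k, co a k * co b (n - k) := rfl

instance : One (Wn m) := ⟨mkW (fun n => if n = 0 then 1 else 0) (summable_of_ne_finset_zero (s := {0}) (by
  intro b hb; simp at hb; simp [hb]))⟩

lemma co_one (n : KK m) : co (1 : Wn m) n = if n = 0 then 1 else 0 := rfl

lemma real_one (x : XX m) : real 1 x = 1 := by
  unfold real
  rw [tsum_eq_single 0]
  · simp [co_one, kr_zero, ech_zero]
  · intro k hk; simp [co_one, hk]

lemma real_mul (a b : Wn m) (x) : real (a * b) x = real a x * real b x := by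
  unfold real
  rw [tsum_mul_tsum_of_summable_norm (by simpa only [norm_term] using summable_co a) (by simpa only [norm_term] using summable_co b)]
  rw [← (eqv m).tsum_eq]
  have hs : Summable (fun p : KK m × KK m => co a (eqv m p).1 * ech (kr (eqv m p).1) x * (co b (eqv m p).2 * ech (kr (eqv m p).2) x)) := by
    apply Summable.of_norm
    simp only [norm_mul, norm_ech, mul_one]
    exact conv_summable a b
  rw [hs.tsum_prod]
  congr 1; ext n
  rw [co_mul, ← tsum_mul_right]
  congr 1; ext k
  simp only [eqv, Equiv.coe_fn_mk]
  have : kr n = kr k + kr (n - k) := by rw [← kr_add]; congr 1; abel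
  rw [this, ech_add]; ring

lemma norm_mul_le' (a b : Wn m) : ‖a * b‖ ≤ ‖a‖ * ‖b‖ := by
  simp only [norm_eq_tsum]
  rw [tsum_mul_tsum_of_summable_norm (by simpa using summable_co a) (by simpa using summable_co b)]
  rw [← (eqv m).tsum_eq]
  have h := conv_summable a b
  have e : (∑' c : KK m × KK m, ‖co a (eqv m c).1‖ * ‖co b (eqv m c).2‖) = ∑' n, ∑' k, ‖co a k‖ * ‖co b (n - k)‖ := by
    exact h.tsum_prod
  rw [e]
  apply Summable.tsum_le_tsum _ (conv_summable' a b) h.prod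
  intro n
  refine (norm_tsum_le_tsum_norm ?_).trans ?_
  · simpa only [norm_mul] using h.prod_factor n
  · simp only [norm_mul]; exact le_rfl

instance : CommRing (Wn m) where
  __ := (inferInstance : AddCommGroup (Wn m))
  mul_assoc a b c := real_inj fun x _ => by simp only [real_mul, mul_assoc]
  one_mul a := real_inj fun x _ => by simp only [real_mul, real_one, one_mul]
  mul_one a := real_inj fun x _ => by simp only [real_mul, real_one, mul_one]
  zero_mul a := real_inj fun x _ => by simp only [real_mul, real_zero, zero_mul]
  mul_zero a := real_inj fun x _ => by simp only [real_mul, real_zero, mul_zero]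
  left_distrib a b c := real_inj fun x _ => by simp only [real_mul, real_add, mul_add]
  right_distrib a b c := real_inj fun x _ => by simp only [real_mul, real_add, add_mul]
  mul_comm a b := real_inj fun x _ => by simp only [real_mul, mul_comm]
instance : NormedCommRing (Wn m) where
  dist_eq := NormedAddCommGroup.dist_eq
  norm_mul_le := norm_mul_le'
  mul_comm := mul_comm

instance : Algebra ℂ (Wn m) := Algebra.ofModule
  (fun r x y => real_inj fun t _ => by simp only [real_mul, real_smul]; ring)
  (fun r x y => real_inj fun t _ => by simp only [real_mul, real_smul]; ring)

instance : NormedAlgebra ℂ (Wn m) where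
  norm_smul_le := norm_smul_le


/-- evaluation -/
def evx (x : XX m) : Wn m →ₐ[ℂ] ℂ where
  toFun b := real b x
  map_one' := real_one x
  map_mul' a b := real_mul a b x
  map_zero' := real_zero x
  map_add' a b := real_add a b x
  commutes' r := by
    rw [Algebra.algebraMap_eq_smul_one, real_smul, real_one]; simp

lemma evx_apply (x : XX m) (b : Wn m) : evx x b = real b x := rfl

lemma real_sum {ι : Type*} (s : Finset ι) (f : ι → Wn m) (x) : real (∑ i ∈ s, f i) x = ∑ i ∈ s, real (f i) x := by
  simp only [← evx_apply, map_sum]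

lemma coef_sub {g h : XX m → ℂ} (hg : IntegrableOn g (cell m)) (hh : IntegrableOn h (cell m)) (k) :
    coef (fun x => g x - h x) k = coef g k - coef h k := by
  unfold coef
  rw [← integral_sub]
  · simp only [mul_sub]
  · exact hg.bdd_mul (c := 1) (continuous_ech _).aestronglyMeasurable (by simp [norm_ech])
  · exact hh.bdd_mul (c := 1) (continuous_ech _).aestronglyMeasurable (by simp [norm_ech])

lemma memLp_of_bdd {g : XX m → ℂ} (hg : ContinuousOn g (cell m)) {C : ℝ} (hC : ∀ x ∈ cell m, ‖g x‖ ≤ C) (p : ENNReal) :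
    MemLp g p (volume.restrict (cell m)) := by
  apply MemLp.of_bound (hg.aestronglyMeasurable isOpen_cell.measurableSet) C
  exact (ae_restrict_iff' isOpen_cell.measurableSet).2 (ae_of_all _ hC)

lemma memLp_real (b : Wn m) (p : ENNReal) : MemLp (real b) p (volume.restrict (cell m)) :=
  memLp_of_bdd (continuous_real b).continuousOn (fun x _ => norm_real_le b x) p

/-- a function with the coefficients of b equals `real b` on the open set of continuity. -/
lemma eq_real {g : XX m → ℂ} (hg : MemLp g 2 (volume.restrict (cell m))) {b : Wn m} (hb : ∀ k, coef g k = co b k)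
    {V : Set (XX m)} (hV : IsOpen V) (hVc : V ⊆ cell m) (hc : ContinuousOn g V) : EqOn g (real b) V := by
  have hd : MemLp (fun x => g x - real b x) 2 (volume.restrict (cell m)) := hg.sub (memLp_real b 2)
  have hp := parseval hd
  have hz : ∀ k, coef (fun x => g x - real b x) k = 0 := by
    intro k
    rw [coef_sub (hg.integrable (by norm_num)) ((memLp_real b 1).integrable le_rfl), hb, coef_real, sub_self]
  simp only [hz] at hp
  have h0 : ∫ x in cell m, ‖g x - real b x‖ ^ 2 = 0 := by
    have := hp.tsum_eq
    simpa using this.symm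
  rw [integral_eq_zero_iff_of_nonneg (fun x => by positivity)] at h0
  · have h1 : g =ᵐ[volume.restrict V] real b := by
      have := ae_restrict_of_ae_restrict_of_subset hVc h0
      filter_upwards [this] with x hx
      have h2 : ‖g x - real b x‖ ^ 2 = 0 := hx
      rw [← sub_eq_zero]; simpa using h2
    exact Measure.eqOn_open_of_ae_eq h1 hV hc (continuous_real b).continuousOn
  · exact (memLp_two_iff_integrable_sq_norm hd.1).1 hd

end wiener
end Lawlor

namespace Lawlor
open MeasureTheory Set Filter Topology
open scoped Real ContDiff

noncomputable section decay
variable {m : ℕ}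

lemma summable_lattice (n : ℕ) (hn : m < n) : Summable (fun k : KK m => ((1 + ‖k‖) ^ n)⁻¹) := by
  let L := Submodule.span ℤ (Set.range (Pi.basisFun ℝ (Fin m)))
  have hr : Module.finrank ℤ L = m := by
    rw [ZLattice.rank ℝ L]; simp
  have h := ZLattice.summable_norm_pow_inv L n (by rw [hr]; exact hn)
  have hmem : ∀ k : KK m, kr k ∈ L := by
    intro k
    have : kr k = ∑ i, k i • (Pi.basisFun ℝ (Fin m) i) := by
      ext j; simp [kr, Finset.sum_apply, Pi.single_apply]
    rw [this]
    exact Submodule.sum_mem _ fun i _ => Submodule.smul_mem _ _ (Submodule.subset_span ⟨i, rfl⟩)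
  have hi : Function.Injective (fun k : KK m => (⟨kr k, hmem k⟩ : L)) := by
    intro a b hab
    have := congrArg Subtype.val hab
    ext i
    have h2 := congrFun this i
    simpa [kr] using h2
  have h2 : Summable (fun k : KK m => ‖k‖⁻¹ ^ n) := by
    have := h.comp_injective hi
    refine this.congr ?_
    intro k
    show ‖kr k‖⁻¹ ^ n = _
    rw [norm_kr]
  have h3 : Summable (fun k : KK m => if k = 0 then (1:ℝ) else 0) :=
    summable_of_ne_finset_zero (s := {0}) (by intro b hb; simp at hb; simp [hb])
  refine Summable.of_nonneg_of_le (fun k => by positivity) (fun k => ?_) (h2.add h3)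
  by_cases hk : k = 0
  · simp [hk]
  · have : 0 < ‖k‖ := norm_pos_iff.2 hk
    rw [if_neg hk, add_zero, ← inv_pow]
    gcongr; linarith

lemma DD_contDiffOn {V : Set (XX m)} (hV : IsOpen V) {g : XX m → ℂ} (hg : ContDiffOn ℝ ∞ g V) (i : Fin m) :
    ContDiffOn ℝ ∞ (DD i g) V := by
  have h := hg.fderiv_of_isOpen (m := ∞) hV (by simp)
  exact h.clm_apply contDiffOn_const

lemma DD_continuousOn {V : Set (XX m)} (hV : IsOpen V) {g : XX m → ℂ} (hg : ContDiffOn ℝ 1 g V) (i : Fin m) :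
    ContinuousOn (DD i g) V := by
  have h := hg.fderiv_of_isOpen (m := 0) hV (by simp)
  exact (h.clm_apply contDiffOn_const).continuousOn

lemma DD_congr {V : Set (XX m)} (hV : IsOpen V) {g h : XX m → ℂ} (hgh : EqOn g h V) (i : Fin m) :
    EqOn (DD i g) (DD i h) V := by
  intro x hx
  unfold DD
  rw [Filter.EventuallyEq.fderiv_eq (Filter.eventuallyEq_of_mem (hV.mem_nhds hx) hgh)]

lemma DD_supp {g : XX m → ℂ} {ρ : ℝ} (hs : ∀ x, ρ < ‖x‖ → g x = 0) (i : Fin m) (x) (hx : ρ < ‖x‖) : DD i g x = 0 := by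
  have hV : IsOpen {x : XX m | ρ < ‖x‖} := isOpen_lt continuous_const continuous_norm
  have := DD_congr hV (h := fun _ => 0) (fun y hy => hs y hy) i hx
  rw [this]; simp [DD]

lemma DD_mul {g h : XX m → ℂ} {x : XX m} (hg : DifferentiableAt ℝ g x) (hh : DifferentiableAt ℝ h x) (i : Fin m) :
    DD i (fun y => g y * h y) x = DD i g x * h x + g x * DD i h x := by
  unfold DD
  rw [fderiv_fun_mul hg hh]; simp; ring

lemma integral_DD_succ {n : ℕ} (hn : 1 ≤ n) {g : XX (n+1) → ℂ} (i : Fin (n+1)) (hg : ContDiffOn ℝ 1 g {0}ᶜ) {ρ : ℝ}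
    (hs : ∀ x, ρ < ‖x‖ → g x = 0) (hi : Integrable (DD i g)) : ∫ x, DD i g x = 0 := by
  have hmp := (volume_preserving_piFinSuccAbove (fun _ : Fin (n + 1) => ℝ) i).symm
  have hop : IsOpen ({0}ᶜ : Set (XX (n+1))) := isOpen_compl_singleton
  rw [← hmp.integral_comp (MeasurableEquiv.measurableEmbedding _)]
  have hi2 := (hmp.integrable_comp_emb (MeasurableEquiv.measurableEmbedding _)).2 hi
  rw [Measure.volume_eq_prod] at hi2 ⊢
  simp only [Function.comp_def] at hi2
  rw [integral_prod_symm _ hi2]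
  have : Nonempty (Fin n) := ⟨⟨0, by omega⟩⟩
  have hae : ∀ᵐ y : (Fin n → ℝ), y ≠ 0 := by
    rw [ae_iff]
    simp
  rw [integral_congr_ae (g := fun _ => (0:ℂ)), integral_zero]
  filter_upwards [hae] with y hy
  have key : ∀ t : ℝ, ((MeasurableEquiv.piFinSuccAbove (fun _ : Fin (n + 1) => ℝ) i).symm (t, y)) = i.insertNth t y := fun t => rfl
  simp only [key]
  have hne : ∀ t : ℝ, (i.insertNth t y : XX (n+1)) ≠ 0 := by
    intro t h0
    apply hy; ext j
    have := congrFun h0 (i.succAbove j)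
    simpa using this
  have hline : ∀ t : ℝ, HasDerivAt (fun t : ℝ => (i.insertNth t y : XX (n+1))) (Pi.single i 1) t := by
    intro t
    rw [hasDerivAt_pi]
    intro j
    refine Fin.succAboveCases i ?_ ?_ j
    · simp only [Fin.insertNth_apply_same, Pi.single_eq_same]
      exact hasDerivAt_id t
    · intro j
      simp only [Fin.insertNth_apply_succAbove, Pi.single_apply, Fin.succAbove_ne, if_false]
      exact hasDerivAt_const _ _
  have hcl : Continuous (fun t : ℝ => (i.insertNth t y : XX (n+1))) :=
    continuous_iff_continuousAt.2 fun t => (hline t).continuousAt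
  have hcs : ∀ t : ℝ, t ∉ Set.Icc (-|ρ|) |ρ| → ρ < ‖(i.insertNth t y : XX (n+1))‖ := by
    intro t ht
    have h1 : ‖(i.insertNth t y : XX (n+1)) i‖ ≤ ‖(i.insertNth t y : XX (n+1))‖ := norm_le_pi_norm _ i
    simp only [Fin.insertNth_apply_same, Real.norm_eq_abs] at h1
    have h2 : |ρ| < |t| := by
      by_contra hh
      exact ht (abs_le.1 (not_lt.1 hh))
    linarith [le_abs_self ρ]
  apply integral_eq_zero_of_hasDerivAt_of_integrable (f := fun t => g (i.insertNth t y))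
  · intro t
    have hd : DifferentiableAt ℝ g (i.insertNth t y) :=
      (hg.differentiableOn (by norm_num)).differentiableAt (hop.mem_nhds (hne t))
    exact hd.hasFDerivAt.comp_hasDerivAt t (hline t)
  · apply Continuous.integrable_of_hasCompactSupport
    · exact (DD_continuousOn hop hg i).comp_continuous hcl hne
    · apply HasCompactSupport.intro (isCompact_Icc (a := -|ρ|) (b := |ρ|))
      intro t ht
      exact DD_supp hs i _ (hcs t ht)
  · apply Continuous.integrable_of_hasCompactSupport
    · exact hg.continuousOn.comp_continuous hcl hne
    · apply HasCompactSupport.intro (isCompact_Icc (a := -|ρ|) (b := |ρ|))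
      intro t ht
      exact hs _ (hcs t ht)

lemma integral_DD (hm : 2 ≤ m) {g : XX m → ℂ} (i : Fin m) (hg : ContDiffOn ℝ 1 g {0}ᶜ) {ρ : ℝ}
    (hs : ∀ x, ρ < ‖x‖ → g x = 0) (hi : Integrable (DD i g)) : ∫ x, DD i g x = 0 := by
  obtain ⟨n, rfl⟩ : ∃ n, m = n + 1 := ⟨m - 1, by omega⟩
  exact integral_DD_succ (by omega) i hg hs hi

/-- Fourier transform -/
def FT (g : XX m → ℂ) (ζ : XX m) : ℂ := ∫ x, ech (-ζ) x * g x

lemma integrable_ech_mul {g : XX m → ℂ} (hg : Integrable g) (ζ : XX m) : Integrable (fun x => ech ζ x * g x) :=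
  hg.bdd_mul (c := 1) (continuous_ech _).aestronglyMeasurable (by simp [norm_ech])

lemma norm_FT_le (g : XX m → ℂ) (ζ : XX m) : ‖FT g ζ‖ ≤ ∫ x, ‖g x‖ := by
  refine (norm_integral_le_integral_norm _).trans (le_of_eq ?_)
  simp [norm_ech]

lemma FT_DD (hm : 2 ≤ m) {g : XX m → ℂ} (i : Fin m) (hg : ContDiffOn ℝ 1 g {0}ᶜ) {ρ : ℝ}
    (hs : ∀ x, ρ < ‖x‖ → g x = 0) (hi0 : Integrable g) (hi : Integrable (DD i g)) (ζ : XX m) :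
    FT (DD i g) ζ = 2 * π * Complex.I * ζ i * FT g ζ := by
  have hop : IsOpen ({0}ᶜ : Set (XX m)) := isOpen_compl_singleton
  have : Nonempty (Fin m) := ⟨⟨0, by omega⟩⟩
  have hae : ∀ᵐ x : XX m, DD i (fun y => ech (-ζ) y * g y) x = ech (-ζ) x * DD i g x - 2 * π * Complex.I * ζ i * (ech (-ζ) x * g x) := by
    have h0 : ∀ᵐ x : XX m, x ≠ 0 := by
      rw [ae_iff]; simp
    filter_upwards [h0] with x hx
    rw [DD_mul ((contDiff_ech (-ζ) (n := 1)).differentiable (by norm_num) x)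
      ((hg.differentiableOn (by norm_num)).differentiableAt (hop.mem_nhds hx)), DD_ech]
    simp; ring
  have hInt : Integrable (fun x => ech (-ζ) x * DD i g x - 2 * π * Complex.I * ζ i * (ech (-ζ) x * g x)) :=
    (integrable_ech_mul hi _).sub ((integrable_ech_mul hi0 _).const_mul _)
  have := integral_DD hm (g := fun y => ech (-ζ) y * g y) i ((contDiff_ech (-ζ) (n := 1)).contDiffOn.mul hg) (ρ := ρ)
    (fun x hx => by simp [hs x hx]) (hInt.congr (hae.mono fun x hx => hx.symm))
  rw [integral_congr_ae hae, integral_sub (integrable_ech_mul hi _) ((integrable_ech_mul hi0 _).const_mul _), integral_const_mul] at this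
  exact sub_eq_zero.1 this

lemma FT_DD_iter (hm : 2 ≤ m) (i : Fin m) (N : ℕ) {ρ : ℝ} (ζ : XX m) : ∀ {g : XX m → ℂ} (_ : ContDiffOn ℝ ∞ g {0}ᶜ)
    (_ : ∀ x, ρ < ‖x‖ → g x = 0) (_ : ∀ j ≤ N, Integrable ((DD i)^[j] g)),
    FT ((DD i)^[N] g) ζ = (2 * π * Complex.I * ζ i) ^ N * FT g ζ := by
  induction N with
  | zero => intro g _ _ _; simp
  | succ N ih =>
    intro g hg hs hi
    rw [Function.iterate_succ_apply, ih (DD_contDiffOn isOpen_compl_singleton hg i) (DD_supp hs i)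
      (fun j hj => by simpa using hi (j+1) (by omega)), FT_DD hm i (hg.of_le (by norm_cast)) hs (hi 0 (by omega)) (hi 1 (by omega))]
    ring

lemma exists_norm_coord (hm : 1 ≤ m) (ζ : XX m) : ∃ i, ‖ζ‖ = |ζ i| := by
  have : Nonempty (Fin m) := ⟨⟨0, by omega⟩⟩
  obtain ⟨i, hi⟩ := Finite.exists_max (fun i => ‖ζ i‖)
  exact ⟨i, le_antisymm ((pi_norm_le_iff_of_nonneg (norm_nonneg _)).2 hi) (norm_le_pi_norm ζ i)⟩

lemma FT_decay (hm : 2 ≤ m) (N : ℕ) {ρ : ℝ} {g : XX m → ℂ} (hg : ContDiffOn ℝ ∞ g {0}ᶜ)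
    (hs : ∀ x, ρ < ‖x‖ → g x = 0) (hi : ∀ i, ∀ j ≤ N, Integrable ((DD i)^[j] g)) :
    ∃ C, 0 ≤ C ∧ ∀ ζ, (1 + ‖ζ‖) ^ N * ‖FT g ζ‖ ≤ C := by
  refine ⟨2 ^ (N-1) * (∫ x, ‖g x‖) + 2 ^ (N-1) * ∑ i, ∫ x, ‖(DD i)^[N] g x‖, ?_, fun ζ => ?_⟩
  · have : ∀ i, 0 ≤ ∫ x, ‖(DD i)^[N] g x‖ := fun i => integral_nonneg fun _ => norm_nonneg _
    have h2 : 0 ≤ ∫ x, ‖g x‖ := integral_nonneg fun _ => norm_nonneg _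
    have := Finset.sum_nonneg (s := Finset.univ) fun i _ => this i
    positivity
  · obtain ⟨i, hi'⟩ := exists_norm_coord (by omega) ζ
    have h1 : ‖ζ‖ ^ N * ‖FT g ζ‖ ≤ ∑ i, ∫ x, ‖(DD i)^[N] g x‖ := by
      have h := FT_DD_iter hm i N ζ hg hs (hi i)
      have h2 : ‖ζ‖ ^ N * ‖FT g ζ‖ ≤ ‖FT ((DD i)^[N] g) ζ‖ := by
        rw [h, norm_mul, norm_pow, hi']
        gcongr
        simp only [norm_mul, Complex.norm_I, Complex.norm_real, Real.norm_eq_abs, mul_one, Complex.norm_ofNat]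
        rw [abs_of_pos Real.pi_pos]
        nlinarith [abs_nonneg (ζ i), Real.pi_gt_three]
      refine h2.trans ((norm_FT_le _ _).trans ?_)
      exact Finset.single_le_sum (f := fun i => ∫ x, ‖(DD i)^[N] g x‖) (fun i _ => integral_nonneg fun _ => norm_nonneg _) (Finset.mem_univ i)
    have h2 := norm_FT_le g ζ
    have h3 := add_pow_le (zero_le_one' ℝ) (norm_nonneg ζ) N
    calc (1 + ‖ζ‖) ^ N * ‖FT g ζ‖ ≤ (2 ^ (N-1) * (1 ^ N + ‖ζ‖ ^ N)) * ‖FT g ζ‖ := by gcongr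
      _ = 2 ^ (N-1) * ‖FT g ζ‖ + 2 ^ (N-1) * (‖ζ‖ ^ N * ‖FT g ζ‖) := by ring
      _ ≤ _ := by gcongr

lemma coef_eq_FT {g : XX m → ℂ} (hs : ∀ x, x ∉ cell m → g x = 0) (k : KK m) : coef g k = FT g (kr k) := by
  unfold coef FT
  apply setIntegral_eq_integral_of_forall_compl_eq_zero
  intro x hx; simp [hs x hx]

/-- support in the ball of radius ρ -/
def SuppIn (ρ : ℝ) (g : XX m → ℂ) : Prop := ∀ x, ρ < ‖x‖ → g x = 0

lemma SuppIn.cell {ρ : ℝ} (hρ : ρ < 1/2) {g : XX m → ℂ} (h : SuppIn ρ g) (x) (hx : x ∉ cell m) : g x = 0 := by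
  apply h
  simp only [Lawlor.cell, Metric.mem_ball, dist_zero_right, not_lt] at hx
  linarith

lemma SuppIn.hcs {ρ : ℝ} {g : XX m → ℂ} (h : SuppIn ρ g) : HasCompactSupport g := by
  apply HasCompactSupport.intro (isCompact_closedBall (0 : XX m) ρ)
  intro x hx
  apply h
  simpa using hx

lemma SuppIn.DD {ρ : ℝ} {g : XX m → ℂ} (h : SuppIn ρ g) (i : Fin m) : SuppIn ρ (DD i g) := DD_supp h i

lemma DD_contDiff {g : XX m → ℂ} (hg : ContDiff ℝ ∞ g) (i : Fin m) : ContDiff ℝ ∞ (DD i g) := by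
  rw [← contDiffOn_univ] at hg ⊢
  exact DD_contDiffOn isOpen_univ hg i

lemma iter_smooth {g : XX m → ℂ} {ρ : ℝ} (hg : ContDiff ℝ ∞ g) (hs : SuppIn ρ g) (i : Fin m) (j : ℕ) :
    ContDiff ℝ ∞ ((DD i)^[j] g) ∧ SuppIn ρ ((DD i)^[j] g) := by
  induction j with
  | zero => exact ⟨hg, hs⟩
  | succ j ih => rw [Function.iterate_succ_apply']; exact ⟨DD_contDiff ih.1 i, ih.2.DD i⟩

lemma FT_decay_smooth (hm : 2 ≤ m) (N : ℕ) {ρ : ℝ} {g : XX m → ℂ} (hg : ContDiff ℝ ∞ g) (hs : SuppIn ρ g) :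
    ∃ C, 0 ≤ C ∧ ∀ ζ, (1 + ‖ζ‖) ^ N * ‖FT g ζ‖ ≤ C :=
  FT_decay hm N hg.contDiffOn hs fun i j _ => by
    obtain ⟨h1, h2⟩ := iter_smooth hg hs i j
    exact h1.continuous.integrable_of_hasCompactSupport h2.hcs

lemma coef_DD (hm : 2 ≤ m) {ρ : ℝ} (hρ : ρ < 1/2) {g : XX m → ℂ} (hg : ContDiff ℝ 1 g) (hs : SuppIn ρ g) (i : Fin m) (k) :
    coef (DD i g) k = 2 * π * Complex.I * k i * coef g k := by
  rw [coef_eq_FT ((hs.DD i).cell hρ), coef_eq_FT (hs.cell hρ)]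
  have hc : Continuous (DD i g) := by
    rw [← continuousOn_univ]
    exact DD_continuousOn isOpen_univ hg.contDiffOn i
  have := FT_DD hm i hg.contDiffOn hs (hg.continuous.integrable_of_hasCompactSupport hs.hcs)
    (hc.integrable_of_hasCompactSupport (hs.DD i).hcs) (kr k)
  simpa [kr] using this

end decay
end Lawlor

namespace Lawlor
open MeasureTheory Set Filter Topology
open scoped Real ContDiff

noncomputable section tops
variable {m : ℕ}

lemma continuous_FT {g : XX m → ℂ} (hg : Integrable g) : Continuous (FT g) := by
  unfold FT
  apply continuous_of_dominated (bound := fun x => ‖g x‖)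
  · intro ζ; exact (integrable_ech_mul hg _).aestronglyMeasurable
  · intro ζ; simp [norm_ech]
  · exact hg.norm
  · apply ae_of_all; intro x
    exact ((continuous_ech' x).comp continuous_neg).mul continuous_const

/-- smooth with support in the cell -/
structure Good (ψ : XX m → ℂ) : Prop where
  smooth : ContDiff ℝ ∞ ψ
  supp : SuppIn (9/20) ψ

lemma Good.DD {ψ : XX m → ℂ} (h : Good ψ) (i : Fin m) : Good (DD i ψ) := ⟨DD_contDiff h.smooth i, h.supp.DD i⟩

lemma Good.cell {ψ : XX m → ℂ} (h : Good ψ) (x) (hx : x ∉ cell m) : ψ x = 0 := h.supp.cell (by norm_num) x hx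

lemma Good.integrable {ψ : XX m → ℂ} (h : Good ψ) : Integrable ψ :=
  h.smooth.continuous.integrable_of_hasCompactSupport h.supp.hcs

lemma Good.mul {ψ g : XX m → ℂ} (h : Good ψ) (hg : ContDiff ℝ ∞ g) : Good (fun x => g x * ψ x) :=
  ⟨hg.mul h.smooth, fun x hx => by simp [h.supp x hx]⟩

lemma Good.memLp {ψ : XX m → ℂ} (h : Good ψ) : MemLp ψ 2 (volume.restrict (Lawlor.cell m)) := by
  obtain ⟨C, hC⟩ := h.supp.hcs.exists_bound_of_continuous h.smooth.continuous
  exact memLp_of_bdd h.smooth.continuous.continuousOn (fun x _ => hC x) 2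

open Classical in
/-- Wiener coefficients of a function -/
def wc (g : XX m → ℂ) : Wn m := if h : Summable (fun k => ‖coef g k‖) then mkW (coef g) h else 0

lemma co_wc {g : XX m → ℂ} (h : Summable (fun k => ‖coef g k‖)) (k) : co (wc g) k = coef g k := by
  unfold wc; rw [dif_pos h]; rfl

lemma coef_mul_ech {ψ : XX m → ℂ} (h : Good ψ) (ξ : XX m) (k) : coef (fun x => ech ξ x * ψ x) k = FT ψ (kr k - ξ) := by
  rw [coef_eq_FT (fun x hx => by simp [h.cell x hx])]
  unfold FT
  congr 1; ext x
  rw [← mul_assoc, ← ech_add]; congr 2; abel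

lemma kr_sub (k l : KK m) : kr (k - l) = kr k - kr l := by ext i; simp [kr]

lemma FT_bound [hm : Fact (2 ≤ m)] {ψ : XX m → ℂ} (h : Good ψ) : ∃ C, 0 ≤ C ∧ ∀ ξ, ‖ξ‖ ≤ 1 → ∀ k : KK m, ‖FT ψ (kr k - ξ)‖ ≤ C * ((1 + ‖k‖) ^ (m+1))⁻¹ := by
  obtain ⟨C, hC0, hC⟩ := FT_decay_smooth hm.out (m+1) h.smooth h.supp
  refine ⟨2 ^ (m+1) * C, by positivity, fun ξ hξ k => ?_⟩
  have h1 : (1 + ‖k‖) ≤ 2 * (1 + ‖kr k - ξ‖) := by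
    have := norm_sub_norm_le (kr k) ξ
    rw [norm_kr] at this
    linarith [norm_nonneg (kr k - ξ)]
  rw [← div_eq_mul_inv, le_div_iff₀ (by positivity)]
  calc ‖FT ψ (kr k - ξ)‖ * (1 + ‖k‖) ^ (m+1) ≤ ‖FT ψ (kr k - ξ)‖ * (2 * (1 + ‖kr k - ξ‖)) ^ (m+1) := by gcongr
    _ = 2 ^ (m+1) * ((1 + ‖kr k - ξ‖) ^ (m+1) * ‖FT ψ (kr k - ξ)‖) := by rw [mul_pow]; ring
    _ ≤ _ := by gcongr; exact hC _

def flr (ξ : XX m) : KK m := fun i => ⌊ξ i⌋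

lemma norm_flr (ξ : XX m) : ‖ξ - kr (flr ξ)‖ ≤ 1 := by
  rw [pi_norm_le_iff_of_nonneg zero_le_one]
  intro i
  simp only [Pi.sub_apply, kr, flr, Real.norm_eq_abs, Int.self_sub_floor]
  rw [abs_of_nonneg (Int.fract_nonneg _)]
  exact (Int.fract_lt_one _).le

lemma FT_summable [hm : Fact (2 ≤ m)] {ψ : XX m → ℂ} (h : Good ψ) : ∃ M, 0 ≤ M ∧ ∀ ξ, Summable (fun k : KK m => ‖FT ψ (kr k - ξ)‖) ∧ ∑' k : KK m, ‖FT ψ (kr k - ξ)‖ ≤ M := by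
  obtain ⟨C, hC0, hC⟩ := FT_bound h
  have hs := (summable_lattice (m := m) (m+1) (by omega)).mul_left C
  refine ⟨∑' k : KK m, C * ((1 + ‖k‖) ^ (m+1))⁻¹, tsum_nonneg fun k => by positivity, fun ξ => ?_⟩
  have key : (fun k : KK m => ‖FT ψ (kr k - ξ)‖) = (fun k : KK m => ‖FT ψ (kr k - (ξ - kr (flr ξ)))‖) ∘ (Equiv.subRight (flr ξ)) := by
    ext k; simp only [Function.comp, Equiv.subRight_apply, kr_sub]; congr 2; abel
  have hs1 : Summable (fun k : KK m => ‖FT ψ (kr k - (ξ - kr (flr ξ)))‖) :=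
    Summable.of_nonneg_of_le (fun _ => norm_nonneg _) (hC _ (norm_flr ξ)) hs
  rw [key]
  refine ⟨(Equiv.summable_iff _).2 hs1, ?_⟩
  have := (Equiv.subRight (flr ξ)).tsum_eq (fun k : KK m => ‖FT ψ (kr k - (ξ - kr (flr ξ)))‖)
  refine le_trans (le_of_eq this) ?_
  exact hs1.tsum_le_tsum (hC _ (norm_flr ξ)) hs

/-- coefficients of ψ times a character -/
def Ew (ψ : XX m → ℂ) (ξ : XX m) : Wn m := wc (fun x => ech ξ x * ψ x)

lemma co_Ew [hm : Fact (2 ≤ m)] {ψ : XX m → ℂ} (h : Good ψ) (ξ : XX m) (k) : co (Ew ψ ξ) k = FT ψ (kr k - ξ) := by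
  obtain ⟨M, _, hM⟩ := FT_summable h
  unfold Ew
  rw [co_wc]
  · exact coef_mul_ech h ξ k
  · simp only [coef_mul_ech h]; exact (hM ξ).1

lemma norm_Ew [hm : Fact (2 ≤ m)] {ψ : XX m → ℂ} (h : Good ψ) : ∃ M, 0 ≤ M ∧ ∀ ξ, ‖Ew ψ ξ‖ ≤ M := by
  obtain ⟨M, hM0, hM⟩ := FT_summable h
  refine ⟨M, hM0, fun ξ => ?_⟩
  rw [norm_eq_tsum]; simp only [co_Ew h]; exact (hM ξ).2

lemma real_Ew [hm : Fact (2 ≤ m)] {ψ : XX m → ℂ} (h : Good ψ) (ξ : XX m) : EqOn (real (Ew ψ ξ)) (fun x => ech ξ x * ψ x) (cell m) := by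
  have hg : Good (fun x => ech ξ x * ψ x) := h.mul (contDiff_ech ξ)
  refine (eq_real hg.memLp (fun k => ?_) isOpen_cell subset_rfl hg.smooth.continuous.continuousOn).symm
  rw [co_Ew h, coef_mul_ech h]

lemma real_wc [hm : Fact (2 ≤ m)] {ψ : XX m → ℂ} (h : Good ψ) : EqOn (real (wc ψ)) ψ (cell m) := by
  have := real_Ew h 0
  simpa [Ew, ech_zero] using this

lemma Ew_zero (ψ : XX m → ℂ) : Ew ψ 0 = wc ψ := by simp [Ew, ech_zero]

lemma Ew_tendsto [hm : Fact (2 ≤ m)] {ψ : XX m → ℂ} (h : Good ψ) (ζ : XX m) :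
    Tendsto (fun ε : ℝ => Ew ψ (ε • ζ)) (𝓝 0) (𝓝 (wc ψ)) := by
  obtain ⟨C, hC0, hC⟩ := FT_bound h
  have hs := (summable_lattice (m := m) (m+1) (by omega)).mul_left C
  rw [tendsto_iff_norm_sub_tendsto_zero]
  simp only [norm_eq_tsum, co_sub, ← Ew_zero ψ, co_Ew h]
  have := tendsto_tsum_of_dominated_convergence (𝓕 := 𝓝 (0:ℝ)) (f := fun (ε : ℝ) (k : KK m) => ‖FT ψ (kr k - ε • ζ) - FT ψ (kr k - 0)‖) (g := fun _ => 0)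
    (hs.add hs) ?_ ?_
  · simpa using this
  · intro k
    have hc : Continuous (fun ε : ℝ => ‖FT ψ (kr k - ε • ζ) - FT ψ (kr k - 0)‖) := by
      have := continuous_FT h.integrable
      fun_prop
    have := hc.tendsto 0
    simpa using this
  · have : ∀ᶠ ε : ℝ in 𝓝 0, ‖ε • ζ‖ ≤ 1 := by
      have hc : Continuous (fun ε : ℝ => ‖ε • ζ‖) := by fun_prop
      have := hc.tendsto 0
      simp only [zero_smul, norm_zero] at this
      exact (this.eventually_lt_const (by norm_num : (0:ℝ) < 1)).mono fun _ h => h.le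
    filter_upwards [this] with ε hε k
    rw [norm_norm]
    exact (norm_sub_le _ _).trans (add_le_add (hC _ hε k) (hC 0 (by simp) k))

/-- dilate and cut off -/
def TT (ψ : XX m → ℂ) (ε : ℝ) (h : Wn m) : Wn m := ∑' k, co h k • Ew ψ (ε • kr k)

lemma TT_summable [hm : Fact (2 ≤ m)] {ψ : XX m → ℂ} (hψ : Good ψ) (ε : ℝ) (h : Wn m) : Summable (fun k => co h k • Ew ψ (ε • kr k)) := by
  obtain ⟨M, hM0, hM⟩ := norm_Ew hψ
  apply Summable.of_norm_bounded ((summable_co h).mul_right M)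
  intro k; rw [norm_smul]; gcongr; exact hM _

/-- evaluation as continuous linear map -/
def evL (x : XX m) : Wn m →L[ℂ] ℂ := (evx x).toLinearMap.mkContinuous 1 (fun b => by rw [one_mul]; exact norm_real_le b x)

lemma evL_apply (x : XX m) (b : Wn m) : evL x b = real b x := rfl

lemma real_TT [hm : Fact (2 ≤ m)] {ψ : XX m → ℂ} (hψ : Good ψ) (ε : ℝ) (h : Wn m) {x : XX m} (hx : x ∈ cell m) :
    real (TT ψ ε h) x = ψ x * real h (ε • x) := by
  rw [← evL_apply, TT, ContinuousLinearMap.map_tsum _ (TT_summable hψ ε h)]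
  simp only [map_smul, evL_apply, smul_eq_mul]
  unfold real
  rw [← tsum_mul_left]
  congr 1; ext k
  have := real_Ew hψ (ε • kr k) hx
  unfold real at this
  rw [this]; simp only [ech_smul]; ring

lemma TT_tendsto [hm : Fact (2 ≤ m)] {ψ : XX m → ℂ} (hψ : Good ψ) (h : Wn m) :
    Tendsto (fun ε : ℝ => TT ψ ε h) (𝓝 0) (𝓝 (real h 0 • wc ψ)) := by
  obtain ⟨M, hM0, hM⟩ := norm_Ew hψ
  have e : real h 0 • wc ψ = ∑' k, co h k • wc ψ := by
    unfold real
    simp only [ech_zero_right, mul_one]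
    exact ((summable_co h).of_norm.hasSum.smul_const (wc ψ)).tsum_eq.symm
  rw [e]
  apply tendsto_tsum_of_dominated_convergence ((summable_co h).mul_right M)
  · intro k
    exact (Ew_tendsto hψ (kr k)).const_smul _
  · apply Eventually.of_forall; intro ε k
    rw [norm_smul]; gcongr; exact hM _

/-- derivative relation on coefficients -/
def IsD (i : Fin m) (a b : Wn m) : Prop := ∀ k, co b k = 2 * π * Complex.I * k i * co a k

lemma hasFDerivAt_real {a : Wn m} {b : Fin m → Wn m} (h : ∀ i, IsD i a (b i)) (x : XX m) :
    HasFDerivAt (real a) (∑ i, real (b i) x • (Complex.ofRealCLM ∘L (ContinuousLinearMap.proj i : XX m →L[ℝ] ℝ))) x := by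
  have hu : Summable (fun k => ∑ i, ‖co (b i) k‖) := summable_sum fun i _ => summable_co (b i)
  let g' : KK m → XX m → (XX m →L[ℝ] ℂ) := fun k y => ∑ i, (co (b i) k * ech (kr k) y) • (Complex.ofRealCLM ∘L (ContinuousLinearMap.proj i : XX m →L[ℝ] ℝ))
  have hpn : ∀ i : Fin m, ‖Complex.ofRealCLM ∘L (ContinuousLinearMap.proj i : XX m →L[ℝ] ℝ)‖ ≤ 1 := by
    intro i
    apply ContinuousLinearMap.opNorm_le_bound _ zero_le_one
    intro v
    simpa using norm_le_pi_norm v i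
  have hb : ∀ k y, ‖g' k y‖ ≤ ∑ i, ‖co (b i) k‖ := by
    intro k y
    refine (norm_sum_le _ _).trans (Finset.sum_le_sum fun i _ => ?_)
    rw [norm_smul, norm_term]
    exact mul_le_of_le_one_right (norm_nonneg _) (hpn i)
  have hd : ∀ k y, HasFDerivAt (fun y => co a k * ech (kr k) y) (g' k y) y := by
    intro k y
    have := (hasFDerivAt_ech (kr k) y).const_mul (co a k)
    convert! this using 1
    rw [Finset.smul_sum]
    apply Finset.sum_congr rfl
    intro i _
    rw [smul_smul, h i k]
    congr 1
    simp only [smul_eq_mul, kr]; push_cast; ring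
  have := hasFDerivAt_tsum hu hd hb (summable_term a 0) x
  convert! this using 1
  ext v
  have hs : Summable (fun k => g' k x) := Summable.of_norm_bounded hu (fun k => hb k x)
  have e := ContinuousLinearMap.map_tsum (ContinuousLinearMap.apply ℝ ℂ v) hs
  simp only [ContinuousLinearMap.apply_apply] at e
  rw [e]
  simp only [g', sum_apply, smul_apply, smul_eq_mul]
  rw [Summable.tsum_finsetSum]
  · apply Finset.sum_congr rfl
    intro i _
    rw [tsum_mul_right]; rfl
  · intro i _
    exact (summable_term (b i) x).mul_right _

lemma DD_real {a : Wn m} {b : Fin m → Wn m} (h : ∀ i, IsD i a (b i)) (i) (x : XX m) : DD i (real a) x = real (b i) x := by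
  unfold DD
  rw [(hasFDerivAt_real h x).fderiv]
  simp [Pi.single_apply, apply_ite Complex.ofReal]

lemma contDiff_real {a : Wn m} {b : Fin m → Wn m} (h : ∀ i, IsD i a (b i)) : ContDiff ℝ 1 (real a) := by
  rw [contDiff_one_iff_fderiv]
  refine ⟨fun x => (hasFDerivAt_real h x).differentiableAt, ?_⟩
  have : fderiv ℝ (real a) = fun x => ∑ i, real (b i) x • (Complex.ofRealCLM ∘L (ContinuousLinearMap.proj i : XX m →L[ℝ] ℝ)) :=
    funext fun x => (hasFDerivAt_real h x).fderiv
  rw [this]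
  exact continuous_finsetSum _ fun i _ => (continuous_real (b i)).smul continuous_const

lemma isD_of_fun [hm : Fact (2 ≤ m)] {g : XX m → ℂ} (hg : ContDiff ℝ 1 g) (hs : SuppIn (9/20) g) {i : Fin m} {a b : Wn m}
    (ha : EqOn (real a) g (cell m)) (hb : EqOn (real b) (DD i g) (cell m)) : IsD i a b := by
  intro k
  rw [← coef_real, ← coef_real, coef_congr ha, coef_congr hb]
  exact coef_DD hm.out (by norm_num) hg hs i k

end tops
end Lawlor

namespace Lawlor
open MeasureTheory Set Filter Topology
open scoped Real ContDiff

/-- jet indices -/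
abbrev JJ (m : ℕ) := Unit ⊕ (Fin m ⊕ (Fin m × Fin m))

noncomputable section ellip
variable {m : ℕ}

abbrev jU : JJ m := Sum.inl ()
abbrev jP (i : Fin m) : JJ m := Sum.inr (Sum.inl i)
abbrev jA (i j : Fin m) : JJ m := Sum.inr (Sum.inr (i, j))

/-- symbol of a derivative -/
def dk (i : Fin m) (k : KK m) : ℂ := 2 * π * Complex.I * k i

lemma norm_dk_le (i : Fin m) (k : KK m) : ‖dk i k‖ ≤ 2 * π * ‖k‖ := by
  unfold dk
  simp only [norm_mul, Complex.norm_I, Complex.norm_real, Real.norm_eq_abs, mul_one, Complex.norm_ofNat, abs_of_pos Real.pi_pos]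
  gcongr
  have := norm_le_pi_norm k i
  rw [Int.norm_eq_abs] at this
  refine le_trans (le_of_eq ?_) this
  simp [Complex.norm_intCast]

lemma dk_zero (i : Fin m) : dk i 0 = 0 := by simp [dk]

/-- symbol of a jet component -/
def ds : JJ m → KK m → ℂ
  | Sum.inl _, _ => 1
  | Sum.inr (Sum.inl i), k => dk i k
  | Sum.inr (Sum.inr (i, j)), k => dk i k * dk j k

/-- symbol of the second order operator -/
def sg (a : Fin m → Fin m → ℂ) (k : KK m) : ℂ := ∑ i, ∑ j, a i j * (dk i k * dk j k)

def Ell (a : Fin m → Fin m → ℂ) (c0 : ℝ) : Prop := 0 < c0 ∧ ∀ k : KK m, c0 * ‖k‖ ^ 2 ≤ ‖sg a k‖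

lemma sg_zero (a : Fin m → Fin m → ℂ) : sg a 0 = 0 := by simp [sg, dk_zero]

lemma one_le_norm {k : KK m} (hk : k ≠ 0) : 1 ≤ ‖k‖ := by
  obtain ⟨i, hi⟩ := Function.ne_iff.1 hk
  have h1 : (1:ℝ) ≤ ‖k i‖ := by
    rw [Int.norm_eq_abs]
    have : (1:ℤ) ≤ |k i| := Int.one_le_abs hi
    exact_mod_cast this
  exact h1.trans (norm_le_pi_norm k i)

lemma Ell.ne {a : Fin m → Fin m → ℂ} {c0 : ℝ} (h : Ell a c0) {k : KK m} (hk : k ≠ 0) : sg a k ≠ 0 := by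
  have h1 := one_le_norm hk
  have h2 := h.2 k
  intro h0
  rw [h0, norm_zero] at h2
  have h3 := h.1
  have : 0 < c0 * ‖k‖ ^ 2 := by positivity
  linarith

lemma ds_bound {a : Fin m → Fin m → ℂ} {c0 : ℝ} (h : Ell a c0) : ∃ C, 0 ≤ C ∧ ∀ (α : JJ m) (k : KK m), k ≠ 0 → ‖ds α k‖ ≤ C * ‖sg a k‖ := by
  have hc := h.1
  have hpi := Real.pi_gt_three
  refine ⟨(2*π)^2 / c0, by positivity, fun α k hk => ?_⟩
  have h1 := one_le_norm hk
  have h2 : ‖ds α k‖ ≤ (2*π)^2 * ‖k‖^2 := by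
    rcases α with _ | i | ⟨i, j⟩
    · simp only [ds, norm_one]
      nlinarith [mul_le_mul h1 h1 zero_le_one (by positivity)]
    · refine (norm_dk_le i k).trans ?_
      have : 2 * π * ‖k‖ ≤ (2 * π * ‖k‖) * (2 * π * ‖k‖) := le_mul_of_one_le_right (by positivity) (by nlinarith)
      nlinarith
    · simp only [ds, norm_mul]
      calc _ ≤ (2 * π * ‖k‖) * (2 * π * ‖k‖) := mul_le_mul (norm_dk_le i k) (norm_dk_le j k) (norm_nonneg _) (by positivity)
        _ = _ := by ring
  calc ‖ds α k‖ ≤ (2*π)^2 * ‖k‖^2 := h2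
    _ = (2*π)^2/c0 * (c0 * ‖k‖^2) := by field_simp
    _ ≤ _ := by gcongr; exact h.2 k

/-- Fourier multiplier -/
def mult (μ : KK m → ℂ) (hμ : ∃ C, ∀ k, ‖μ k‖ ≤ C) : Wn m →L[ℂ] Wn m :=
  LinearMap.mkContinuousOfExistsBound
    { toFun := fun b => mkW (fun k => μ k * co b k) (by
        obtain ⟨C, hC⟩ := hμ
        refine Summable.of_nonneg_of_le (fun _ => norm_nonneg _) (fun k => ?_) ((summable_co b).mul_left C)
        rw [norm_mul]; gcongr; exact hC k)
      map_add' := fun a b => by ext k; simp only [co_mkW, co_add]; ring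
      map_smul' := fun c b => by ext k; simp only [co_mkW, co_smul, RingHom.id_apply]; ring }
    (by
      obtain ⟨C, hC⟩ := hμ
      refine ⟨C, fun b => ?_⟩
      simp only [LinearMap.coe_mk, AddHom.coe_mk, norm_eq_tsum]
      rw [← tsum_mul_left]
      have hle : ∀ k, ‖μ k * co b k‖ ≤ C * ‖co b k‖ := fun k => by
        rw [norm_mul]; gcongr; exact hC k
      exact Summable.tsum_le_tsum hle (Summable.of_nonneg_of_le (fun _ => norm_nonneg _) hle ((summable_co b).mul_left C)) ((summable_co b).mul_left C))

lemma co_mult (μ : KK m → ℂ) (hμ) (b : Wn m) (k) : co (mult μ hμ b) k = μ k * co b k := rfl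

/-- the outer part of the cell -/
def outr (m : ℕ) : Set (XX m) := cell m ∩ {x | 9/20 < ‖x‖}

lemma isOpen_outr : IsOpen (outr m) := isOpen_cell.inter (isOpen_lt continuous_const continuous_norm)

lemma outr_pos [hm : Fact (2 ≤ m)] : 0 < volume.real (outr m) := by
  have : Nonempty (Fin m) := ⟨⟨0, by have := hm.out; omega⟩⟩
  rw [measureReal_def]
  apply ENNReal.toReal_pos
  · apply (isOpen_outr.measure_pos volume ⟨fun _ => (19/40 : ℝ), ?_, ?_⟩).ne'
    · simp only [cell, Metric.mem_ball, dist_zero_right, pi_norm_const]; norm_num [abs_of_pos]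
    · simp only [Set.mem_ofPred_eq, pi_norm_const]; norm_num [abs_of_pos]
  · exact ((measure_mono inter_subset_left).trans_lt (by rw [volume_cell]; exact ENNReal.one_lt_top)).ne

/-- average over the outer part -/
def ellf (g : XX m → ℂ) : ℂ := (volume.real (outr m))⁻¹ * ∫ x in outr m, g x

lemma outr_sub : outr m ⊆ cell m := inter_subset_left

lemma intOn_outr {g : XX m → ℂ} (hg : MemLp g 2 (volume.restrict (cell m))) : IntegrableOn g (outr m) :=
  IntegrableOn.mono_set (hg.integrable (by norm_num)) outr_sub

lemma ellf_add {g h : XX m → ℂ} (hg : MemLp g 2 (volume.restrict (cell m))) (hh : MemLp h 2 (volume.restrict (cell m))) :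
    ellf (fun x => g x + h x) = ellf g + ellf h := by
  unfold ellf
  rw [integral_add (intOn_outr hg) (intOn_outr hh)]; ring

lemma ellf_smul (c : ℂ) (g : XX m → ℂ) : ellf (fun x => c * g x) = c * ellf g := by
  unfold ellf
  rw [integral_const_mul]; ring

lemma ellf_const [hm : Fact (2 ≤ m)] (c : ℂ) : ellf (fun _ : XX m => c) = c := by
  unfold ellf
  have := (outr_pos (m := m)).ne'
  rw [setIntegral_const, Complex.real_smul, ← mul_assoc, Complex.ofReal_inv, inv_mul_cancel₀ (by exact_mod_cast this), one_mul]

lemma ellf_zero_of {g : XX m → ℂ} (hg : ∀ x ∈ outr m, g x = 0) : ellf g = 0 := by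
  unfold ellf
  rw [setIntegral_congr_fun isOpen_outr.measurableSet (g := fun _ => 0) hg]; simp

lemma norm_ellf_le [hm : Fact (2 ≤ m)] {g : XX m → ℂ} {C : ℝ} (hg : ∀ x ∈ outr m, ‖g x‖ ≤ C) : ‖ellf g‖ ≤ C := by
  unfold ellf
  have hp := outr_pos (m := m)
  have hf : volume (outr m) < ⊤ := (measure_mono inter_subset_left).trans_lt (by rw [volume_cell]; exact ENNReal.one_lt_top)
  have := norm_setIntegral_le_of_norm_le_const hf hg
  rw [norm_mul, Complex.norm_real, norm_inv, Real.norm_eq_abs, abs_of_pos hp]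
  rw [inv_mul_le_iff₀ hp]; linarith

lemma ellf_sq_le [hm : Fact (2 ≤ m)] {g : XX m → ℂ} (hg : MemLp g 2 (volume.restrict (cell m))) :
    ‖ellf g‖ ^ 2 ≤ ((volume.real (outr m))⁻¹) ^ 2 * ∫ x in cell m, ‖g x‖ ^ 2 := by
  unfold ellf
  have hp := outr_pos (m := m)
  rw [norm_mul, Complex.norm_real, norm_inv, Real.norm_eq_abs, abs_of_pos hp, mul_pow]
  gcongr
  have hi := (hg.integrable (by norm_num : (1:ENNReal) ≤ 2)).norm
  have h1 : ‖∫ x in outr m, g x‖ ≤ ∫ x in cell m, ‖g x‖ :=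
    (norm_integral_le_integral_norm _).trans (setIntegral_mono_set hi (ae_of_all _ fun _ => norm_nonneg _) (LE.le.eventuallyLE outr_sub))
  have hsq : Integrable (fun x => ‖g x‖ ^ 2) (volume.restrict (cell m)) := (memLp_two_iff_integrable_sq_norm hg.1).1 hg
  set A := ∫ x in cell m, ‖g x‖ with hA
  have hA0 : 0 ≤ A := integral_nonneg fun _ => norm_nonneg _
  have h2 : 0 ≤ ∫ x in cell m, (‖g x‖ - A) ^ 2 := integral_nonneg fun _ => sq_nonneg _
  have h3 : ∫ x in cell m, (‖g x‖ - A) ^ 2 = (∫ x in cell m, ‖g x‖ ^ 2) - A ^ 2 := by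
    have : ∀ x, (‖g x‖ - A) ^ 2 = ‖g x‖ ^ 2 - (2 * A) * ‖g x‖ + A ^ 2 := fun x => by ring
    simp only [this]
    have hs2 : Integrable (fun x => ‖g x‖ ^ 2 - (2 * A) * ‖g x‖) (volume.restrict (cell m)) := hsq.sub (hi.const_mul _)
    rw [integral_add hs2 (integrable_const _), integral_sub hsq (hi.const_mul _), integral_const_mul, ← hA]
    simp; ring
  calc ‖∫ x in outr m, g x‖ ^ 2 ≤ A ^ 2 := by gcongr
    _ ≤ _ := by linarith

/-- the average functional on the Wiener algebra -/
def ellW [hm : Fact (2 ≤ m)] : Wn m →L[ℂ] ℂ :=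
  LinearMap.mkContinuous
    { toFun := fun b => ellf (real b)
      map_add' := fun a b => by
        rw [← ellf_add (memLp_real a 2) (memLp_real b 2)]; congr 1; ext x; exact real_add a b x
      map_smul' := fun c b => by
        simp only [RingHom.id_apply, smul_eq_mul]
        rw [← ellf_smul]; congr 1; ext x; exact real_smul c b x } 1
    (fun b => by
      rw [one_mul]
      exact norm_ellf_le fun x _ => norm_real_le b x)

lemma ellW_apply [hm : Fact (2 ≤ m)] (b : Wn m) : ellW b = ellf (real b) := rfl

lemma ellW_one [hm : Fact (2 ≤ m)] : ellW (1 : Wn m) = 1 := by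
  rw [ellW_apply]
  have : real (1 : Wn m) = fun _ => 1 := funext real_one
  rw [this, ellf_const]

/-- coefficient functional -/
def coL (k : KK m) : Wn m →L[ℂ] ℂ :=
  LinearMap.mkContinuous { toFun := fun b => co b k, map_add' := fun a b => rfl, map_smul' := fun c b => rfl } 1
    (fun b => by rw [one_mul]; exact norm_co_le b k)

lemma mu_bd {a : Fin m → Fin m → ℂ} {c0 : ℝ} (h : Ell a c0) (α : JJ m) : ∃ C, ∀ k, ‖ds α k * (sg a k)⁻¹‖ ≤ C := by
  obtain ⟨C, hC0, hC⟩ := ds_bound h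
  refine ⟨C, fun k => ?_⟩
  by_cases hk : k = 0
  · rw [hk, sg_zero]; simpa using hC0
  · rw [norm_mul, norm_inv, ← div_eq_mul_inv, div_le_iff₀ (norm_pos_iff.2 (h.ne hk))]
    exact hC α k hk

/-- solution operators: jets of the solution -/
def Rop [hm : Fact (2 ≤ m)] {a : Fin m → Fin m → ℂ} {c0 : ℝ} (h : Ell a c0) : JJ m → Wn m →L[ℂ] Wn m
  | Sum.inl u => mult _ (mu_bd h (Sum.inl u)) + (coL 0 - ellW.comp (mult _ (mu_bd h (Sum.inl u)))).smulRight 1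
  | Sum.inr β => mult _ (mu_bd h (Sum.inr β))

section
variable [hm : Fact (2 ≤ m)] {a : Fin m → Fin m → ℂ} {c0 : ℝ} (h : Ell a c0)

lemma co_Rop_ne (α : JJ m) (b : Wn m) {k : KK m} (hk : k ≠ 0) : co (Rop h α b) k = ds α k * (sg a k)⁻¹ * co b k := by
  rcases α with u | β
  · show co (mult _ (mu_bd h (Sum.inl u)) b + (coL 0 b - ellW (mult _ (mu_bd h (Sum.inl u)) b)) • (1 : Wn m)) k = _
    rw [co_add, co_smul, co_one, if_neg hk, co_mult]; ring
  · rfl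

lemma co_Rop_zero (β) (b : Wn m) : co (Rop h (Sum.inr β) b) 0 = 0 := by
  show ds (Sum.inr β) 0 * (sg a 0)⁻¹ * co b 0 = 0
  rw [sg_zero]; simp

lemma ellW_Rop (b : Wn m) : ellW (Rop h jU b) = co b 0 := by
  show ellW (mult _ (mu_bd h (Sum.inl ())) b + (coL 0 b - ellW (mult _ (mu_bd h (Sum.inl ())) b)) • (1 : Wn m)) = _
  rw [map_add, map_smul, ellW_one, smul_eq_mul, mul_one, add_sub_cancel]; rfl

lemma isD_Rop1 (b : Wn m) (i : Fin m) : IsD i (Rop h jU b) (Rop h (jP i) b) := by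
  intro k
  by_cases hk : k = 0
  · rw [hk, co_Rop_zero]; simp
  · rw [co_Rop_ne h _ _ hk, co_Rop_ne h _ _ hk]; simp only [ds, dk]; ring

lemma isD_Rop2 (b : Wn m) (i j : Fin m) : IsD j (Rop h (jP i) b) (Rop h (jA i j) b) := by
  intro k
  by_cases hk : k = 0
  · rw [hk, co_Rop_zero]; simp
  · rw [co_Rop_ne h _ _ hk, co_Rop_ne h _ _ hk]; simp only [ds, dk]; ring

lemma Rop_eq (b : Wn m) : b = ∑ i, ∑ j, a i j • Rop h (jA i j) b + co b 0 • 1 := by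
  ext k
  simp only [co_add, co_sum, co_smul, co_one]
  by_cases hk : k = 0
  · rw [hk]; simp [co_Rop_zero]
  · simp only [co_Rop_ne h _ _ hk, if_neg hk, mul_zero, add_zero, ds]
    have := h.ne hk
    have e : ∀ i j, a i j * (dk i k * dk j k * (sg a k)⁻¹ * co b k) = a i j * (dk i k * dk j k) * ((sg a k)⁻¹ * co b k) := by
      intros; ring
    simp only [e, ← Finset.sum_mul]
    rw [show (∑ i, ∑ j, a i j * (dk i k * dk j k)) = sg a k from rfl, ← mul_assoc, mul_inv_cancel₀ this, one_mul]

lemma Rop_inv {z : JJ m → Wn m} (hz : ∀ α k, co (z α) k = ds α k * co (z jU) k) (hl : ellW (z jU) = 0) (α : JJ m) :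
    Rop h α (∑ i, ∑ j, a i j • z (jA i j)) = z α := by
  have hb : ∀ k, co (∑ i, ∑ j, a i j • z (jA i j)) k = sg a k * co (z jU) k := by
    intro k
    simp only [co_sum, co_smul, hz (jA _ _) k, sg, Finset.sum_mul, ds]
    apply Finset.sum_congr rfl; intro i _; apply Finset.sum_congr rfl; intro j _; ring
  have hne : ∀ α k, k ≠ 0 → co (Rop h α (∑ i, ∑ j, a i j • z (jA i j))) k = co (z α) k := by
    intro α k hk
    rw [co_Rop_ne h _ _ hk, hb, hz α k]
    have := h.ne hk
    field_simp
  rcases α with u | β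
  · -- difference is a constant
    have hd : Rop h jU (∑ i, ∑ j, a i j • z (jA i j)) - z jU = (co (Rop h jU (∑ i, ∑ j, a i j • z (jA i j)) - z jU) 0) • 1 := by
      ext k
      by_cases hk : k = 0
      · rw [hk, co_smul, co_one]; simp
      · rw [co_sub, hne _ k hk, co_smul, co_one, if_neg hk]; simp
    have h2 := congrArg ellW hd
    rw [map_sub, ellW_Rop, hl, hb, sg_zero, map_smul, ellW_one] at h2
    simp only [zero_mul, sub_zero, smul_eq_mul, mul_one] at h2
    rw [← h2, zero_smul, sub_eq_zero] at hd
    exact hd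
  · ext k
    by_cases hk : k = 0
    · rw [hk, co_Rop_zero, hz]
      rcases β with i | ⟨i, j⟩ <;> simp [ds, dk_zero]
    · exact hne _ k hk

end
end ellip
end Lawlor

namespace Lawlor
open MeasureTheory Set Filter Topology
open scoped Real ContDiff
noncomputable section uniq
variable {m : ℕ}

lemma intEch {g : XX m → ℂ} (hg : MemLp g 2 (volume.restrict (cell m))) (k : KK m) :
    Integrable (fun x => ech (-kr k) x * g x) (volume.restrict (cell m)) :=
  (hg.integrable (by norm_num)).bdd_mul (c := 1) (continuous_ech _).aestronglyMeasurable (ae_of_all _ fun x => (norm_ech _ _).le)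

lemma coef_lin {ι : Type*} (s : Finset ι) (c : ι → ℂ) {g : ι → XX m → ℂ}
    (hg : ∀ i, MemLp (g i) 2 (volume.restrict (cell m))) (k : KK m) :
    coef (fun x => ∑ i ∈ s, c i * g i x) k = ∑ i ∈ s, c i * coef (g i) k := by
  unfold coef
  simp only [Finset.mul_sum]
  rw [integral_finsetSum]
  · apply Finset.sum_congr rfl; intro i _
    rw [← integral_const_mul]; congr 1; ext x; ring
  · intro i _
    have := (intEch (hg i) k).const_mul (c i)
    refine this.congr (ae_of_all _ fun x => ?_)
    simp only; ring

lemma coef_const (c : ℂ) (k : KK m) : coef (fun _ => c) k = if k = 0 then c else 0 := by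
  unfold coef
  rw [integral_mul_const, ← kr_neg, integral_ech]
  simp

lemma coef_add {g h : XX m → ℂ} (hg : MemLp g 2 (volume.restrict (cell m))) (hh : MemLp h 2 (volume.restrict (cell m))) (k) :
    coef (fun x => g x + h x) k = coef g k + coef h k := by
  unfold coef
  rw [← integral_add (intEch hg k) (intEch hh k)]
  simp only [mul_add]

lemma memLp_constC (c : ℂ) : MemLp (fun _ : XX m => c) 2 (volume.restrict (cell m)) :=
  memLp_of_bdd continuousOn_const (C := ‖c‖) (fun _ _ => le_rfl) 2

lemma coef_le {g : XX m → ℂ} (hg : MemLp g 2 (volume.restrict (cell m))) (k) :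
    ‖coef g k‖ ^ 2 ≤ ∫ x in cell m, ‖g x‖ ^ 2 :=
  le_hasSum (parseval hg) k (fun _ _ => sq_nonneg _)

lemma compareL {g h : XX m → ℂ} (hg : MemLp g 2 (volume.restrict (cell m))) (hh : MemLp h 2 (volume.restrict (cell m)))
    {K e : ℝ} (H : ∀ k, ‖coef g k‖ ^ 2 ≤ K * ‖coef h k‖ ^ 2 + if k = 0 then e else 0) :
    ∫ x in cell m, ‖g x‖ ^ 2 ≤ K * (∫ x in cell m, ‖h x‖ ^ 2) + e :=
  hasSum_le H (parseval hg) (((parseval hh).mul_left K).add (hasSum_ite_eq 0 e))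

theorem uniq_small [hm : Fact (2 ≤ m)] {a : Fin m → Fin m → ℂ} {c0 : ℝ} (h : Ell a c0) :
    ∃ cs : ℝ, 0 < cs ∧ ∀ d : JJ m → XX m → ℂ, (∀ α, ContinuousOn (d α) (cell m)) →
      (∀ α, MemLp (d α) 2 (volume.restrict (cell m))) →
      (∀ α k, coef (d α) k = ds α k * coef (d jU) k) →
      (∀ x ∈ cell m, ‖∑ i, ∑ j, a i j * d (jA i j) x + ellf (d jU)‖ ≤ cs * ∑ α, ‖d α x‖) →
      ∀ x ∈ cell m, d jU x = 0 := by
  obtain ⟨K, hK0, hK⟩ := ds_bound h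
  set V := (volume.real (outr m))⁻¹ with hV
  set Q := K ^ 2 + (2 + 2 * (V ^ 2 * K ^ 2)) with hQ
  have hQ0 : 0 < Q := by positivity
  set n : ℝ := (Fintype.card (JJ m) : ℝ) with hn
  have hn0 : 0 < n := by rw [hn]; exact_mod_cast Fintype.card_pos
  refine ⟨Real.sqrt (1 / (2 * n ^ 2 * Q)), Real.sqrt_pos.2 (by positivity), ?_⟩
  intro d hcont hL hco hineq
  set cs := Real.sqrt (1 / (2 * n ^ 2 * Q)) with hcs
  have hcs2 : cs ^ 2 = 1 / (2 * n ^ 2 * Q) := Real.sq_sqrt (by positivity)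
  set β := ellf (d jU) with hβ
  set D0 := coef (d jU) 0 with hD0
  set g0 : XX m → ℂ := fun x => ∑ p ∈ (Finset.univ : Finset (Fin m × Fin m)), a p.1 p.2 * d (jA p.1 p.2) x with hg0
  have hg0L : MemLp g0 2 (volume.restrict (cell m)) := memLp_finsetSum _ (fun p _ => (hL _).const_mul _)
  set Lb : XX m → ℂ := fun x => g0 x + β with hLb
  have hLbL : MemLp Lb 2 (volume.restrict (cell m)) := hg0L.add (memLp_constC β)
  have hLbx : ∀ x, Lb x = ∑ i, ∑ j, a i j * d (jA i j) x + β := by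
    intro x
    rw [hLb, hg0]; simp only; rw [Fintype.sum_prod_type]
  have hcoLb : ∀ k, coef Lb k = sg a k * coef (d jU) k + if k = 0 then β else 0 := by
    intro k
    rw [hLb, coef_add hg0L (memLp_constC β), coef_const, hg0, coef_lin Finset.univ (fun p : Fin m × Fin m => a p.1 p.2) (fun p : Fin m × Fin m => hL (jA p.1 p.2)), Fintype.sum_prod_type]
    congr 1
    simp only [hco (jA _ _) k, sg, Finset.sum_mul, ds]
    apply Finset.sum_congr rfl; intro i _; apply Finset.sum_congr rfl; intro j _; ring
  set X := ∫ x in cell m, ‖Lb x‖ ^ 2 with hX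
  have hX0 : 0 ≤ X := integral_nonneg fun _ => sq_nonneg _
  have hβX : ‖β‖ ^ 2 ≤ X := by
    have := coef_le hLbL 0
    rw [hcoLb, sg_zero] at this; simpa using this
  have hne : ∀ α k, k ≠ 0 → ‖coef (d α) k‖ ^ 2 ≤ K ^ 2 * ‖coef Lb k‖ ^ 2 := by
    intro α k hk
    rw [hco, hcoLb, if_neg hk, add_zero, norm_mul, norm_mul, ← mul_pow, ← mul_assoc]
    gcongr
    exact hK α k hk
  -- the mean-free part
  set d0 : XX m → ℂ := fun x => d jU x + (-D0) with hd0
  have hd0L : MemLp d0 2 (volume.restrict (cell m)) := (hL jU).add (memLp_constC _)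
  have hd0X : ∫ x in cell m, ‖d0 x‖ ^ 2 ≤ K ^ 2 * X := by
    have := compareL (K := K ^ 2) (e := 0) hd0L hLbL (fun k => by
      rw [hd0, coef_add (hL jU) (memLp_constC _), coef_const]
      by_cases hk : k = 0
      · rw [hk]; simp only [if_true, ← hD0]
        have : 0 ≤ K ^ 2 * ‖coef Lb 0‖ ^ 2 := by positivity
        simpa using this
      · rw [if_neg hk, if_neg hk, add_zero, add_zero]; exact hne jU k hk)
    simpa using this
  have hD0b : D0 = β - ellf d0 := by
    have : ellf d0 = β + (-D0) := by
      rw [hd0, ellf_add (hL jU) (memLp_constC _), ellf_const]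
    rw [this]; ring
  have hD0X : ‖D0‖ ^ 2 ≤ (2 + 2 * (V ^ 2 * K ^ 2)) * X := by
    have h1 := ellf_sq_le hd0L
    have h2 : ‖ellf d0‖ ^ 2 ≤ V ^ 2 * (K ^ 2 * X) := h1.trans (by gcongr)
    have h3 : ‖D0‖ ≤ ‖β‖ + ‖ellf d0‖ := by rw [hD0b]; exact norm_sub_le _ _
    have h4 : ‖D0‖ ^ 2 ≤ (‖β‖ + ‖ellf d0‖) ^ 2 := by gcongr
    nlinarith [sq_nonneg (‖β‖ - ‖ellf d0‖)]
  have hdX : ∀ α, ∫ x in cell m, ‖d α x‖ ^ 2 ≤ Q * X := by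
    intro α
    have := compareL (K := K ^ 2) (e := ‖D0‖ ^ 2) (hL α) hLbL (fun k => by
      by_cases hk : k = 0
      · rw [if_pos hk, hk, hco]
        have h5 : 0 ≤ K ^ 2 * ‖coef Lb 0‖ ^ 2 := by positivity
        rcases α with u | i | ⟨i, j⟩
        · simp only [ds, one_mul]; linarith
        · simp only [ds, dk_zero, zero_mul, norm_zero]; nlinarith [sq_nonneg ‖D0‖]
        · simp only [ds, dk_zero, zero_mul, norm_zero]; nlinarith [sq_nonneg ‖D0‖]
      · rw [if_neg hk, add_zero]; exact hne α k hk)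
    rw [hQ]; nlinarith
  have hsqi : ∀ α, Integrable (fun x => ‖d α x‖ ^ 2) (volume.restrict (cell m)) := fun α =>
    (memLp_two_iff_integrable_sq_norm (hL α).1).1 (hL α)
  have hXle : X ≤ cs ^ 2 * (n * (n * (Q * X))) := by
    have h1 : X ≤ ∫ x in cell m, cs ^ 2 * (n * ∑ α, ‖d α x‖ ^ 2) := by
      rw [hX]
      apply setIntegral_mono_on ((memLp_two_iff_integrable_sq_norm hLbL.1).1 hLbL)
        (((integrable_finsetSum _ fun α _ => hsqi α).const_mul _).const_mul _) isOpen_cell.measurableSet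
      intro x hx
      have h2 := hineq x hx
      rw [← hLbx] at h2
      calc ‖Lb x‖ ^ 2 ≤ (cs * ∑ α, ‖d α x‖) ^ 2 := by gcongr
        _ = cs ^ 2 * (∑ α, ‖d α x‖) ^ 2 := by ring
        _ ≤ _ := by
          gcongr
          have := sq_sum_le_card_mul_sum_sq (s := Finset.univ) (f := fun α => ‖d α x‖)
          simpa [hn] using this
    refine h1.trans ?_
    rw [integral_const_mul, integral_const_mul, integral_finsetSum _ fun α _ => hsqi α]
    gcongr
    calc ∑ α, ∫ x in cell m, ‖d α x‖ ^ 2 ≤ ∑ α : JJ m, Q * X := Finset.sum_le_sum fun α _ => hdX α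
      _ = n * (Q * X) := by rw [Finset.sum_const, nsmul_eq_mul]; rfl
  have hXz : X = 0 := by
    rw [hcs2] at hXle
    have : 1 / (2 * n ^ 2 * Q) * (n * (n * (Q * X))) = X / 2 := by field_simp
    rw [this] at hXle; linarith
  have hcz : ∀ k, coef (d jU) k = co (0 : Wn m) k := by
    intro k
    have h1 := (coef_le (hL jU) k).trans (hdX jU)
    rw [hXz, mul_zero] at h1
    rw [co_zero]
    have : ‖coef (d jU) k‖ ^ 2 = 0 := le_antisymm h1 (sq_nonneg _)
    simpa using this
  intro x hx
  have := eq_real (hL jU) hcz isOpen_cell subset_rfl (hcont jU) hx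
  rw [this, real_zero]

end uniq
end Lawlor

namespace Lawlor
open MeasureTheory Set Filter Topology
open scoped Real ContDiff
noncomputable section transf
variable {m : ℕ} {A B : Type*} [CommRing A] [CommRing B]

/-- push a jet forward -/
def psh (lam e1 : Fin m → A) (e2 : Fin m → Fin m → A) (z : JJ m → A) : JJ m → A
  | Sum.inl _ => z jU
  | Sum.inr (Sum.inl i) => z (jP i) + e1 i * ∑ l, lam l * z (jP l)
  | Sum.inr (Sum.inr (i, j)) => z (jA i j) + e1 j * (∑ l, lam l * z (jA i l)) + e1 i * (∑ l, lam l * z (jA l j))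
      + e1 i * e1 j * (∑ l, lam l * ∑ k, lam k * z (jA l k)) + (∑ l, lam l * z (jP l)) * e2 i j

/-- pull a jet back -/
def tr (J : A) (lam e1 : Fin m → A) (e2 : Fin m → Fin m → A) (w : JJ m → A) : JJ m → A
  | Sum.inl _ => w jU
  | Sum.inr (Sum.inl i) => w (jP i) - J * (e1 i * ∑ l, lam l * w (jP l))
  | Sum.inr (Sum.inr (i, j)) =>
      let q := J * ∑ l, lam l * w (jP l)
      w (jA i j) - q * e2 i j - J * (e1 j * (∑ l, lam l * (w (jA i l) - q * e2 i l)))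
       - J * (e1 i * (∑ l, lam l * (w (jA l j) - q * e2 l j)))
       + J * J * (e1 i * e1 j * (∑ l, lam l * ∑ k, lam k * (w (jA l k) - q * e2 l k)))

lemma tr_zero (J : A) (e1 : Fin m → A) (e2) (w : JJ m → A) : tr J 0 e1 e2 w = w := by
  funext α
  rcases α with u | i | ⟨i, j⟩ <;> simp [tr]

lemma map_tr (φ : A →+* B) (J : A) (lam e1 : Fin m → A) (e2) (w : JJ m → A) (α) :
    φ (tr J lam e1 e2 w α) = tr (φ J) (fun i => φ (lam i)) (fun i => φ (e1 i)) (fun i j => φ (e2 i j)) (fun α => φ (w α)) α := by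
  rcases α with u | i | ⟨i, j⟩ <;> simp [tr, map_sum]

lemma tr_sub (J : A) (lam e1 : Fin m → A) (e2) (w w' : JJ m → A) (α) :
    tr J lam e1 e2 w α - tr J lam e1 e2 w' α = tr J lam e1 e2 (fun α => w α - w' α) α := by
  rcases α with u | i | ⟨i, j⟩
  · simp [tr]
  · simp only [tr, mul_sub, Finset.sum_sub_distrib]; ring
  · simp only [tr, mul_sub, sub_mul, Finset.sum_sub_distrib]; ring

lemma tr_smul (c : A) (J : A) (lam e1 : Fin m → A) (e2) (w : JJ m → A) (α) :
    tr J lam e1 e2 (fun α => c * w α) α = c * tr J lam e1 e2 w α := by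
  have h : ∀ f : Fin m → A, ∑ l, lam l * (c * f l) = c * ∑ l, lam l * f l := by
    intro f; rw [Finset.mul_sum]; apply Finset.sum_congr rfl; intros; ring
  rcases α with u | i | ⟨i, j⟩
  · simp [tr]
  · simp only [tr, h]; ring
  · have e : ∀ i j, c * w (jA i j) - J * (c * ∑ l, lam l * w (jP l)) * e2 i j = c * (w (jA i j) - J * (∑ l, lam l * w (jP l)) * e2 i j) := by
      intros; ring
    simp only [tr, h, e]; ring

lemma tr_psh (J : A) (lam e1 : Fin m → A) (e2) (z : JJ m → A) (hJ : J * (1 + ∑ l, lam l * e1 l) = 1) :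
    tr J lam e1 e2 (psh lam e1 e2 z) = z := by
  set s := ∑ l, lam l * e1 l with hs
  set p := ∑ l, lam l * z (jP l) with hp
  have h1 : ∑ l, lam l * psh lam e1 e2 z (jP l) = (1 + s) * p := by
    simp only [psh, mul_add, Finset.sum_add_distrib, ← hp, ← mul_assoc, ← Finset.sum_mul, ← hs]; ring
  have hq : J * ∑ l, lam l * psh lam e1 e2 z (jP l) = p := by rw [h1, ← mul_assoc, hJ, one_mul]
  have hB : ∀ i j, psh lam e1 e2 z (jA i j) - p * e2 i j = z (jA i j) + e1 j * (∑ l, lam l * z (jA i l)) + e1 i * (∑ l, lam l * z (jA l j))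
      + e1 i * e1 j * (∑ l, lam l * ∑ k, lam k * z (jA l k)) := by
    intro i j; simp only [psh, ← hp]; ring
  set t := ∑ l, lam l * ∑ k, lam k * z (jA l k) with ht
  have ht2 : ∑ k, lam k * ∑ l, lam l * z (jA l k) = t := by
    rw [ht]; simp only [Finset.mul_sum]; rw [Finset.sum_comm]
    apply Finset.sum_congr rfl; intro i _; apply Finset.sum_congr rfl; intro j _; ring
  funext α
  rcases α with u | i | ⟨i, j⟩
  · simp [tr, psh]
  · simp only [tr]
    rw [mul_left_comm, hq]; simp only [psh, ← hp]; ring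
  · simp only [tr, hq, hB]
    have a1 : ∀ i, ∑ l, lam l * (z (jA i l) + e1 l * (∑ k, lam k * z (jA i k)) + e1 i * (∑ k, lam k * z (jA k l))
      + e1 i * e1 l * t) = (1 + s) * ((∑ k, lam k * z (jA i k)) + e1 i * t) := by
      intro i
      have : ∀ l, lam l * (z (jA i l) + e1 l * (∑ k, lam k * z (jA i k)) + e1 i * (∑ k, lam k * z (jA k l))
      + e1 i * e1 l * t) = lam l * z (jA i l) + (lam l * e1 l) * (∑ k, lam k * z (jA i k)) + e1 i * (lam l * (∑ k, lam k * z (jA k l)))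
        + (lam l * e1 l) * (e1 i * t) := by intro l; ring
      simp only [this, Finset.sum_add_distrib, ← Finset.sum_mul, ← Finset.mul_sum, ← hs, ht2]; ring
    have a2 : ∀ j, ∑ l, lam l * (z (jA l j) + e1 j * (∑ k, lam k * z (jA l k)) + e1 l * (∑ k, lam k * z (jA k j))
      + e1 l * e1 j * t) = (1 + s) * ((∑ k, lam k * z (jA k j)) + e1 j * t) := by
      intro j
      have : ∀ l, lam l * (z (jA l j) + e1 j * (∑ k, lam k * z (jA l k)) + e1 l * (∑ k, lam k * z (jA k j))
      + e1 l * e1 j * t) = lam l * z (jA l j) + e1 j * (lam l * (∑ k, lam k * z (jA l k))) + (lam l * e1 l) * (∑ k, lam k * z (jA k j))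
        + (lam l * e1 l) * (e1 j * t) := by intro l; ring
      simp only [this, Finset.sum_add_distrib, ← Finset.sum_mul, ← Finset.mul_sum, ← hs, ← ht]; ring
    have a3 : ∑ l, lam l * ((1 + s) * ((∑ k, lam k * z (jA l k)) + e1 l * t)) = (1 + s) * ((1 + s) * t) := by
      have : ∀ l, lam l * ((1 + s) * ((∑ k, lam k * z (jA l k)) + e1 l * t)) = (1 + s) * (lam l * (∑ k, lam k * z (jA l k)) + (lam l * e1 l) * t) := by
        intro l; ring
      simp only [this, ← Finset.mul_sum, Finset.sum_add_distrib, ← Finset.sum_mul, ← hs, ← ht]; ring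
    simp only [a1, a2, a3]
    have b1 : ∀ x, J * (e1 j * ((1 + s) * x)) = e1 j * x := fun x => by
      linear_combination e1 j * x * hJ
    have b2 : ∀ x, J * (e1 i * ((1 + s) * x)) = e1 i * x := fun x => by
      linear_combination e1 i * x * hJ
    have b3 : J * J * (e1 i * e1 j * ((1 + s) * ((1 + s) * t))) = e1 i * e1 j * t := by
      linear_combination e1 i * e1 j * t * (J * (1 + s) + 1) * hJ
    rw [b1, b2, b3]; ring

/-- The Hadamard lemma for polynomials -/
lemma hadamard {σ τ : Type*} [Fintype τ] [DecidableEq τ] (p : MvPolynomial (σ ⊕ τ) ℂ) :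
    ∃ Q : τ → MvPolynomial (σ ⊕ (τ ⊕ τ)) ℂ,
      (∀ (A : Type) [CommRing A] [Algebra ℂ A] (ξ : σ → A) (y y' : τ → A),
        MvPolynomial.aeval (Sum.elim ξ y) p - MvPolynomial.aeval (Sum.elim ξ y') p
          = ∑ t, MvPolynomial.aeval (Sum.elim ξ (Sum.elim y y')) (Q t) * (y t - y' t)) ∧
      (∀ (A : Type) [CommRing A] [Algebra ℂ A] (ξ : σ → A) (y : τ → A) (t),
        MvPolynomial.aeval (Sum.elim ξ (Sum.elim y y)) (Q t) = MvPolynomial.aeval (Sum.elim ξ y) (MvPolynomial.pderiv (Sum.inr t) p)) := by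
  induction p using MvPolynomial.induction_on with
  | C c => exact ⟨fun _ => 0, by intros; simp, by intros; simp⟩
  | add p q hp hq =>
    obtain ⟨P, hP1, hP2⟩ := hp
    obtain ⟨Q, hQ1, hQ2⟩ := hq
    refine ⟨fun t => P t + Q t, ?_, ?_⟩
    · intro A _ _ ξ y y'
      simp only [map_add, add_mul, Finset.sum_add_distrib, ← hP1, ← hQ1]; ring
    · intro A _ _ ξ y t
      simp only [map_add, hP2, hQ2]
  | mul_X p n hp =>
    obtain ⟨P, hP1, hP2⟩ := hp
    rcases n with s | u
    · refine ⟨fun t => P t * MvPolynomial.X (Sum.inl s), ?_, ?_⟩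
      · intro A _ _ ξ y y'
        have := hP1 A ξ y y'
        simp only [map_mul, MvPolynomial.aeval_X, Sum.elim_inl, mul_right_comm _ (ξ s), ← Finset.sum_mul, ← this]; ring
      · intro A _ _ ξ y t
        simp only [map_mul, MvPolynomial.aeval_X, Sum.elim_inl, hP2, MvPolynomial.pderiv_mul, map_add, MvPolynomial.pderiv_X, Pi.single_apply]
        simp
    · refine ⟨fun t => P t * MvPolynomial.X (Sum.inr (Sum.inl u)) + if t = u then MvPolynomial.rename (Sum.map id Sum.inr) p else 0, ?_, ?_⟩
      · intro A _ _ ξ y y'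
        have := hP1 A ξ y y'
        have hr : MvPolynomial.aeval (Sum.elim ξ (Sum.elim y y')) (MvPolynomial.rename (Sum.map id Sum.inr) p) = MvPolynomial.aeval (Sum.elim ξ y') p := by
          rw [MvPolynomial.aeval_rename]; congr 2; funext x; rcases x with x | x <;> simp
        simp only [map_mul, map_add, MvPolynomial.aeval_X, Sum.elim_inr, Sum.elim_inl, add_mul, Finset.sum_add_distrib, apply_ite (MvPolynomial.aeval (Sum.elim ξ (Sum.elim y y'))), hr, map_zero, ite_mul, zero_mul, mul_right_comm _ (y u), ← Finset.sum_mul, ← this]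
        simp; ring
      · intro A _ _ ξ y t
        have hr : MvPolynomial.aeval (Sum.elim ξ (Sum.elim y y)) (MvPolynomial.rename (Sum.map id Sum.inr) p) = MvPolynomial.aeval (Sum.elim ξ y) p := by
          rw [MvPolynomial.aeval_rename]; congr 2; funext x; rcases x with x | x <;> simp
        simp only [map_mul, MvPolynomial.aeval_X, Sum.elim_inr, Sum.elim_inl, hP2, MvPolynomial.pderiv_mul, map_add, MvPolynomial.pderiv_X, apply_ite (MvPolynomial.aeval (Sum.elim ξ (Sum.elim y y))), hr, map_zero, Pi.single_apply]
        by_cases h : t = u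
        · subst h; simp
        · simp [h, Ne.symm h]

end transf
end Lawlor

namespace Lawlor
open MeasureTheory Set Filter Topology
open scoped Real ContDiff
noncomputable section jets
variable {m : ℕ}

/-- 2-jet of a function -/
def jet (V : XX m → ℂ) : JJ m → XX m → ℂ
  | Sum.inl _ => V
  | Sum.inr (Sum.inl i) => DD i V
  | Sum.inr (Sum.inr (i, j)) => DD j (DD i V)

lemma DD_contDiff_succ {n : ℕ} {g : XX m → ℂ} (hg : ContDiff ℝ (n+1 : ℕ) g) (i : Fin m) : ContDiff ℝ n (DD i g) := by
  have h := hg.fderiv_right (m := n) (by norm_cast)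
  exact h.clm_apply contDiff_const

lemma jet_continuous {V : XX m → ℂ} (hV : ContDiff ℝ 2 V) (α : JJ m) : Continuous (jet V α) := by
  have h1 : ∀ i, ContDiff ℝ (1:ℕ) (DD i V) := fun i => DD_contDiff_succ (n := 1) hV i
  rcases α with u | i | ⟨i, j⟩
  · exact hV.continuous
  · exact (h1 i).continuous
  · exact (DD_contDiff_succ (n := 0) (h1 i) j).continuous

lemma jet_supp {V : XX m → ℂ} {ρ : ℝ} (hV : SuppIn ρ V) (α : JJ m) : SuppIn ρ (jet V α) := by
  rcases α with u | i | ⟨i, j⟩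
  · exact hV
  · exact hV.DD i
  · exact (hV.DD i).DD j

lemma jet_memLp {V : XX m → ℂ} (hV : ContDiff ℝ 2 V) {ρ : ℝ} (hs : SuppIn ρ V) (α : JJ m) :
    MemLp (jet V α) 2 (volume.restrict (Lawlor.cell m)) := by
  obtain ⟨C, hC⟩ := (jet_supp hs α).hcs.exists_bound_of_continuous (jet_continuous hV α)
  exact memLp_of_bdd (jet_continuous hV α).continuousOn (fun x _ => hC x) 2

lemma jet_coef [hm : Fact (2 ≤ m)] {V : XX m → ℂ} (hV : ContDiff ℝ 2 V) (hs : SuppIn (9/20) V) (α : JJ m) (k) :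
    coef (jet V α) k = ds α k * coef (jet V jU) k := by
  have h1 : ∀ i, ContDiff ℝ (1:ℕ) (DD i V) := fun i => DD_contDiff_succ (n := 1) hV i
  rcases α with u | i | ⟨i, j⟩
  · simp [ds, jet]
  · simp only [jet, ds, dk]; exact coef_DD hm.out (by norm_num) (hV.of_le (by norm_num)) hs i k
  · simp only [jet, ds, dk]
    rw [coef_DD hm.out (by norm_num) (h1 i) (hs.DD i) j k, coef_DD hm.out (by norm_num) (hV.of_le (by norm_num)) hs i k]; ring

lemma fderiv_eq_sum (g : XX m → ℂ) (x v : XX m) : fderiv ℝ g x v = ∑ i, (v i : ℂ) * DD i g x := by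
  conv_lhs => rw [pi_eq_sum_univ' v]
  rw [map_sum]
  apply Finset.sum_congr rfl; intro i _
  rw [map_smul, Complex.real_smul]; rfl

/-- the deformation -/
def phi (e : XX m → ℝ) (lam x : XX m) : XX m := x + e x • lam

lemma phi_contDiff {e : XX m → ℝ} (he : ContDiff ℝ ∞ e) (lam : XX m) : ContDiff ℝ ∞ (phi e lam) := by
  unfold phi; fun_prop

lemma chain1 {e : XX m → ℝ} (he : ContDiff ℝ ∞ e) (lam : XX m) {g : XX m → ℂ} (hg : ContDiff ℝ 1 g) (i : Fin m) (x : XX m) :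
    DD i (fun x => g (phi e lam x)) x = DD i g (phi e lam x) + DD i (fun x => (e x : ℂ)) x * ∑ l, (lam l : ℂ) * DD l g (phi e lam x) := by
  have hd : DifferentiableAt ℝ e x := he.differentiable (by simp) x
  have h1 : HasFDerivAt (phi e lam) (ContinuousLinearMap.id ℝ (XX m) + (fderiv ℝ e x).smulRight lam) x := by
    unfold phi
    exact (hasFDerivAt_id x).add (hd.hasFDerivAt.smul_const lam)
  have h2 : HasFDerivAt g (fderiv ℝ g (phi e lam x)) (phi e lam x) := (hg.differentiable (by norm_num) _).hasFDerivAt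
  have h3 := h2.comp x h1
  have h4 : HasFDerivAt (fun x => (e x : ℂ)) (Complex.ofRealCLM ∘L fderiv ℝ e x) x := Complex.ofRealCLM.hasFDerivAt.comp x hd.hasFDerivAt
  unfold DD
  rw [show (fun x => g (phi e lam x)) = g ∘ phi e lam from rfl, h3.fderiv, h4.fderiv]
  simp only [ContinuousLinearMap.comp_apply, add_apply, ContinuousLinearMap.id_apply, ContinuousLinearMap.smulRight_apply, map_add, map_smul, Complex.ofRealCLM_apply, Complex.real_smul]
  rw [fderiv_eq_sum g _ lam]; rfl

lemma DD_add' {g h : XX m → ℂ} {x : XX m} (hg : DifferentiableAt ℝ g x) (hh : DifferentiableAt ℝ h x) (i : Fin m) :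
    DD i (fun x => g x + h x) x = DD i g x + DD i h x := by
  unfold DD; rw [show (fun x => g x + h x) = g + h from rfl, fderiv_add hg hh]; rfl

lemma DD_sum {ι : Type*} (s : Finset ι) {g : ι → XX m → ℂ} {x : XX m} (hg : ∀ i ∈ s, DifferentiableAt ℝ (g i) x) (i : Fin m) :
    DD i (fun x => ∑ l ∈ s, g l x) x = ∑ l ∈ s, DD i (g l) x := by
  unfold DD; rw [fderiv_fun_sum hg]; simp

lemma DD_cmul (c : ℂ) {g : XX m → ℂ} {x : XX m} (hg : DifferentiableAt ℝ g x) (i : Fin m) :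
    DD i (fun x => c * g x) x = c * DD i g x := by
  unfold DD; rw [fderiv_const_mul hg]; rfl

lemma jet_comp {e : XX m → ℝ} (he : ContDiff ℝ ∞ e) (lam : XX m) {V : XX m → ℂ} (hV : ContDiff ℝ 2 V) (α : JJ m) (x : XX m) :
    jet (fun x => V (phi e lam x)) α x = psh (fun l => (lam l : ℂ)) (fun i => DD i (fun x => (e x : ℂ)) x)
      (fun i j => DD j (DD i (fun x => (e x : ℂ))) x) (fun β => jet V β (phi e lam x)) α := by
  have hV1 : ContDiff ℝ 1 V := hV.of_le (by norm_num)
  have h1 : ∀ i, ContDiff ℝ 1 (DD i V) := fun i => DD_contDiff_succ (n := 1) hV i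
  rcases α with u | i | ⟨i, j⟩
  · rfl
  · simp only [jet, psh]; exact chain1 he lam hV1 i x
  · simp only [jet, psh]
    have e0 : DD i (fun x => V (phi e lam x)) = fun x => DD i V (phi e lam x) + DD i (fun x => (e x : ℂ)) x * ∑ l, (lam l : ℂ) * DD l V (phi e lam x) :=
      funext fun x => chain1 he lam hV1 i x
    have hec : ContDiff ℝ ∞ (fun x => (e x : ℂ)) := Complex.ofRealCLM.contDiff.comp he
    have hp := phi_contDiff he lam
    have hc : ∀ l, ContDiff ℝ 1 (fun x => DD l V (phi e lam x)) := fun l => (h1 l).comp (hp.of_le (by norm_cast))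
    have d1 : ∀ l, DifferentiableAt ℝ (fun x => DD l V (phi e lam x)) x := fun l => (hc l).differentiable (by norm_num) x
    have d2 : DifferentiableAt ℝ (DD i (fun x => (e x : ℂ))) x := (DD_contDiff hec i).differentiable (by simp) x
    have d4 : ∀ l, DifferentiableAt ℝ (fun x => (lam l : ℂ) * DD l V (phi e lam x)) x := fun l => (d1 l).const_mul _
    have d3 : DifferentiableAt ℝ (fun x => ∑ l, (lam l : ℂ) * DD l V (phi e lam x)) x := by
      fun_prop
    have d5 : DifferentiableAt ℝ (fun x => DD i (fun x => (e x : ℂ)) x * ∑ l, (lam l : ℂ) * DD l V (phi e lam x)) x := d2.mul d3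
    rw [e0, DD_add' (d1 i) d5, DD_mul d2 d3, DD_sum _ (fun l _ => d4 l)]
    simp only [DD_cmul _ (d1 _), chain1 he lam (h1 _) j x]
    simp only [mul_add, Finset.sum_add_distrib, mul_left_comm _ (DD j (fun x => (e x : ℂ)) x), ← Finset.mul_sum]
    ring

/-! bumps -/

def bmp (r R : ℝ) (h : 0 < r ∧ r < R) : ContDiffBump (0 : XX m) := ⟨r, R, h.1, h.2⟩

def etar : XX m → ℝ := bmp (1/20) (9/100) (by norm_num)
def eta (x : XX m) : ℂ := etar x
def chit (x : XX m) : ℂ := ((bmp (1/10) (2/10) (by norm_num) : ContDiffBump (0 : XX m)) x : ℝ)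
def chi (x : XX m) : ℂ := ((bmp (2/10) (3/10) (by norm_num) : ContDiffBump (0 : XX m)) x : ℝ)

lemma etar_smooth : ContDiff ℝ ∞ (etar (m := m)) := ContDiffBump.contDiff _
lemma eta_smooth : ContDiff ℝ ∞ (eta (m := m)) := Complex.ofRealCLM.contDiff.comp etar_smooth

lemma etar_supp (x : XX m) (hx : 9/100 ≤ ‖x‖) : etar x = 0 := by
  apply ContDiffBump.zero_of_le_dist; rw [dist_zero_right]; exact hx
lemma etar_zero : etar (0 : XX m) = 1 := by
  apply ContDiffBump.one_of_mem_closedBall; simp [bmp]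
lemma etar_le (x : XX m) : |etar x| ≤ 1 := by
  unfold etar; rw [abs_of_nonneg (ContDiffBump.nonneg _)]; exact ContDiffBump.le_one _
lemma eta_suppIn : SuppIn (9/100) (eta (m := m)) := fun x hx => by simp [eta, etar_supp x hx.le]
lemma chit_one (x : XX m) (hx : ‖x‖ ≤ 1/10) : chit x = 1 := by
  unfold chit; rw [ContDiffBump.one_of_mem_closedBall]; simp
  simpa [bmp] using hx
lemma chit_zero (x : XX m) (hx : 2/10 ≤ ‖x‖) : chit x = 0 := by
  unfold chit; rw [ContDiffBump.zero_of_le_dist]; simp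
  simpa [bmp] using hx
lemma chi_one (x : XX m) (hx : ‖x‖ ≤ 2/10) : chi x = 1 := by
  unfold chi; rw [ContDiffBump.one_of_mem_closedBall]; simp
  simpa [bmp] using hx
lemma chi_zero (x : XX m) (hx : 3/10 ≤ ‖x‖) : chi x = 0 := by
  unfold chi; rw [ContDiffBump.zero_of_le_dist]; simp
  simpa [bmp] using hx

lemma good_eta : Good (eta (m := m)) := ⟨eta_smooth, fun x hx => eta_suppIn x (by linarith)⟩
lemma good_chit : Good (chit (m := m)) := ⟨Complex.ofRealCLM.contDiff.comp (ContDiffBump.contDiff _), fun x hx => chit_zero x (by linarith)⟩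
lemma good_chi : Good (chi (m := m)) := ⟨Complex.ofRealCLM.contDiff.comp (ContDiffBump.contDiff _), fun x hx => chi_zero x (by linarith)⟩

lemma good_Xi (i : Fin m) : Good (fun x : XX m => (x i : ℂ) * chi x) :=
  good_chi.mul (Complex.ofRealCLM.contDiff.comp (contDiff_apply ℝ ℝ i))

/-- cut-off coordinates in the Wiener algebra -/
def Xi (i : Fin m) : Wn m := wc (fun x : XX m => (x i : ℂ) * chi x)

lemma mem_cell_of {x : XX m} (h : ‖x‖ < 1/2) : x ∈ cell m := by simpa [cell] using h

lemma real_Xi [hm : Fact (2 ≤ m)] (i : Fin m) {x : XX m} (hx : ‖x‖ ≤ 2/10) : real (Xi i) x = x i := by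
  unfold Xi
  rw [real_wc (good_Xi i) (mem_cell_of (by linarith))]; simp only; rw [chi_one x hx, mul_one]

end jets
end Lawlor

namespace Lawlor
open MeasureTheory Set Filter Topology
open scoped Real ContDiff
noncomputable section ift
variable {m : ℕ}

lemma contDiffAt_aeval {E : Type*} [NormedAddCommGroup E] [NormedSpace ℝ E] {σ : Type*} {n : WithTop ℕ∞} (N : MvPolynomial σ ℂ) {z : σ → E → Wn m} {p : E}
    (hz : ∀ s, ContDiffAt ℝ n (z s) p) : ContDiffAt ℝ n (fun e => MvPolynomial.aeval (fun s => z s e) N) p := by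
  induction N using MvPolynomial.induction_on with
  | C c => simpa using contDiffAt_const
  | add p q hp hq => simpa using hp.add hq
  | mul_X p s hp => simpa using hp.mul (hz s)

lemma hasFDerivAt_aeval {σ τ : Type*} [Fintype τ] [DecidableEq τ] (N : MvPolynomial (σ ⊕ τ) ℂ) (ξ : σ → Wn m)
    (L : τ → Wn m →L[ℝ] Wn m) (b0 : Wn m) :
    HasFDerivAt (fun b => MvPolynomial.aeval (Sum.elim ξ (fun t => L t b)) N)
      (∑ t, (ContinuousLinearMap.mul ℝ (Wn m) (MvPolynomial.aeval (Sum.elim ξ (fun t => L t b0)) (MvPolynomial.pderiv (Sum.inr t) N))) ∘L L t) b0 := by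
  induction N using MvPolynomial.induction_on with
  | C c => simpa using hasFDerivAt_const _ _
  | add p q hp hq =>
    simp only [map_add, ContinuousLinearMap.add_comp, Finset.sum_add_distrib]
    exact hp.add hq
  | mul_X p s hp =>
    have hs : HasFDerivAt (fun b => MvPolynomial.aeval (Sum.elim ξ (fun t => L t b)) (MvPolynomial.X (R := ℂ) s))
        (∑ t, (ContinuousLinearMap.mul ℝ (Wn m) (MvPolynomial.aeval (Sum.elim ξ (fun t => L t b0)) (MvPolynomial.pderiv (Sum.inr t) (MvPolynomial.X (R := ℂ) s)))) ∘L L t) b0 := by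
      rcases s with s | u
      · simp only [MvPolynomial.aeval_X, Sum.elim_inl]
        refine (hasFDerivAt_const (ξ s) b0).congr_fderiv (Eq.symm ?_)
        apply Finset.sum_eq_zero; intro t _
        rw [MvPolynomial.pderiv_X_of_ne (by simp)]; simp
      · simp only [MvPolynomial.aeval_X, Sum.elim_inr]
        convert! (L u).hasFDerivAt using 1
        rw [Finset.sum_eq_single u]
        · ext b; simp
        · intro t _ ht
          rw [MvPolynomial.pderiv_X_of_ne (by simpa using ht.symm)]; simp
        · simp
    simp only [map_mul]
    convert! hp.mul hs using 1
    ext b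
    simp only [MvPolynomial.pderiv_mul, map_add, map_mul, sum_apply, ContinuousLinearMap.comp_apply, ContinuousLinearMap.mul_apply', add_apply, smul_apply, smul_eq_mul, Finset.mul_sum, Finset.sum_add_distrib]
    rw [add_comm]
    congr 1 <;> congr 1 <;> (apply Finset.sum_congr rfl; intro t _; ring)

lemma isInvertible_of_small {E : Type*} [NormedAddCommGroup E] [NormedSpace ℝ E] [CompleteSpace E] (S : E →L[ℝ] E) (hS : ‖S‖ < 1) :
    (ContinuousLinearMap.id ℝ E + S).IsInvertible := by
  have h : IsUnit (1 - (-S)) := isUnit_one_sub_of_norm_lt_one (by rwa [norm_neg])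
  rw [sub_neg_eq_add] at h
  obtain ⟨u, hu⟩ := h
  exact ⟨ContinuousLinearEquiv.ofUnit u, by ext x; simp [ContinuousLinearEquiv.ofUnit, hu]⟩

def lamW (lam : XX m) (i : Fin m) : Wn m := ((lam i : ℝ) : ℂ) • (1 : Wn m)

lemma real_lamW (lam : XX m) (i : Fin m) (x : XX m) : real (lamW lam i) x = lam i := by
  unfold lamW; rw [real_smul, real_one, mul_one]

def E1 (i : Fin m) : Wn m := wc (DD i eta)
def E2 (i j : Fin m) : Wn m := wc (DD j (DD i eta))
def Jop (lam : XX m) : Wn m := Ring.inverse (1 + ∑ l, lamW lam l * E1 l)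

lemma lamW_zero : lamW (0 : XX m) = 0 := by funext i; simp [lamW]

lemma lamW_contDiff (i : Fin m) {n : WithTop ℕ∞} : ContDiff ℝ n (fun lam : XX m => lamW lam i) := by
  have : (fun lam : XX m => lamW lam i) = fun lam : XX m => (lam i) • (1 : Wn m) := by
    funext lam; unfold lamW; simp
  rw [this]; fun_prop

lemma Jop_contDiffAt : ContDiffAt ℝ ω (Jop (m := m)) 0 := by
  unfold Jop
  have h0 : (1 + ∑ l, lamW (0 : XX m) l * E1 l : Wn m) = ((1 : (Wn m)ˣ) : Wn m) := by
    simp [lamW_zero]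
  have h1 : ContDiffAt ℝ ω (Ring.inverse : Wn m → Wn m) (1 + ∑ l, lamW (0 : XX m) l * E1 l) := by
    rw [h0]; exact contDiffAt_ringInverse ℝ 1
  refine ContDiffAt.comp (g := (Ring.inverse : Wn m → Wn m)) (f := fun lam => 1 + ∑ l, lamW lam l * E1 l) (0 : XX m) h1 ?_
  apply ContDiffAt.add contDiffAt_const
  apply ContDiffAt.sum; intro l _
  exact (lamW_contDiff l).contDiffAt.mul contDiffAt_const

lemma Jop_mul : ∀ᶠ lam in 𝓝 (0 : XX m), Jop lam * (1 + ∑ l, lamW lam l * E1 l) = 1 := by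
  have hc : Continuous (fun lam : XX m => (1 + ∑ l, lamW lam l * E1 l : Wn m)) := by
    apply Continuous.add continuous_const
    apply continuous_finsetSum; intro l _
    exact (lamW_contDiff l (n := 0)).continuous.mul continuous_const
  have hu : {w : Wn m | IsUnit w} ∈ 𝓝 (1 + ∑ l, lamW (0 : XX m) l * E1 l : Wn m) := by
    apply Units.isOpen.mem_nhds; simp [lamW_zero]
  filter_upwards [hc.continuousAt.preimage_mem_nhds hu] with lam hlam
  exact Ring.inverse_mul_cancel _ hlam

variable {a : Fin m → Fin m → ℂ} {c0 : ℝ}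

def Tz [hm : Fact (2 ≤ m)] (h : Ell a c0) (lam : XX m) (b : Wn m) : JJ m → Wn m :=
  tr (Jop lam) (lamW lam) E1 E2 (fun α => Rop h α b)

def xiW (lam : XX m) (i : Fin m) : Wn m := Xi i + lamW lam i * wc eta

lemma xiW_zero : xiW (0 : XX m) = Xi := by funext i; simp [xiW, lamW_zero]

def GG [hm : Fact (2 ≤ m)] (h : Ell a c0) (N : MvPolynomial (Fin m ⊕ JJ m) ℂ) (g : Wn m) (p : XX m × Wn m) : Wn m :=
  co p.2 0 • 1 + ∑ i, ∑ j, a i j • Tz h p.1 p.2 (jA i j) + wc chit * MvPolynomial.aeval (Sum.elim (xiW p.1) (Tz h p.1 p.2)) N - g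

lemma Tz_zero [hm : Fact (2 ≤ m)] (h : Ell a c0) (b : Wn m) : Tz h 0 b = fun α => Rop h α b := by
  unfold Tz; rw [lamW_zero, tr_zero]

lemma GG_zero [hm : Fact (2 ≤ m)] (h : Ell a c0) (N : MvPolynomial (Fin m ⊕ JJ m) ℂ) (g : Wn m) (b : Wn m) :
    GG h N g (0, b) = b + wc chit * MvPolynomial.aeval (Sum.elim Xi (fun α => Rop h α b)) N - g := by
  unfold GG; simp only [Tz_zero, xiW_zero]
  congr 2
  conv_rhs => rw [Rop_eq h b]
  rw [add_comm]

lemma contDiffAt_tr {E : Type*} [NormedAddCommGroup E] [NormedSpace ℝ E] {n : WithTop ℕ∞} {J : E → Wn m} {lam : Fin m → E → Wn m} {w : JJ m → E → Wn m} (e1 : Fin m → Wn m) (e2) {p : E}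
    (hJ : ContDiffAt ℝ n J p) (hl : ∀ i, ContDiffAt ℝ n (lam i) p) (hw : ∀ α, ContDiffAt ℝ n (w α) p) (α : JJ m) :
    ContDiffAt ℝ n (fun q => tr (J q) (fun i => lam i q) e1 e2 (fun β => w β q) α) p := by
  rcases α with u | i | ⟨i, j⟩
  · exact hw _
  · simp only [tr]; fun_prop
  · simp only [tr]; fun_prop

lemma GG_contDiffAt [hm : Fact (2 ≤ m)] (h : Ell a c0) (N : MvPolynomial (Fin m ⊕ JJ m) ℂ) (g : Wn m) (b : Wn m) :
    ContDiffAt ℝ ω (GG h N g) (0, b) := by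
  have hJ : ContDiffAt ℝ ω (fun p : XX m × Wn m => Jop p.1) (0, b) :=
    ContDiffAt.comp (g := Jop) (f := fun p : XX m × Wn m => p.1) (0, b) Jop_contDiffAt contDiffAt_fst
  have hl : ∀ i, ContDiffAt ℝ ω (fun p : XX m × Wn m => lamW p.1 i) (0, b) := fun i => ((lamW_contDiff i).comp contDiff_fst).contDiffAt
  have hw : ∀ α, ContDiffAt ℝ ω (fun p : XX m × Wn m => Rop h α p.2) (0, b) := fun α =>
    ((((Rop h α).restrictScalars ℝ).contDiff).comp contDiff_snd).contDiffAt
  have hT : ∀ α, ContDiffAt ℝ ω (fun p : XX m × Wn m => Tz h p.1 p.2 α) (0, b) := fun α =>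
    contDiffAt_tr E1 E2 hJ hl hw α
  have hx : ∀ i, ContDiffAt ℝ ω (fun p : XX m × Wn m => xiW p.1 i) (0, b) := fun i =>
    contDiffAt_const.add ((hl i).mul contDiffAt_const)
  have hA : ContDiffAt ℝ ω (fun p : XX m × Wn m => MvPolynomial.aeval (Sum.elim (xiW p.1) (Tz h p.1 p.2)) N) (0, b) := by
    have := contDiffAt_aeval N (z := fun s (p : XX m × Wn m) => Sum.elim (xiW p.1) (Tz h p.1 p.2) s) (n := ω) (p := (0, b)) (by
      intro s; rcases s with i | α
      · exact hx i
      · exact hT α)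
    exact this
  have hco : ContDiffAt ℝ ω (fun p : XX m × Wn m => co p.2 0 • (1 : Wn m)) (0, b) := by
    have : ContDiff ℝ ω (fun b : Wn m => co b 0 • (1 : Wn m)) := by
      have := ((((coL (0 : KK m)).restrictScalars ℝ).contDiff (n := ω)).smul (contDiff_const (c := (1 : Wn m))))
      exact this
    exact (this.comp contDiff_snd).contDiffAt
  unfold GG
  refine ((hco.add ?_).add (contDiffAt_const.mul hA)).sub contDiffAt_const
  apply ContDiffAt.sum; intro i _; apply ContDiffAt.sum; intro j _
  exact (hT _).const_smul _

lemma ift_exists [hm : Fact (2 ≤ m)] (h : Ell a c0) : ∃ δ : ℝ, 0 < δ ∧ ∀ (N : MvPolynomial (Fin m ⊕ JJ m) ℂ) (b0 : Wn m),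
    (∀ α, ‖wc chit * MvPolynomial.aeval (Sum.elim Xi (fun α => Rop h α b0)) (MvPolynomial.pderiv (Sum.inr α) N)‖ ≤ δ) →
    ∃ B : XX m → Wn m, ContDiffAt ℝ ω B 0 ∧ B 0 = b0 ∧ ∀ᶠ lam in 𝓝 0,
      GG h N (b0 + wc chit * MvPolynomial.aeval (Sum.elim Xi (fun α => Rop h α b0)) N) (lam, B lam) = 0 := by
  set R : JJ m → Wn m →L[ℝ] Wn m := fun α => (Rop h α).restrictScalars ℝ with hR
  set M := 1 + ∑ α, ‖R α‖ with hM
  have hM0 : 0 < M := by positivity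
  refine ⟨1 / (2 * M), by positivity, fun N b0 hN => ?_⟩
  set g := b0 + wc chit * MvPolynomial.aeval (Sum.elim Xi (fun α => Rop h α b0)) N with hg
  have hcd := GG_contDiffAt h N g b0
  set S : Wn m →L[ℝ] Wn m := ContinuousLinearMap.mul ℝ (Wn m) (wc chit) ∘L ∑ t, (ContinuousLinearMap.mul ℝ (Wn m) (MvPolynomial.aeval (Sum.elim Xi (fun t => R t b0)) (MvPolynomial.pderiv (Sum.inr t) N))) ∘L R t with hS
  have hd1 : HasFDerivAt (fun b => GG h N g (0, b)) (ContinuousLinearMap.id ℝ (Wn m) + S) b0 := by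
    simp only [GG_zero]
    apply HasFDerivAt.sub_const
    apply (hasFDerivAt_id b0).add
    exact ((ContinuousLinearMap.mul ℝ (Wn m) (wc chit)).hasFDerivAt).comp b0 (hasFDerivAt_aeval N Xi R b0)
  have hd2 : HasFDerivAt (fun b => GG h N g (0, b)) (fderiv ℝ (GG h N g) (0, b0) ∘L .inr ℝ (XX m) (Wn m)) b0 := by
    have := (hcd.differentiableAt (by simp)).hasFDerivAt
    exact this.comp b0 (hasFDerivAt_prodMk_right (0 : XX m) b0)
  have hSn : ‖S‖ < 1 := by
    have : ‖S‖ ≤ 1 / (2 * M) * M := by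
      apply ContinuousLinearMap.opNorm_le_bound _ (by positivity)
      intro b
      have e : S b = ∑ t, (wc chit * MvPolynomial.aeval (Sum.elim Xi (fun t => R t b0)) (MvPolynomial.pderiv (Sum.inr t) N)) * R t b := by
        simp only [hS, ContinuousLinearMap.comp_apply, sum_apply, ContinuousLinearMap.mul_apply', Finset.mul_sum, mul_assoc]
      rw [e]
      calc _ ≤ ∑ t, ‖(wc chit * MvPolynomial.aeval (Sum.elim Xi (fun t => R t b0)) (MvPolynomial.pderiv (Sum.inr t) N)) * R t b‖ := norm_sum_le _ _
        _ ≤ ∑ t, 1 / (2 * M) * (‖R t‖ * ‖b‖) := by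
          apply Finset.sum_le_sum; intro t _
          refine (norm_mul_le _ _).trans ?_
          gcongr
          · exact hN t
          · exact (R t).le_opNorm b
        _ = 1 / (2 * M) * (∑ t, ‖R t‖) * ‖b‖ := by rw [← Finset.mul_sum, ← Finset.sum_mul]; ring
        _ ≤ _ := by gcongr; rw [hM]; linarith
    have e2 : 1 / (2 * M) * M = 1 / 2 := by field_simp
    linarith
  have hinv : (fderiv ℝ (GG h N g) (0, b0) ∘L .inr ℝ (XX m) (Wn m)).IsInvertible := by
    rw [← hd1.unique hd2]; exact isInvertible_of_small S hSn
  have hG0 : GG h N g (0, b0) = 0 := by rw [GG_zero, hg]; simp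
  refine ⟨hcd.implicitFunction (by simp) hinv, hcd.contDiffAt_implicitFunction _ hinv, hcd.implicitFunction_apply_self _ hinv, ?_⟩
  have := hcd.eventually_apply_implicitFunction (by simp) hinv
  rw [hG0] at this; exact this

end ift
end Lawlor

namespace Lawlor
open MeasureTheory Set Filter Topology
open scoped Real ContDiff
noncomputable section core
variable {m : ℕ}

lemma unif_cont {P Q : Type*} [NormedAddCommGroup P] [ProperSpace P] [NormedAddCommGroup Q] {f : P → Q} (hf : Continuous f)
    (M : ℝ) {δ : ℝ} (hδ : 0 < δ) : ∃ τ, 0 < τ ∧ ∀ y y0, ‖y0‖ ≤ M → ‖y - y0‖ < τ → ‖f y - f y0‖ < δ := by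
  have hu := (isCompact_closedBall (0 : P) (M + 1)).uniformContinuousOn_of_continuous hf.continuousOn
  rw [Metric.uniformContinuousOn_iff] at hu
  obtain ⟨τ, hτ, h⟩ := hu δ hδ
  refine ⟨min τ 1, by positivity, fun y y0 h0 hy => ?_⟩
  rw [← dist_eq_norm]
  apply h
  · rw [mem_closedBall_zero_iff]
    have := norm_sub_norm_le y y0
    have := lt_of_lt_of_le hy (min_le_right _ _)
    linarith
  · rw [mem_closedBall_zero_iff]; linarith
  · rw [dist_eq_norm]; exact lt_of_lt_of_le hy (min_le_left _ _)

lemma continuous_aevalC {σ : Type*} (Q : MvPolynomial σ ℂ) : Continuous (fun y : σ → ℂ => MvPolynomial.aeval y Q) := by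
  induction Q using MvPolynomial.induction_on with
  | C c => simpa using continuous_const
  | add p q hp hq => simp only [map_add]; exact hp.add hq
  | mul_X p s hp => simp only [map_mul, MvPolynomial.aeval_X]; exact hp.mul (continuous_apply s)

lemma unif_Q {σ τ : Type*} [Fintype σ] [Fintype τ] (Q : τ → MvPolynomial σ ℂ) (M : ℝ) {δ : ℝ} (hδ : 0 < δ) :
    ∃ r, 0 < r ∧ ∀ y y0 : σ → ℂ, ‖y0‖ ≤ M → ‖y - y0‖ < r → ∀ t, ‖MvPolynomial.aeval y (Q t) - MvPolynomial.aeval y0 (Q t)‖ < δ := by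
  obtain ⟨r, hr, h⟩ := unif_cont (f := fun y : σ → ℂ => fun t => MvPolynomial.aeval y (Q t)) (continuous_pi fun t => continuous_aevalC (Q t)) M hδ
  refine ⟨r, hr, fun y y0 h0 hy t => ?_⟩
  have := h y y0 h0 hy
  exact lt_of_le_of_lt (norm_le_pi_norm ((fun t => MvPolynomial.aeval y (Q t) : τ → ℂ) - fun t => MvPolynomial.aeval y0 (Q t)) t) this

lemma continuous_tr (α : JJ m) : Continuous (fun q : ℂ × (Fin m → ℂ) × (Fin m → ℂ) × (Fin m → Fin m → ℂ) × (JJ m → ℂ) =>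
    tr q.1 q.2.1 q.2.2.1 q.2.2.2.1 q.2.2.2.2 α) := by
  rcases α with u | i | ⟨i, j⟩
  · simp only [tr]; fun_prop
  · simp only [tr]; fun_prop
  · simp only [tr]; fun_prop

lemma unif_tr (M : ℝ) {δ : ℝ} (hδ : 0 < δ) : ∃ r, 0 < r ∧ ∀ (J : ℂ) (lam e1 : Fin m → ℂ) (e2 : Fin m → Fin m → ℂ), ‖J‖ ≤ M → ‖e1‖ ≤ M →
    ‖e2‖ ≤ M → ‖lam‖ < r → ∀ (w : JJ m → ℂ) α, ‖tr J lam e1 e2 w α - w α‖ ≤ δ * ∑ β, ‖w β‖ := by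
  obtain ⟨r, hr, h⟩ := unif_cont (f := fun q : ℂ × (Fin m → ℂ) × (Fin m → ℂ) × (Fin m → Fin m → ℂ) × (JJ m → ℂ) => fun α =>
    tr q.1 q.2.1 q.2.2.1 q.2.2.2.1 q.2.2.2.2 α) (continuous_pi continuous_tr) (max M 1) hδ
  refine ⟨r, hr, fun J lam e1 e2 hJ h1 h2 hl w α => ?_⟩
  set S := ∑ β, ‖w β‖ with hS
  have hS0 : 0 ≤ S := Finset.sum_nonneg fun _ _ => norm_nonneg _
  have hwS : ∀ β, ‖w β‖ ≤ S := fun β => Finset.single_le_sum (f := fun β => ‖w β‖) (fun _ _ => norm_nonneg _) (Finset.mem_univ β)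
  rcases hS0.eq_or_lt with h0 | hpos
  · have hw : w = fun β => 0 * (0 : JJ m → ℂ) β := by
      funext β; have := hwS β; rw [← h0] at this; simpa using this
    rw [hw, tr_smul]; simp [← h0]
  · set w' : JJ m → ℂ := fun β => (S : ℂ)⁻¹ * w β with hw'
    have hne : (S : ℂ) ≠ 0 := by exact_mod_cast hpos.ne'
    have hw : w = fun β => (S : ℂ) * w' β := by funext β; rw [hw']; field_simp
    have hn : ‖w'‖ ≤ 1 := by
      rw [pi_norm_le_iff_of_nonneg zero_le_one]; intro β
      rw [hw', norm_mul, norm_inv, Complex.norm_real, Real.norm_of_nonneg hS0, inv_mul_le_iff₀ hpos, mul_one]; exact hwS β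
    have := h (J, lam, e1, e2, w') (J, 0, e1, e2, w') (by
        simp only [Prod.norm_def, norm_zero]
        simp only [max_le_iff]
        refine ⟨hJ.trans (le_max_left _ _), ?_, h1.trans (le_max_left _ _), h2.trans (le_max_left _ _), hn.trans (le_max_right _ _)⟩
        exact zero_le_one.trans (le_max_right _ _)) (by
        simp only [Prod.mk_sub_mk, sub_self, sub_zero, Prod.norm_def, norm_zero]
        simp only [max_lt_iff, hr, hl, and_self])
    have h3 := lt_of_le_of_lt (norm_le_pi_norm _ α) this
    simp only [Pi.sub_apply, tr_zero] at h3
    rw [hw, tr_smul, ← mul_sub, norm_mul, Complex.norm_real, Real.norm_of_nonneg hS0, mul_comm]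
    gcongr

lemma ellf_sub {g h : XX m → ℂ} (hg : MemLp g 2 (volume.restrict (cell m))) (hh : MemLp h 2 (volume.restrict (cell m))) :
    ellf (fun x => g x - h x) = ellf g - ellf h := by
  unfold ellf
  rw [integral_sub (intOn_outr hg) (intOn_outr hh)]; ring

lemma real_aeval {σ : Type*} (z : σ → Wn m) (N : MvPolynomial σ ℂ) (x : XX m) :
    real (MvPolynomial.aeval z N) x = MvPolynomial.aeval (fun s => real (z s) x) N := by
  rw [← evx_apply, MvPolynomial.comp_aeval_apply]; rfl

lemma real_tr (J : Wn m) (lam e1 : Fin m → Wn m) (e2) (w : JJ m → Wn m) (α) (x : XX m) :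
    real (tr J lam e1 e2 w α) x = tr (real J x) (fun i => real (lam i) x) (fun i => real (e1 i) x) (fun i j => real (e2 i j) x) (fun α => real (w α) x) α :=
  map_tr (evx x : Wn m →+* ℂ) J lam e1 e2 w α

lemma norm_chit_le (x : XX m) : ‖chit x‖ ≤ 1 := by
  unfold chit
  rw [Complex.norm_real, Real.norm_of_nonneg (ContDiffBump.nonneg _)]; exact ContDiffBump.le_one _

end core
end Lawlor

namespace Lawlor
open MeasureTheory Set Filter Topology
open scoped Real ContDiff
noncomputable section core2
variable {m : ℕ} {a : Fin m → Fin m → ℂ} {c0 : ℝ}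

lemma co_Rop_ds [hm : Fact (2 ≤ m)] (h : Ell a c0) (α : JJ m) (b : Wn m) (k : KK m) : co (Rop h α b) k = ds α k * co (Rop h jU b) k := by
  by_cases hk : k = 0
  · subst hk
    rcases α with u | i | ⟨i, j⟩
    · simp [ds]
    · rw [co_Rop_zero]; simp [ds, dk_zero]
    · rw [co_Rop_zero]; simp [ds, dk_zero]
  · rw [co_Rop_ne h _ _ hk, co_Rop_ne h _ _ hk]; simp [ds]; ring

lemma est_pt {cs τ : ℝ} (d t q : JJ m → ℂ) (l : ℂ) (h0 : ∑ i, ∑ j, a i j * t (jA i j) + l + ∑ α, q α * t α = 0)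
    (hcs : 0 ≤ cs) (h1 : ∀ α, ‖t α - d α‖ ≤ τ * ∑ β, ‖d β‖) (h2 : ∀ α, ‖q α‖ ≤ cs / 4) (h3 : τ * Fintype.card (JJ m) ≤ 1)
    (h4 : τ * ∑ i, ∑ j, ‖a i j‖ ≤ cs / 2) : ‖∑ i, ∑ j, a i j * d (jA i j) + l‖ ≤ cs * ∑ α, ‖d α‖ := by
  set D := ∑ α, ‖d α‖ with hD
  have hD0 : 0 ≤ D := Finset.sum_nonneg fun _ _ => norm_nonneg _
  have e : ∑ i, ∑ j, a i j * d (jA i j) + l = -(∑ i, ∑ j, a i j * (t (jA i j) - d (jA i j))) - ∑ α, q α * t α := by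
    simp only [mul_sub, Finset.sum_sub_distrib]
    linear_combination h0
  rw [e]
  have b1 : ‖∑ i, ∑ j, a i j * (t (jA i j) - d (jA i j))‖ ≤ cs / 2 * D := by
    calc _ ≤ ∑ i, ∑ j, ‖a i j‖ * (τ * D) := by
          refine (norm_sum_le _ _).trans (Finset.sum_le_sum fun i _ => (norm_sum_le _ _).trans (Finset.sum_le_sum fun j _ => ?_))
          rw [norm_mul]; gcongr; exact h1 _
      _ = (τ * ∑ i, ∑ j, ‖a i j‖) * D := by simp only [← Finset.sum_mul]; ring
      _ ≤ _ := by gcongr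
  have b2 : ‖∑ α, q α * t α‖ ≤ cs / 2 * D := by
    calc _ ≤ ∑ α, cs / 4 * (‖d α‖ + τ * D) := by
          refine (norm_sum_le _ _).trans (Finset.sum_le_sum fun α _ => ?_)
          rw [norm_mul]
          have : ‖t α‖ ≤ ‖d α‖ + τ * D := by
            have := norm_add_le (d α) (t α - d α)
            rw [add_sub_cancel] at this
            linarith [h1 α]
          gcongr; exact h2 α
      _ = cs / 4 * (D + (τ * Fintype.card (JJ m)) * D) := by
          rw [← Finset.mul_sum, Finset.sum_add_distrib, Finset.sum_const, Finset.card_univ, nsmul_eq_mul]; ring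
      _ ≤ cs / 4 * (D + 1 * D) := by gcongr
      _ = _ := by ring
  calc _ ≤ ‖∑ i, ∑ j, a i j * (t (jA i j) - d (jA i j))‖ + ‖∑ α, q α * t α‖ := by
        refine (norm_sub_le _ _).trans ?_; rw [norm_neg]
    _ ≤ _ := by linarith

lemma pde_pt [hm : Fact (2 ≤ m)] {N : MvPolynomial (Fin m ⊕ JJ m) ℂ} {v : JJ m → Wn m} {V : XX m → ℂ}
    (hv : ∀ α, EqOn (real (v α)) (jet V α) (cell m))
    (hpde : ∀ x, ‖x‖ < 2/10 → ∑ i, ∑ j, a i j * jet V (jA i j) x + MvPolynomial.aeval (Sum.elim (fun i => (x i : ℂ)) (fun α => jet V α x)) N = 0)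
    {lam : XX m} (hl : ‖lam‖ < 1/10) {x : XX m} (hx : x ∈ cell m) :
    ∑ i, ∑ j, a i j * jet V (jA i j) (phi etar lam x) + chit x * MvPolynomial.aeval (Sum.elim (fun i => real (xiW lam i) x) (fun α => jet V α (phi etar lam x))) N
    = ∑ i, ∑ j, a i j * real (v (jA i j)) x + chit x * MvPolynomial.aeval (Sum.elim (fun i => real (Xi i) x) (fun α => real (v α) x)) N := by
  have hxi : ∀ i, real (xiW lam i) x = real (Xi i) x + lam i * etar x := by
    intro i; unfold xiW; rw [real_add, real_mul, real_lamW, real_wc good_eta hx]; rfl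
  simp only [hv _ hx]
  by_cases h : ‖x‖ < 1/10
  · have hphi : ‖phi etar lam x‖ < 2/10 := by
      unfold phi
      have h1 := norm_add_le x (etar x • lam)
      rw [norm_smul, Real.norm_eq_abs] at h1
      have := mul_le_mul_of_nonneg_right (etar_le x) (norm_nonneg lam)
      linarith
    rw [chit_one x h.le, one_mul, one_mul]
    have h1 := hpde _ hphi
    have h2 := hpde x (by linarith)
    have e1 : (fun i => real (xiW lam i) x) = fun i => ((phi etar lam x i : ℝ) : ℂ) := by
      funext i; rw [hxi, real_Xi i (by linarith)]; simp [phi]; ring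
    have e2 : (fun i => real (Xi i) x) = fun i => ((x i : ℝ) : ℂ) := by
      funext i; rw [real_Xi i (by linarith)]
    rw [e1, e2, h1, h2]
  · push Not at h
    have e0 := etar_supp x (by linarith)
    have e1 : phi etar lam x = x := by simp [phi, e0]
    have e2 : (fun i => real (xiW lam i) x) = (fun i => real (Xi i) x) := by funext i; rw [hxi, e0]; simp
    rw [e1, e2]

lemma Q_pt [hm : Fact (2 ≤ m)] (v : JJ m → Wn m) (N : MvPolynomial (Fin m ⊕ JJ m) ℂ) (Q : JJ m → MvPolynomial (Fin m ⊕ JJ m ⊕ JJ m) ℂ)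
    (hQ2 : ∀ (A : Type) [CommRing A] [Algebra ℂ A] (ξ : Fin m → A) (y : JJ m → A) (t : JJ m),
    (MvPolynomial.aeval (Sum.elim ξ (Sum.elim y y))) (Q t) = (MvPolynomial.aeval (Sum.elim ξ y)) ((MvPolynomial.pderiv (Sum.inr t)) N))
    {δ τQ M cs : ℝ} (hδ : 0 < δ)
    (HQ : ∀ (y y0 : Fin m ⊕ JJ m ⊕ JJ m → ℂ), ‖y0‖ ≤ M → ‖y - y0‖ < τQ → ∀ (t : JJ m), ‖(MvPolynomial.aeval y) (Q t) - (MvPolynomial.aeval y0) (Q t)‖ < δ)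
    (hM0 : 0 ≤ M) (hM1 : ∀ i x, ‖real (Xi i : Wn m) x‖ ≤ M) (hM2 : ∀ α x, ‖real (v α) x‖ ≤ M)
    (hN : ∀ α, ‖wc chit * MvPolynomial.aeval (Sum.elim Xi v) (MvPolynomial.pderiv (Sum.inr α) N)‖ ≤ δ)
    {x lam : XX m} (hx : x ∈ cell m) (hlQ : ‖lam‖ < τQ) (y y' : JJ m → ℂ) (hy : ∀ α, ‖y α - real (v α) x‖ < τQ)
    (hy' : ∀ α, ‖y' α - real (v α) x‖ < τQ) (hτQ : 0 < τQ) (q6 : δ ≤ cs / 8) (α : JJ m) :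
    ‖chit x * MvPolynomial.aeval (Sum.elim (fun i => real (xiW lam i) x) (Sum.elim y y')) (Q α)‖ ≤ cs / 4 := by
  have q1 : ‖(Sum.elim (fun i => real (Xi i) x) (Sum.elim (fun α => real (v α) x) (fun α => real (v α) x)) : Fin m ⊕ (JJ m ⊕ JJ m) → ℂ)‖ ≤ M := by
    rw [pi_norm_le_iff_of_nonneg hM0]
    rintro (i | α | α)
    · exact hM1 i x
    · exact hM2 α x
    · exact hM2 α x
  have q2 : ‖(Sum.elim (fun i => real (xiW lam i) x) (Sum.elim y y') : Fin m ⊕ (JJ m ⊕ JJ m) → ℂ)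
     - (Sum.elim (fun i => real (Xi i) x) (Sum.elim (fun α => real (v α) x) (fun α => real (v α) x)) : Fin m ⊕ (JJ m ⊕ JJ m) → ℂ)‖ < τQ := by
    rw [pi_norm_lt_iff hτQ]
    rintro (i | α | α)
    · refine lt_of_le_of_lt ?_ hlQ
      show ‖real (xiW lam i) x - real (Xi i) x‖ ≤ _
      unfold xiW; rw [real_add, real_mul, real_lamW, real_wc good_eta hx, add_sub_cancel_left, norm_mul, Complex.norm_real]
      calc _ ≤ ‖lam‖ * 1 := by
            gcongr
            · exact norm_le_pi_norm lam i
            · simp only [eta, Complex.norm_real]; exact etar_le x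
        _ = _ := mul_one _
    · exact hy α
    · exact hy' α
  have q3 := HQ _ _ q1 q2 α
  have q4 := (norm_real_le _ x).trans (hN α)
  rw [real_mul, real_wc good_chit hx, real_aeval] at q4
  have c1 : (fun s => real (Sum.elim Xi v s) x) = Sum.elim (fun i => real (Xi i) x) (fun α => real (v α) x) := by
    funext s; rcases s with s | s <;> rfl
  rw [c1, ← hQ2 ℂ] at q4
  generalize MvPolynomial.aeval (Sum.elim (fun i => real (xiW lam i) x) (Sum.elim y y')) (Q α) = A at *
  generalize MvPolynomial.aeval (Sum.elim (fun i => real (Xi i) x) (Sum.elim (fun α => real (v α) x) (fun α => real (v α) x))) (Q α) = A0 at *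
  have q5 : ‖chit x * (A - A0)‖ ≤ δ := by
    rw [norm_mul]
    calc _ ≤ 1 * δ := by gcongr; exact norm_chit_le x
      _ = δ := one_mul _
  have q7 := norm_add_le (chit x * (A - A0)) (chit x * A0)
  rw [← mul_add, sub_add_cancel] at q7
  linarith

set_option maxHeartbeats 600000 in
theorem core [hm : Fact (2 ≤ m)] (h : Ell a c0) : ∃ δ : ℝ, 0 < δ ∧ ∀ (N : MvPolynomial (Fin m ⊕ JJ m) ℂ) (v : JJ m → Wn m) (V : XX m → ℂ),
    ContDiff ℝ 2 V → SuppIn (9/20) V → (∀ α, EqOn (real (v α)) (jet V α) (cell m)) →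
    (∀ x, ‖x‖ < 2/10 → ∑ i, ∑ j, a i j * jet V (jA i j) x + MvPolynomial.aeval (Sum.elim (fun i => (x i : ℂ)) (fun α => jet V α x)) N = 0) →
    (∀ α, ‖wc chit * MvPolynomial.aeval (Sum.elim Xi v) (MvPolynomial.pderiv (Sum.inr α) N)‖ ≤ δ) → AnalyticAt ℝ V 0 := by
  obtain ⟨δ1, hδ1, H1⟩ := ift_exists h
  obtain ⟨cs, hcs, H2⟩ := uniq_small h
  have hδ : 0 < min δ1 (cs / 8) := by positivity
  refine ⟨min δ1 (cs / 8), hδ, fun N v V hV hs hv hpde hN => ?_⟩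
  set δ := min δ1 (cs / 8) with hδd
  have hzc : ∀ α k, co (v α) k = ds α k * co (v jU) k := by
    intro α k
    rw [← coef_real, ← coef_real, coef_congr (hv α), coef_congr (hv jU), jet_coef hV hs]
  have hl0 : ellW (v jU) = 0 := by
    rw [ellW_apply]; apply ellf_zero_of
    intro x hx; rw [hv jU (outr_sub hx)]; exact hs x hx.2
  have hR : (fun α => Rop h α (∑ i, ∑ j, a i j • v (jA i j))) = v := funext fun α => Rop_inv h hzc hl0 α
  obtain ⟨B, hBω, hB0, hBG⟩ := H1 N (∑ i, ∑ j, a i j • v (jA i j)) (by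
    rw [hR]; intro α; exact (hN α).trans (min_le_left _ _))
  rw [hR] at hBG
  -- constants
  obtain ⟨M, hM⟩ : ∃ q : ℝ, q = ∑ i, ‖(Xi i : Wn m)‖ + ∑ α, ‖v α‖ := ⟨_, rfl⟩
  have hM1 : ∀ i x, ‖real (Xi i : Wn m) x‖ ≤ M := fun i x => (norm_real_le _ _).trans (by
    rw [hM]
    have := Finset.single_le_sum (f := fun i => ‖(Xi i : Wn m)‖) (fun _ _ => norm_nonneg _) (Finset.mem_univ i)
    have h2 : 0 ≤ ∑ α, ‖v α‖ := Finset.sum_nonneg fun _ _ => norm_nonneg _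
    linarith)
  have hM2 : ∀ α x, ‖real (v α) x‖ ≤ M := fun α x => (norm_real_le _ _).trans (by
    rw [hM]
    have := Finset.single_le_sum (f := fun α => ‖v α‖) (fun _ _ => norm_nonneg _) (Finset.mem_univ α)
    have h2 : 0 ≤ ∑ i, ‖(Xi i : Wn m)‖ := Finset.sum_nonneg fun _ _ => norm_nonneg _
    linarith)
  have hM0 : 0 ≤ M := (norm_nonneg _).trans (hM2 jU 0)
  obtain ⟨Q, hQ1, hQ2⟩ := hadamard N
  obtain ⟨τQ, hτQ, HQ⟩ := unif_Q Q M hδ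
  obtain ⟨K, hK⟩ : ∃ q : ℝ, q = ‖Jop (0 : XX m)‖ + 1 + ∑ i, ‖(E1 i : Wn m)‖ + ∑ i, ∑ j, ‖(E2 i j : Wn m)‖ := ⟨_, rfl⟩
  obtain ⟨Sa, hSa⟩ : ∃ q : ℝ, q = ∑ i, ∑ j, ‖a i j‖ := ⟨_, rfl⟩
  have hSa0 : 0 ≤ Sa := hSa ▸ Finset.sum_nonneg fun _ _ => Finset.sum_nonneg fun _ _ => norm_nonneg _
  obtain ⟨cd, hcd⟩ : ∃ q : ℝ, q = ((Fintype.card (JJ m) : ℕ) : ℝ) := ⟨_, rfl⟩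
  have hcd0 : 0 ≤ cd := by rw [hcd]; exact Nat.cast_nonneg _
  set τ : ℝ := min (1 / (1 + cd)) (cs / (2 * (1 + Sa))) with hτ
  have hτ0 : 0 < τ := by positivity
  have hτ1 : τ * cd ≤ 1 := by
    calc τ * cd ≤ 1 / (1 + cd) * (1 + cd) := by gcongr; exact min_le_left _ _; linarith
      _ = 1 := by field_simp
  have hτ2 : τ * Sa ≤ cs / 2 := by
    calc τ * Sa ≤ cs / (2 * (1 + Sa)) * (1 + Sa) := by gcongr; exact min_le_right _ _; linarith
      _ = cs / 2 := by field_simp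
  obtain ⟨τT, hτT, HT⟩ := unif_tr (m := m) K hτ0
  have HV : ∀ α, ∃ r, 0 < r ∧ ∀ x y, ‖x - y‖ < r → ‖jet V α x - jet V α y‖ < τQ := by
    intro α
    have := (jet_supp hs α).hcs.uniformContinuous_of_continuous (jet_continuous hV α)
    rw [Metric.uniformContinuous_iff] at this
    obtain ⟨r, hr, hh⟩ := this τQ hτQ
    refine ⟨r, hr, fun x y hxy => ?_⟩
    rw [← dist_eq_norm]; apply hh; rwa [dist_eq_norm]
  choose rV hrV HV using HV
  -- eventual conditions
  have ev1 : ∀ᶠ lam in 𝓝 (0 : XX m), ‖Jop lam‖ < ‖Jop (0 : XX m)‖ + 1 :=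
    (Jop_contDiffAt.continuousAt.norm).eventually_lt continuousAt_const (by simp)
  have hTc : ∀ α, ContinuousAt (fun lam => Tz h lam (B lam) α) 0 := by
    intro α
    have := contDiffAt_tr (n := ω) (J := Jop) (lam := fun i lam => lamW lam i) (w := fun α lam => Rop h α (B lam)) (p := (0 : XX m)) E1 E2
      Jop_contDiffAt (fun i => (lamW_contDiff i).contDiffAt) (fun α => ((Rop h α).restrictScalars ℝ).contDiff.contDiffAt.comp (0 : XX m) hBω) α
    exact this.continuousAt
  have hT0 : ∀ α, Tz h 0 (B 0) α = v α := by
    intro α; rw [Tz_zero, hB0, hR]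
  have ev2 : ∀ᶠ lam in 𝓝 (0 : XX m), ∀ α, ‖Tz h lam (B lam) α - v α‖ < τQ := by
    rw [eventually_all]; intro α
    refine (((hTc α).sub continuousAt_const).norm).eventually_lt continuousAt_const ?_
    show ‖Tz h 0 (B 0) α - v α‖ < τQ
    rw [hT0, sub_self, norm_zero]; exact hτQ
  have ev3 : ∀ {r : ℝ}, 0 < r → ∀ᶠ lam in 𝓝 (0 : XX m), ‖lam‖ < r := fun hr => by
    filter_upwards [Metric.ball_mem_nhds (0 : XX m) hr] with lam hl; simpa using hl
  have ev4 : ∀ᶠ lam in 𝓝 (0 : XX m), ∀ α, ‖lam‖ < rV α := eventually_all.2 fun α => ev3 (hrV α)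
  have key : ∀ᶠ lam in 𝓝 (0 : XX m), V lam = real (Rop h jU (B lam)) 0 := by
    filter_upwards [hBG, Jop_mul, ev1, ev2, ev3 (show (0:ℝ) < 1/10 by norm_num), ev3 hτT, ev3 hτQ, ev4] with lam hG hJ hJn hTn hl1 hlT hlQ hlV
    set w : XX m → ℂ := fun x => V (phi etar lam x) with hw
    have hw2 : ContDiff ℝ 2 w := hV.comp ((phi_contDiff etar_smooth lam).of_le (by norm_cast))
    have hws : SuppIn (9/20) w := by
      intro x hx
      have : etar x = 0 := etar_supp x (by linarith)
      simp only [hw, phi, this, zero_smul, add_zero]; exact hs x hx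
    have hInt : ∀ α, IntegrableOn (jet w α) (cell m) := fun α => (jet_memLp hw2 hws α).integrable (by norm_num)
    have hintR : ∀ b : Wn m, IntegrableOn (real b) (cell m) := fun b => (memLp_real b 1).integrable le_rfl
    have hfin := H2 (fun α x => jet w α x - real (Rop h α (B lam)) x)
      (fun α => ((jet_continuous hw2 α).sub (continuous_real _)).continuousOn)
      (fun α => (jet_memLp hw2 hws α).sub (memLp_real _ 2))
      (fun α k => by
        rw [coef_sub (hInt _) (hintR _), coef_sub (hInt _) (hintR _), jet_coef hw2 hws α, coef_real, coef_real, co_Rop_ds h α]; ring)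
      (fun x hx => by
        have hell : ellf (fun x => jet w jU x - real (Rop h jU (B lam)) x) = - co (B lam) 0 := by
          rw [ellf_sub (jet_memLp hw2 hws jU) (memLp_real _ 2), ← ellW_apply, ellW_Rop, ellf_zero_of, zero_sub]
          intro x hx; exact hws x hx.2
        rw [hell]
        set J : ℂ := real (Jop lam) x with hJd
        set la : Fin m → ℂ := fun i => (lam i : ℂ) with hla
        set e1 : Fin m → ℂ := fun i => real (E1 i) x with he1
        set e2 : Fin m → Fin m → ℂ := fun i j => real (E2 i j) x with he2
        set y : JJ m → ℂ := fun α => jet V α (phi etar lam x) with hy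
        set y' : JJ m → ℂ := fun α => real (Tz h lam (B lam) α) x with hy'
        have hlaW : (fun i => real (lamW lam i) x) = la := funext fun i => real_lamW _ _ _
        have e1eq : (fun i => DD i (fun x => (etar x : ℂ)) x) = e1 := by
          funext i; rw [he1]; simp only [E1]; rw [real_wc (good_eta.DD i) hx]; rfl
        have e2eq : (fun i j => DD j (DD i (fun x => (etar x : ℂ))) x) = e2 := by
          funext i j; rw [he2]; simp only [E2]; rw [real_wc ((good_eta.DD i).DD j) hx]; rfl
        have hJ1 : J * (1 + ∑ l, la l * e1 l) = 1 := by
          have := congrArg (fun b => real b x) hJ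
          simp only [real_mul, real_add, real_one, real_sum, real_lamW] at this
          exact this
        have hyt : ∀ α, y α = tr J la e1 e2 (fun α => jet w α x) α := by
          intro α
          have : (fun α => jet w α x) = psh la e1 e2 y := by
            funext α; rw [← e1eq, ← e2eq]; exact jet_comp etar_smooth lam hV α x
          rw [this, tr_psh J la e1 e2 y hJ1]
        have hyt' : ∀ α, y' α = tr J la e1 e2 (fun α => real (Rop h α (B lam)) x) α := by
          intro α
          rw [hy']; simp only [Tz]; rw [real_tr, hlaW]
        have htr : ∀ α, y α - y' α = tr J la e1 e2 (fun α => jet w α x - real (Rop h α (B lam)) x) α := by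
          intro α; rw [hyt, hyt', tr_sub]
        have hA := pde_pt hv hpde hl1 hx
        have hB : co (B lam) 0 + ∑ i, ∑ j, a i j * y' (jA i j) + chit x * MvPolynomial.aeval (Sum.elim (fun i => real (xiW lam i) x) y') N
           = ∑ i, ∑ j, a i j * real (v (jA i j)) x + chit x * MvPolynomial.aeval (Sum.elim (fun i => real (Xi i) x) (fun α => real (v α) x)) N := by
          have := congrArg (fun b => real b x) hG
          simp only [GG, real_sub, real_add, real_smul, real_one, real_sum, real_mul, real_zero, real_aeval, real_wc good_chit hx] at this
          have c1 : ∀ (p : Fin m → Wn m) (q : JJ m → Wn m), (fun s => real (Sum.elim p q s) x) = Sum.elim (fun i => real (p i) x) (fun α => real (q α) x) := by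
            intro p q; funext s; rcases s with s | s <;> rfl
          rw [c1, c1] at this
          linear_combination this
        have hQe := hQ1 ℂ (fun i => real (xiW lam i) x) y y'
        refine est_pt (τ := τ) (fun α => jet w α x - real (Rop h α (B lam)) x) (fun α => y α - y' α)
          (fun α => chit x * MvPolynomial.aeval (Sum.elim (fun i => real (xiW lam i) x) (Sum.elim y y')) (Q α)) _ ?_ hcs.le ?_ ?_ (hcd ▸ hτ1) (hSa ▸ hτ2)
        · simp only [mul_assoc, ← Finset.mul_sum]
          rw [← hQe]
          simp only [mul_sub, Finset.sum_sub_distrib]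
          linear_combination hA - hB
        · intro α
          simp only [htr]
          have k1 : ‖J‖ ≤ ‖Jop lam‖ := norm_real_le _ _
          have k2 : 0 ≤ ∑ i, ‖(E1 i : Wn m)‖ := Finset.sum_nonneg fun _ _ => norm_nonneg _
          have k3 : 0 ≤ ∑ i, ∑ j, ‖(E2 i j : Wn m)‖ := Finset.sum_nonneg fun _ _ => Finset.sum_nonneg fun _ _ => norm_nonneg _
          have k4 := norm_nonneg (Jop (0 : XX m))
          have kK : 0 ≤ K := by rw [hK]; linarith
          refine HT J la e1 e2 ?_ ?_ ?_ ?_ _ α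
          · rw [hK]; linarith
          · rw [pi_norm_le_iff_of_nonneg kK]; intro i
            have k5 := Finset.single_le_sum (f := fun i => ‖(E1 i : Wn m)‖) (fun _ _ => norm_nonneg _) (Finset.mem_univ i)
            have k6 := norm_real_le (E1 i) x
            rw [hK]; linarith
          · rw [pi_norm_le_iff_of_nonneg kK]; intro i
            rw [pi_norm_le_iff_of_nonneg kK]; intro j
            have k5 := Finset.single_le_sum (f := fun i => ∑ j, ‖(E2 i j : Wn m)‖) (fun _ _ => Finset.sum_nonneg fun _ _ => norm_nonneg _) (Finset.mem_univ i)
            have k7 := Finset.single_le_sum (f := fun j => ‖(E2 i j : Wn m)‖) (fun _ _ => norm_nonneg _) (Finset.mem_univ j)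
            have k6 := norm_real_le (E2 i j) x
            rw [hK]; linarith
          · refine lt_of_le_of_lt ?_ hlT
            rw [pi_norm_le_iff_of_nonneg (norm_nonneg _)]; intro i
            rw [hla]; simp only [Complex.norm_real]; exact norm_le_pi_norm lam i
        · intro α
          exact Q_pt v N Q hQ2 hδ HQ hM0 hM1 hM2 hN hx hlQ y y' (fun α => by
              rw [hy]; simp only; rw [hv α hx]; apply HV
              refine lt_of_le_of_lt ?_ (hlV α)
              simp only [phi, add_sub_cancel_left, norm_smul]
              calc _ ≤ 1 * ‖lam‖ := by gcongr; exact etar_le x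
                _ = _ := one_mul _) (fun α => by
              rw [hy']; simp only; rw [← real_sub]; exact lt_of_le_of_lt (norm_real_le _ _) (hTn α)) hτQ (min_le_right _ _) α) 0 (mem_cell_of (by simp))
    have h0 : jet w jU 0 = V lam := by simp [jet, hw, phi, etar_zero]
    rw [sub_eq_zero, h0] at hfin
    exact hfin
  have hfinal : ContDiffAt ℝ ω (fun lam => real (Rop h jU (B lam)) 0) (0 : XX m) := by
    have := (((evL (0 : XX m)).comp (Rop h jU)).restrictScalars ℝ).contDiff.contDiffAt.comp (0 : XX m) hBω
    exact this
  exact (hfinal.congr_of_eventuallyEq key).analyticAt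

end core2
end Lawlor

namespace Lawlor
open MeasureTheory Set Filter Topology
open scoped Real ContDiff
noncomputable section an
variable {m : ℕ}

/-- rescale the variables of a polynomial -/
def scl {σ : Type*} (t : σ → ℂ) (N : MvPolynomial σ ℂ) : MvPolynomial σ ℂ :=
  MvPolynomial.aeval (fun s => MvPolynomial.C (t s) * MvPolynomial.X s) N

lemma aeval_scl {σ A : Type*} [CommRing A] [Algebra ℂ A] (t : σ → ℂ) (N : MvPolynomial σ ℂ) (z : σ → A) :
    MvPolynomial.aeval z (scl t N) = MvPolynomial.aeval (fun s => t s • z s) N := by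
  unfold scl
  rw [MvPolynomial.comp_aeval_apply]
  congr 2; funext s
  simp [Algebra.smul_def]

lemma pderiv_scl {σ : Type*} (t : σ → ℂ) (s : σ) (N : MvPolynomial σ ℂ) :
    MvPolynomial.pderiv s (scl t N) = MvPolynomial.C (t s) * scl t (MvPolynomial.pderiv s N) := by
  classical
  induction N using MvPolynomial.induction_on with
  | C c => simp [scl]
  | add p q hp hq => simp only [scl, map_add] at *; rw [hp, hq]; ring
  | mul_X p r hp =>
    simp only [scl, map_mul, Derivation.leibniz, MvPolynomial.aeval_X, map_add, smul_eq_mul, MvPolynomial.pderiv_C, MvPolynomial.pderiv_X] at *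
    rw [hp]
    by_cases h : s = r
    · subst h; simp; ring
    · simp [Pi.single_apply, h, Ne.symm h, eq_comm]; ring

lemma DD_scale {g : XX m → ℂ} (hg : ContDiff ℝ 1 g) (ε : ℝ) (i : Fin m) (x : XX m) :
    DD i (fun x => g (ε • x)) x = ε * DD i g (ε • x) := by
  unfold DD
  have h1 : HasFDerivAt (fun x : XX m => ε • x) (ε • ContinuousLinearMap.id ℝ (XX m)) x := (hasFDerivAt_id x).const_smul ε
  have h2 : HasFDerivAt g (fderiv ℝ g (ε • x)) (ε • x) := (hg.differentiable (by norm_num) _).hasFDerivAt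
  have h3 : HasFDerivAt (fun x : XX m => g (ε • x)) _ x := h2.comp x h1
  rw [h3.fderiv]; simp

lemma scale_contDiff {g : XX m → ℂ} {n : WithTop ℕ∞} (hg : ContDiff ℝ n g) (ε : ℝ) : ContDiff ℝ n (fun x => g (ε • x)) :=
  hg.comp (show ContDiff ℝ n (fun x : XX m => ε • x) from contDiff_const_smul ε)

lemma cut_DD {ψ g : XX m → ℂ} (hψ : ContDiff ℝ 1 ψ) (hg : ContDiff ℝ 1 g) (ε : ℝ) (i : Fin m) (x : XX m) :
    DD i (fun x => ψ x * g (ε • x)) x = DD i ψ x * g (ε • x) + ε * (ψ x * DD i g (ε • x)) := by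
  rw [DD_mul (hψ.differentiable (by norm_num) x) ((scale_contDiff hg ε).differentiable (by norm_num) x), DD_scale hg]; ring

section
variable {c : JJ m → Wn m}

lemma isD1 (hc : ∀ α k, co (c α) k = ds α k * co (c jU) k) (i : Fin m) : IsD i (c jU) (c (jP i)) := fun k => by rw [hc (jP i) k]; rfl
lemma isD2 (hc : ∀ α k, co (c α) k = ds α k * co (c jU) k) (i j : Fin m) : IsD j (c (jP i)) (c (jA i j)) := fun k => by
  rw [hc (jP i) k, hc (jA i j) k]; simp only [ds, dk]; ring

lemma jet_real (hc : ∀ α k, co (c α) k = ds α k * co (c jU) k) (α : JJ m) : jet (real (c jU)) α = real (c α) := by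
  have h1 : ∀ i, DD i (real (c jU)) = real (c (jP i)) := fun i => funext fun x => DD_real (isD1 hc) i x
  rcases α with u | i | ⟨i, j⟩
  · rfl
  · exact h1 i
  · simp only [jet]; rw [h1]; exact funext fun x => DD_real (isD2 hc i) j x

lemma contDiff_two_real (hc : ∀ α k, co (c α) k = ds α k * co (c jU) k) : ContDiff ℝ 2 (real (c jU)) := by
  have := contDiff_succ_iff_fderiv (𝕜 := ℝ) (n := 1) (f := real (c jU))
  rw [show (2 : WithTop ℕ∞) = 1 + 1 by norm_num, this]
  refine ⟨fun x => (hasFDerivAt_real (isD1 hc) x).differentiableAt, by simp, ?_⟩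
  rw [show fderiv ℝ (real (c jU)) = fun x => ∑ i, real (c (jP i)) x • (Complex.ofRealCLM ∘L (ContinuousLinearMap.proj i : XX m →L[ℝ] ℝ)) from
    funext fun x => (hasFDerivAt_real (isD1 hc) x).fderiv]
  apply ContDiff.sum; intro i _
  exact (contDiff_real (isD2 hc i)).smul contDiff_const
end

/-- scaled and cut off jets in the Wiener algebra -/
def vS (ε : ℝ) (c : JJ m → Wn m) : JJ m → Wn m
  | Sum.inl _ => ((ε : ℂ)^2)⁻¹ • TT chi ε (c jU)
  | Sum.inr (Sum.inl i) => ((ε : ℂ)^2)⁻¹ • (TT (DD i chi) ε (c jU) + (ε : ℂ) • TT chi ε (c (jP i)))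
  | Sum.inr (Sum.inr (i, j)) => ((ε : ℂ)^2)⁻¹ • (TT (DD j (DD i chi)) ε (c jU) + (ε : ℂ) • TT (DD i chi) ε (c (jP j)) +
      (ε : ℂ) • TT (DD j chi) ε (c (jP i)) + ((ε : ℂ)^2) • TT chi ε (c (jA i j)))

def Vf (ε : ℝ) (u : XX m → ℂ) (x : XX m) : ℂ := ((ε : ℂ)^2)⁻¹ * (chi x * u (ε • x))

/-- the weights -/
def ws (ε : ℝ) : JJ m → ℂ
  | Sum.inl _ => (ε : ℂ)^2
  | Sum.inr (Sum.inl _) => ε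
  | Sum.inr (Sum.inr _) => 1

lemma Vf_contDiff (ε : ℝ) {u : XX m → ℂ} (hu : ContDiff ℝ 2 u) : ContDiff ℝ 2 (Vf ε u) :=
  contDiff_const.mul ((good_chi.smooth.of_le (by norm_cast)).mul (scale_contDiff hu ε))

lemma Vf_jet (ε : ℝ) {u : XX m → ℂ} (hu : ContDiff ℝ 2 u) (α : JJ m) : jet (Vf ε u) α = fun x => ((ε:ℂ)^2)⁻¹ * (match α with
    | Sum.inl _ => chi x * u (ε • x)
    | Sum.inr (Sum.inl i) => DD i chi x * u (ε • x) + ε * (chi x * DD i u (ε • x))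
    | Sum.inr (Sum.inr (i, j)) => DD j (DD i chi) x * u (ε • x) + ε * (DD i chi x * DD j u (ε • x)) + ε * (DD j chi x * DD i u (ε • x))
        + ε ^ 2 * (chi x * DD j (DD i u) (ε • x))) := by
  have hu1 : ContDiff ℝ 1 u := hu.of_le (by norm_num)
  have hd : ∀ i, ContDiff ℝ 1 (DD i u) := fun i => DD_contDiff_succ (n := 1) hu i
  have hc1 : ContDiff ℝ 1 (chi (m := m)) := good_chi.smooth.of_le (by norm_cast)
  have hcd : ∀ i, ContDiff ℝ 1 (DD i (chi (m := m))) := fun i => (good_chi.DD i).smooth.of_le (by norm_cast)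
  have dd : ∀ {g : XX m → ℂ} (x), ContDiff ℝ 1 g → DifferentiableAt ℝ g x := fun x hg => hg.differentiable (by norm_num) x
  have e1 : ∀ i, DD i (Vf ε u) = fun x => ((ε:ℂ)^2)⁻¹ * (DD i chi x * u (ε • x) + ε * (chi x * DD i u (ε • x))) := by
    intro i; funext x
    unfold Vf
    rw [DD_cmul _ (dd x (hc1.mul (scale_contDiff hu1 ε))), cut_DD hc1 hu1]
  rcases α with _ | i | ⟨i, j⟩
  · rfl
  · exact e1 i
  · simp only [jet]; rw [e1]; funext x
    have k1 : ContDiff ℝ 1 (fun x => DD i chi x * u (ε • x)) := (hcd i).mul (scale_contDiff hu1 ε)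
    have k2 : ContDiff ℝ 1 (fun x => chi x * DD i u (ε • x)) := hc1.mul (scale_contDiff (hd i) ε)
    have k3 : ContDiff ℝ 1 (fun x => (ε:ℂ) * (chi x * DD i u (ε • x))) := contDiff_const.mul k2
    rw [DD_cmul _ (dd x (k1.add k3)), DD_add' (dd x k1) (dd x k3), DD_cmul _ (dd x k2), cut_DD (hcd i) hu1, cut_DD hc1 (hd i)]
    ring

lemma real_vS [hm : Fact (2 ≤ m)] {c : JJ m → Wn m} (hc : ∀ α k, co (c α) k = ds α k * co (c jU) k) (ε : ℝ) (α : JJ m) :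
    EqOn (real (vS ε c α)) (jet (Vf ε (real (c jU))) α) (cell m) := by
  intro x hx
  rw [Vf_jet ε (contDiff_two_real hc)]
  have j1 := fun i => jet_real hc (jP i)
  have j2 := fun i j => jet_real hc (jA i j)
  simp only [jet] at j1 j2
  rcases α with _ | i | ⟨i, j⟩
  · simp only [vS, real_smul, real_TT good_chi ε _ hx]
  · simp only [vS, real_smul, real_add, real_TT good_chi ε _ hx, real_TT (good_chi.DD i) ε _ hx, j1]
  · simp only [vS, real_smul, real_add, real_TT good_chi ε _ hx, real_TT (good_chi.DD i) ε _ hx, real_TT (good_chi.DD j) ε _ hx, real_TT ((good_chi.DD i).DD j) ε _ hx, j1]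
    rw [← j2, ← j1 i]

lemma jet_congr {V : Set (XX m)} (hV : IsOpen V) {g h : XX m → ℂ} (hgh : EqOn g h V) (α : JJ m) : EqOn (jet g α) (jet h α) V := by
  rcases α with _ | i | ⟨i, j⟩
  · exact hgh
  · exact DD_congr hV hgh i
  · exact DD_congr hV (DD_congr hV hgh i) j

lemma ws_jet {ε : ℝ} (hε : ε ≠ 0) {u : XX m → ℂ} (hu : ContDiff ℝ 2 u) (α : JJ m) {x : XX m} (hx : ‖x‖ < 2/10) :
    ws ε α * jet (Vf ε u) α x = jet u α (ε • x) := by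
  have hu1 : ContDiff ℝ 1 u := hu.of_le (by norm_num)
  have hd : ∀ i, ContDiff ℝ 1 (DD i u) := fun i => DD_contDiff_succ (n := 1) hu i
  have hE : EqOn (Vf ε u) (fun x => ((ε:ℂ)^2)⁻¹ * u (ε • x)) (Metric.ball 0 (2/10)) := by
    intro y hy
    have : ‖y‖ < 2/10 := by simpa using hy
    simp only [Vf, chi_one y this.le, one_mul]
  have dd : ∀ {g : XX m → ℂ} (x), ContDiff ℝ 1 g → DifferentiableAt ℝ g x := fun x hg => hg.differentiable (by norm_num) x
  have hεC : (ε : ℂ) ≠ 0 := by exact_mod_cast hε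
  rw [jet_congr Metric.isOpen_ball hE α (by simpa using hx)]
  have e1 : ∀ i, DD i (fun x => ((ε:ℂ)^2)⁻¹ * u (ε • x)) = fun x => ((ε:ℂ)^2)⁻¹ * (ε * DD i u (ε • x)) := by
    intro i; funext x
    rw [DD_cmul _ (dd x (scale_contDiff hu1 ε)), DD_scale hu1]
  rcases α with _ | i | ⟨i, j⟩
  · simp only [ws, jet]; field_simp
  · simp only [ws, jet]; rw [e1]; field_simp
  · simp only [ws, jet]; rw [e1, DD_cmul _ (dd x (contDiff_const.mul (scale_contDiff (hd i) ε))), DD_cmul _ (dd x (scale_contDiff (hd i) ε)), DD_scale (hd i)]; field_simp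


lemma ws_tendsto {α : JJ m} (h : ∀ i j, α ≠ jA i j) : Tendsto (fun ε : ℝ => ws ε α) (𝓝 0) (𝓝 0) := by
  have h1 : Tendsto (fun ε : ℝ => (ε : ℂ)) (𝓝 0) (𝓝 0) := by
    have := Complex.continuous_ofReal.tendsto 0; simpa using this
  rcases α with _ | i | ⟨i, j⟩
  · simp only [ws]; have := h1.pow 2; simpa using this
  · exact h1
  · exact absurd rfl (h i j)

theorem AN [hm : Fact (2 ≤ m)] (E : MvPolynomial (Fin m ⊕ JJ m) ℂ) (c : JJ m → Wn m) (hc : ∀ α k, co (c α) k = ds α k * co (c jU) k)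
    {r : ℝ} (hr : 0 < r) (hE : ∀ x : XX m, ‖x‖ < r → MvPolynomial.aeval (Sum.elim (fun i => (x i : ℂ)) (fun α => real (c α) x)) E = 0)
    {c0 : ℝ} (h : Ell (fun i j => MvPolynomial.aeval (Sum.elim (fun _ : Fin m => (0:ℂ)) (fun α => real (c α) 0)) (MvPolynomial.pderiv (Sum.inr (jA i j)) E)) c0) :
    AnalyticAt ℝ (real (c jU)) 0 := by
  obtain ⟨δ, hδ, H⟩ := core h
  set a : Fin m → Fin m → ℂ := fun i j => MvPolynomial.aeval (Sum.elim (fun _ : Fin m => (0:ℂ)) (fun α => real (c α) 0)) (MvPolynomial.pderiv (Sum.inr (jA i j)) E) with ha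
  set N : MvPolynomial (Fin m ⊕ JJ m) ℂ := E - ∑ i, ∑ j, MvPolynomial.C (a i j) * MvPolynomial.X (Sum.inr (jA i j)) with hN
  have hu := contDiff_two_real hc
  set u := real (c jU) with hud
  have hNe : ∀ (z : Fin m ⊕ JJ m → ℂ), MvPolynomial.aeval z N = MvPolynomial.aeval z E - ∑ i, ∑ j, a i j * z (Sum.inr (jA i j)) := by
    intro z; rw [hN]; simp [map_sum]
  have hNd : ∀ i j, MvPolynomial.pderiv (Sum.inr (jA i j)) N = MvPolynomial.pderiv (Sum.inr (jA i j)) E - MvPolynomial.C (a i j) := by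
    intro i j
    rw [hN, map_sub, map_sum]
    congr 1
    simp only [map_sum, Derivation.leibniz, MvPolynomial.pderiv_C, MvPolynomial.pderiv_X, smul_zero, add_zero, smul_eq_mul]
    rw [Finset.sum_eq_single i, Finset.sum_eq_single j]
    · simp
    · intro l _ hl; simp [Pi.single_apply, hl]
    · simp
    · intro l _ hl; apply Finset.sum_eq_zero; intro k _; simp [Pi.single_apply, hl]
    · simp
  set hh : JJ m → Wn m := fun α => MvPolynomial.aeval (Sum.elim Xi c) (MvPolynomial.pderiv (Sum.inr α) N) with hhd
  have hhr : ∀ α (x : XX m), ‖x‖ ≤ 2/10 → real (hh α) x = MvPolynomial.aeval (Sum.elim (fun i => (x i : ℂ)) (fun α => real (c α) x)) (MvPolynomial.pderiv (Sum.inr α) N) := by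
    intro α x hx
    rw [hhd]; simp only; rw [real_aeval]
    congr 2; funext s; rcases s with s | s
    · exact real_Xi s hx
    · rfl
  have hh0 : ∀ i j, real (hh (jA i j)) 0 = 0 := by
    intro i j
    rw [hhr _ _ (by rw [norm_zero]; norm_num), hNd, map_sub, MvPolynomial.aeval_C]
    simp only [ha, Pi.zero_apply, Complex.ofReal_zero]; simp
  have htend : ∀ α, Tendsto (fun ε : ℝ => ‖ws ε α • TT chit ε (hh α)‖) (𝓝 0) (𝓝 0) := by
    intro α
    by_cases hα : ∃ i j, α = jA i j
    · obtain ⟨i, j, rfl⟩ := hα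
      have := (TT_tendsto good_chit (hh (jA i j))).norm
      rw [hh0, zero_smul, norm_zero] at this
      simpa [ws] using this
    · push Not at hα
      have h1 : Tendsto (fun ε : ℝ => ws ε α • TT chit ε (hh α)) (𝓝 0) (𝓝 ((0:ℂ) • (real (hh α) 0 • wc chit))) :=
        (ws_tendsto hα).smul (TT_tendsto good_chit (hh α))
      have h2 := h1.norm
      simpa using h2
  have hev : ∀ᶠ ε in 𝓝[>] (0:ℝ), (∀ α, ‖ws ε α • TT chit ε (hh α)‖ < δ) ∧ ε < 1 ∧ ε < r := by
    apply nhdsWithin_le_nhds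
    refine (eventually_all.2 fun α => (htend α).eventually_lt_const hδ).and ((gt_mem_nhds one_pos).and (gt_mem_nhds hr))
  obtain ⟨ε, ⟨hε1, hε2, hε3⟩, hε⟩ := (hev.and self_mem_nhdsWithin).exists
  have hε : 0 < ε := hε
  have hεC : (ε : ℂ) ≠ 0 := by exact_mod_cast hε.ne'
  have hsc : ∀ x : XX m, ‖x‖ < 2/10 → ‖ε • x‖ < 2/10 ∧ ‖ε • x‖ < r := by
    intro x hx
    rw [norm_smul, Real.norm_of_nonneg hε.le]
    constructor
    · calc ε * ‖x‖ ≤ 1 * ‖x‖ := by gcongr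
        _ < _ := by linarith
    · calc ε * ‖x‖ ≤ ε * 1 := by gcongr; linarith
        _ < _ := by linarith
  have key := H (scl (Sum.elim (fun _ => (ε : ℂ)) (ws ε)) N) (vS ε c) (Vf ε u) (Vf_contDiff ε hu)
    (fun x hx => by simp [Vf, chi_zero x (by linarith)]) (real_vS hc ε)
    (fun x hx => by
      rw [aeval_scl]
      have e : (fun s => (Sum.elim (fun _ => (ε : ℂ)) (ws ε) : Fin m ⊕ JJ m → ℂ) s • (Sum.elim (fun i => ((x i : ℝ) : ℂ)) (fun α => jet (Vf ε u) α x) : Fin m ⊕ JJ m → ℂ) s)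
         = Sum.elim (fun i => (((ε • x) i : ℝ) : ℂ)) (fun α => real (c α) (ε • x)) := by
        funext s; rcases s with s | s
        · simp
        · simp only [Sum.elim_inr, smul_eq_mul]; rw [ws_jet hε.ne' hu s hx, jet_real hc]
      rw [e, hNe, hE _ (hsc x hx).2]
      have e2 : ∀ i j, jet (Vf ε u) (jA i j) x = real (c (jA i j)) (ε • x) := by
        intro i j
        have := ws_jet hε.ne' hu (jA i j) hx
        rw [jet_real hc] at this
        simpa [ws] using this
      simp only [e2, Sum.elim_inr]; rw [zero_sub]; exact add_neg_cancel _)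
    (fun α => by
      have e : wc chit * MvPolynomial.aeval (Sum.elim Xi (vS ε c)) (MvPolynomial.pderiv (Sum.inr α) (scl (Sum.elim (fun _ => (ε : ℂ)) (ws ε)) N)) = ws ε α • TT chit ε (hh α) := by
        apply real_inj
        intro x hx
        rw [pderiv_scl, map_mul, MvPolynomial.aeval_C, aeval_scl, real_mul, real_mul, real_smul, real_wc good_chit hx, real_TT good_chit ε _ hx, real_aeval,
          Algebra.algebraMap_eq_smul_one, real_smul, real_one, mul_one]
        simp only [Sum.elim_inr]
        by_cases hx2 : ‖x‖ < 2/10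
        · have e3 : (fun s => real ((Sum.elim (fun _ => (ε : ℂ)) (ws ε) : Fin m ⊕ JJ m → ℂ) s • (Sum.elim Xi (vS ε c) : Fin m ⊕ JJ m → Wn m) s) x)
             = Sum.elim (fun i => (((ε • x) i : ℝ) : ℂ)) (fun α => real (c α) (ε • x)) := by
            funext s; rcases s with s | s
            · simp only [Sum.elim_inl, real_smul]; rw [real_Xi s hx2.le]; simp
            · simp only [Sum.elim_inr, real_smul]; rw [real_vS hc ε s hx, ws_jet hε.ne' hu s hx2, jet_real hc]
          rw [e3, hhr _ _ (hsc x hx2).1.le]; ring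
        · rw [chit_zero x (not_lt.1 hx2)]; ring
      rw [e]; exact (hε1 α).le)
  have e3 : u =ᶠ[𝓝 0] fun y => (ε : ℂ)^2 * Vf ε u (ε⁻¹ • y) := by
    have hcont : ∀ᶠ y : XX m in 𝓝 0, ‖ε⁻¹ • y‖ < 2/10 := by
      have : ContinuousAt (fun y : XX m => ‖ε⁻¹ • y‖) 0 := by fun_prop
      exact this.eventually_lt continuousAt_const (by simp)
    filter_upwards [hcont] with y hy
    have := ws_jet hε.ne' hu jU hy
    simp only [ws, jet] at this
    rw [this, smul_smul, mul_inv_cancel₀ hε.ne', one_smul]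
  refine AnalyticAt.congr ?_ e3.symm
  have h1 : AnalyticAt ℝ (fun y : XX m => ε⁻¹ • y) 0 := (ε⁻¹ • ContinuousLinearMap.id ℝ (XX m)).analyticAt 0
  have h2 : AnalyticAt ℝ (fun y : XX m => Vf ε u (ε⁻¹ • y)) 0 := AnalyticAt.comp' (g := Vf ε u) (by simpa using key) h1
  exact analyticAt_const.mul h2

end an
end Lawlor

namespace Lawlor
open MeasureTheory Set Filter Topology
open scoped Real ContDiff
noncomputable section ellip
variable {m : ℕ}

lemma ell_of_ne {a : Fin m → Fin m → ℂ} (h : ∀ k : XX m, k ≠ 0 → ∑ i, ∑ j, a i j * ((k i : ℂ) * (k j : ℂ)) ≠ 0) : ∃ c0, Ell a c0 := by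
  set q : XX m → ℂ := fun k => ∑ i, ∑ j, a i j * ((k i : ℂ) * (k j : ℂ)) with hq
  have hqc : Continuous q := by rw [hq]; fun_prop
  have hhom : ∀ (t : ℝ) (k : XX m), q (t • k) = (t : ℂ)^2 * q k := by
    intro t k
    rw [hq]; simp only [Finset.mul_sum, Pi.smul_apply, smul_eq_mul, Complex.ofReal_mul]
    refine Finset.sum_congr rfl fun i _ => Finset.sum_congr rfl fun j _ => by ring
  have hmin : ∃ c > 0, ∀ k : XX m, ‖k‖ = 1 → c ≤ ‖q k‖ := by
    rcases (Metric.sphere (0 : XX m) 1).eq_empty_or_nonempty with he | hne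
    · refine ⟨1, one_pos, fun k hk => ?_⟩
      have : k ∈ Metric.sphere (0 : XX m) 1 := by simpa using hk
      rw [he] at this; exact absurd this (by simp)
    · obtain ⟨k0, hk0, hmin⟩ := (isCompact_sphere (0 : XX m) 1).exists_isMinOn hne hqc.norm.continuousOn
      refine ⟨‖q k0‖, norm_pos_iff.2 (h k0 ?_), fun k hk => hmin (by simpa using hk)⟩
      intro h0; rw [h0] at hk0; simp at hk0
  obtain ⟨c, hc, hmin⟩ := hmin
  refine ⟨c, hc, fun k => ?_⟩
  have hsg : sg a k = ((2 * π * Complex.I : ℂ))^2 * q (fun i => (k i : ℝ)) := by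
    rw [hq]; simp only [sg, dk, Finset.mul_sum]
    refine Finset.sum_congr rfl fun i _ => Finset.sum_congr rfl fun j _ => ?_
    push_cast; ring
  have hn : ‖(fun i => (k i : ℝ) : XX m)‖ = ‖k‖ := by
    simp only [Pi.norm_def]; congr 1
  by_cases h0 : (fun i => (k i : ℝ) : XX m) = 0
  · rw [h0, norm_zero] at hn; rw [← hn]; simp
  · have hp : 0 < ‖(fun i => (k i : ℝ) : XX m)‖ := norm_pos_iff.2 h0
    have := hmin (‖(fun i => (k i : ℝ) : XX m)‖⁻¹ • (fun i => (k i : ℝ) : XX m)) (by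
      rw [norm_smul, norm_inv, norm_norm, inv_mul_cancel₀ hp.ne'])
    rw [hhom, norm_mul, norm_pow, Complex.norm_real, norm_inv, norm_norm, hn, inv_pow] at this
    rw [hn] at hp
    rw [← div_eq_inv_mul, le_div_iff₀ (by positivity)] at this
    rw [hsg, norm_mul]
    refine this.trans (le_mul_of_one_le_left (norm_nonneg _) ?_)
    rw [norm_pow, norm_mul, norm_mul, Complex.norm_I, mul_one, Complex.norm_real, Real.norm_of_nonneg Real.pi_pos.le]
    have := Real.pi_gt_three
    simp only [Complex.norm_ofNat]
    nlinarith

lemma dir_deriv {σ : Type*} [Fintype σ] [DecidableEq σ] (p : MvPolynomial σ ℂ) (z κ : σ → ℂ) :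
    HasDerivAt (fun t : ℂ => MvPolynomial.aeval (fun s => z s + t * κ s) p) (∑ s, MvPolynomial.aeval z (MvPolynomial.pderiv s p) * κ s) 0 := by
  induction p using MvPolynomial.induction_on with
  | C c => simpa using hasDerivAt_const (0:ℂ) c
  | add p q hp hq =>
    simp only [map_add, add_mul, Finset.sum_add_distrib]; exact hp.add hq
  | mul_X p r hp =>
    have h1 : HasDerivAt (fun t : ℂ => z r + t * κ r) (κ r) 0 := by
      simpa using ((hasDerivAt_id (0:ℂ)).mul_const (κ r)).const_add (z r)
    have := hp.mul h1
    simp only [zero_mul, add_zero] at this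
    simp only [map_mul, MvPolynomial.aeval_X]
    refine this.congr_deriv ?_
    simp only [Derivation.leibniz, smul_eq_mul, map_add, map_mul, MvPolynomial.aeval_X, MvPolynomial.pderiv_X, add_mul, Finset.sum_add_distrib]
    have h2 : ∑ x, (MvPolynomial.aeval z p) * MvPolynomial.aeval z (Pi.single (M := fun _ => MvPolynomial σ ℂ) x 1 r) * κ x = MvPolynomial.aeval z p * κ r := by
      rw [Finset.sum_eq_single r]
      · simp
      · intro b _ hb; simp [hb.symm]
      · simp
    rw [h2, Finset.sum_mul]
    rw [add_comm]; congr 1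
    apply Finset.sum_congr rfl; intros; ring

open Matrix in
lemma det_rank_one (B : Matrix (Fin m) (Fin m) ℂ) (u v : Fin m → ℂ) :
    (B + vecMulVec u v).det = B.det + v ⬝ᵥ (B.adjugate *ᵥ u) := by
  have key : (fun t : ℂ => ((t • (1 : Matrix (Fin m) (Fin m) ℂ) + B) + vecMulVec u v).det) = fun t : ℂ =>
      (t • (1 : Matrix (Fin m) (Fin m) ℂ) + B).det + v ⬝ᵥ ((t • (1 : Matrix (Fin m) (Fin m) ℂ) + B).adjugate *ᵥ u) := by
    have hfin : {t : ℂ | (-B).charpoly.eval t = 0}.Finite := by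
      refine ((-B).charpoly.roots.toFinset.finite_toSet).subset fun t ht => ?_
      simpa [Polynomial.mem_roots (Matrix.charpoly_monic (-B)).ne_zero] using ht
    have hd : Dense ({t : ℂ | (-B).charpoly.eval t = 0}ᶜ) := hfin.countable.dense_compl ℝ
    refine Continuous.ext_on hd ?_ ?_ ?_
    · exact Continuous.matrix_det (by fun_prop)
    · refine Continuous.add (Continuous.matrix_det (by fun_prop)) (Continuous.dotProduct continuous_const (Continuous.matrix_mulVec (Continuous.matrix_adjugate (by fun_prop)) continuous_const))
    · intro t ht
      have h1 : (t • (1 : Matrix (Fin m) (Fin m) ℂ) + B).det ≠ 0 := by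
        intro h; apply ht
        rw [mem_ofPred_eq, Matrix.eval_charpoly]
        rw [← h]; congr 1; ext i j; simp [Matrix.scalar_apply, Matrix.diagonal, Matrix.one_apply]
      have h2 := det_add_replicateCol_mul_replicateRow (ι := Unit) (isUnit_iff_ne_zero.2 h1) u v
      simp only
      generalize t • (1 : Matrix (Fin m) (Fin m) ℂ) + B = M at *
      rw [← Matrix.vecMulVec_eq] at h2
      rw [h2, det_unique (n := Unit)]
      rw [Matrix.inv_def, Ring.inverse_eq_inv']
      have h3 : (1 + replicateRow Unit v * M.det⁻¹ • M.adjugate * replicateCol Unit u : Matrix Unit Unit ℂ) default default = 1 + M.det⁻¹ * (replicateRow Unit v * M.adjugate * replicateCol Unit u : Matrix Unit Unit ℂ) default default := by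
        rw [Matrix.mul_smul, Matrix.smul_mul, Matrix.add_apply, Matrix.smul_apply, one_apply_eq, smul_eq_mul]
      rw [h3, mul_add, mul_one, mul_inv_cancel_left₀ h1]
      congr 1
      simp [Matrix.mul_apply, dotProduct, mulVec, Finset.mul_sum, Finset.sum_mul]
      rw [Finset.sum_comm]
      refine Finset.sum_congr rfl fun i _ => Finset.sum_congr rfl fun j _ => by ring
  simpa using congrFun key 0
end ellip
end Lawlor

namespace Lawlor
open MeasureTheory Set Filter Topology
open scoped Real ContDiff
noncomputable section ellip2
variable {m : ℕ}
open Matrix MvPolynomial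

def matA (m : ℕ) : Matrix (Fin m) (Fin m) (MvPolynomial (Fin m ⊕ JJ m) ℂ) := Matrix.of fun i j => X (Sum.inr (jA i j))

def EQ1 (m : ℕ) : MvPolynomial (Fin m ⊕ JJ m) ℂ := (1 + (C Complex.I : MvPolynomial (Fin m ⊕ JJ m) ℂ) • matA m).det - (1 - (C Complex.I : MvPolynomial (Fin m ⊕ JJ m) ℂ) • matA m).det

def cm (A : Matrix (Fin m) (Fin m) ℝ) : Matrix (Fin m) (Fin m) ℂ := A.map (fun x : ℝ => (x : ℂ))

lemma E1_eval (z : Fin m ⊕ JJ m → ℂ) : aeval z (EQ1 m) =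
    (1 + Complex.I • (Matrix.of fun i j => z (Sum.inr (jA i j)))).det - (1 - Complex.I • (Matrix.of fun i j => z (Sum.inr (jA i j)))).det := by
  rw [EQ1, map_sub, AlgHom.map_det, AlgHom.map_det]
  congr 2 <;> (ext i j; simp [matA, Matrix.one_apply, apply_ite (aeval z)])

lemma re_quad {A : Matrix (Fin m) (Fin m) ℝ} (hA : Aᵀ = A) (w : Fin m → ℂ) :
    (star w ⬝ᵥ ((1 + Complex.I • cm A) *ᵥ w)).re = ∑ i, ‖w i‖^2 := by
  have hH : (cm A).IsHermitian := by
    ext i j; rw [conjTranspose_apply]; simp only [cm, map_apply]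
    rw [show A j i = A i j from congrFun (congrFun hA i) j]; simp
  have := hH.im_star_dotProduct_mulVec_self w
  rw [add_mulVec, dotProduct_add, one_mulVec, smul_mulVec, dotProduct_smul, Complex.add_re, smul_eq_mul, Complex.I_mul_re]
  rw [show (star w ⬝ᵥ cm A *ᵥ w).im = 0 from this, neg_zero, add_zero]
  simp only [dotProduct, Complex.re_sum]
  refine Finset.sum_congr rfl fun i _ => ?_
  rw [Pi.star_apply, Complex.star_def, ← Complex.normSq_eq_conj_mul_self, Complex.ofReal_re, Complex.normSq_eq_norm_sq]

lemma sumsq_zero {w : Fin m → ℂ} (h : ∑ i, ‖w i‖^2 = 0) : w = 0 := by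
  ext i
  have := (Finset.sum_eq_zero_iff_of_nonneg (fun i _ => by positivity)).1 h i (Finset.mem_univ _)
  simpa using this

lemma det_ne {A : Matrix (Fin m) (Fin m) ℝ} (hA : Aᵀ = A) : (1 + Complex.I • cm A).det ≠ 0 := by
  intro h
  obtain ⟨w, hw, h0⟩ := exists_mulVec_eq_zero_iff.2 h
  have := re_quad hA w
  rw [h0, dotProduct_zero] at this
  exact hw (sumsq_zero (by simpa using this.symm))

lemma conj_B (A : Matrix (Fin m) (Fin m) ℝ) : (1 + Complex.I • cm A).map (starRingEnd ℂ) = 1 - Complex.I • cm A := by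
  ext i j; simp [cm, Matrix.one_apply, apply_ite (starRingEnd ℂ)]; ring

lemma ell_key {A : Matrix (Fin m) (Fin m) ℝ} (hA : Aᵀ = A) (hd : (1 + Complex.I • cm A).det = (1 - Complex.I • cm A).det)
    {k : XX m} (hk : k ≠ 0) : (fun i => (k i : ℂ)) ⬝ᵥ ((1 + Complex.I • cm A).adjugate *ᵥ (fun i => (k i : ℂ))) +
      (fun i => (k i : ℂ)) ⬝ᵥ ((1 - Complex.I • cm A).adjugate *ᵥ (fun i => (k i : ℂ))) ≠ 0 := by
  obtain ⟨B, hB⟩ : ∃ B, B = 1 + Complex.I • cm A := ⟨_, rfl⟩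
  obtain ⟨κ, hκ⟩ : ∃ κ : Fin m → ℂ, κ = fun i => (k i : ℂ) := ⟨_, rfl⟩
  have hdB := det_ne hA
  have hq := re_quad hA (B.adjugate *ᵥ κ)
  rw [← conj_B, ← hB] at hd ⊢
  rw [← hB] at hq hdB
  rw [← hκ]
  have hre : (starRingEnd ℂ) B.det = B.det := by
    rw [RingHom.map_det]; exact hd.symm
  have h1 : κ ⬝ᵥ ((B.map (starRingEnd ℂ)).adjugate *ᵥ κ) = (starRingEnd ℂ) (κ ⬝ᵥ (B.adjugate *ᵥ κ)) := by
    have : (B.map (starRingEnd ℂ)).adjugate = B.adjugate.map (starRingEnd ℂ) := (RingHom.map_adjugate (starRingEnd ℂ) B).symm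
    rw [this]
    simp [dotProduct, mulVec, hκ]
  rw [h1, Complex.add_conj]
  intro h0
  have h2 : (κ ⬝ᵥ (B.adjugate *ᵥ κ)).re = 0 := by
    have := congrArg Complex.re h0
    simpa using this
  rw [mulVec_mulVec, mul_adjugate, smul_mulVec, one_mulVec, dotProduct_smul] at hq
  have h3 : star (B.adjugate *ᵥ κ) ⬝ᵥ κ = (starRingEnd ℂ) (κ ⬝ᵥ (B.adjugate *ᵥ κ)) := by
    simp only [dotProduct, map_sum, map_mul, Pi.star_apply, Complex.star_def]
    refine Finset.sum_congr rfl fun i _ => ?_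
    rw [hκ]; simp [mul_comm]
  rw [h3, smul_eq_mul, Complex.mul_re, Complex.conj_re, h2, Complex.conj_eq_iff_im.1 hre] at hq
  have hw := sumsq_zero (w := B.adjugate *ᵥ κ) (by rw [← hq]; ring)
  have h4 : B *ᵥ (B.adjugate *ᵥ κ) = B.det • κ := by rw [mulVec_mulVec, mul_adjugate, smul_mulVec, one_mulVec]
  rw [hw, mulVec_zero] at h4
  have : κ = 0 := by
    rcases smul_eq_zero.1 h4.symm with h | h
    · exact absurd h hdB
    · exact h
  apply hk; ext i
  have := congrFun this i
  rw [hκ] at this; simpa using this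

lemma E1_ell {A : Matrix (Fin m) (Fin m) ℝ} (hA : Aᵀ = A) {z : Fin m ⊕ JJ m → ℂ} (hz : ∀ i j, z (Sum.inr (jA i j)) = A i j)
    (hE : aeval z (EQ1 m) = 0) : ∃ c0, Ell (fun i j => aeval z (pderiv (Sum.inr (jA i j)) (EQ1 m))) c0 := by
  apply ell_of_ne
  intro k hk
  have hzA : (Matrix.of fun i j => z (Sum.inr (jA i j))) = cm A := by ext i j; simp [hz, cm]
  rw [E1_eval, hzA, sub_eq_zero] at hE
  have hell := ell_key hA hE hk
  obtain ⟨κ, hκ⟩ : ∃ κ : Fin m ⊕ JJ m → ℂ, κ = Sum.elim (fun _ => 0) (Sum.elim (fun _ => 0) (Sum.elim (fun _ => 0) (fun p => (k p.1 : ℂ) * (k p.2 : ℂ)))) := ⟨_, rfl⟩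
  have hdd := dir_deriv (EQ1 m) z κ
  have hs : ∑ s, aeval z (pderiv s (EQ1 m)) * κ s = ∑ i, ∑ j, aeval z (pderiv (Sum.inr (jA i j)) (EQ1 m)) * ((k i : ℂ) * (k j : ℂ)) := by
    rw [Fintype.sum_sum_type, Fintype.sum_sum_type, Fintype.sum_sum_type, Fintype.sum_prod_type]
    simp [hκ, jA]
  rw [← hs]
  obtain ⟨p, hp⟩ : ∃ p : ℂ, p = (fun i => (k i : ℂ)) ⬝ᵥ ((1 + Complex.I • cm A).adjugate *ᵥ (fun i => (k i : ℂ))) := ⟨_, rfl⟩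
  obtain ⟨q, hq⟩ : ∃ q : ℂ, q = (fun i => (k i : ℂ)) ⬝ᵥ ((1 - Complex.I • cm A).adjugate *ᵥ (fun i => (k i : ℂ))) := ⟨_, rfl⟩
  rw [← hp, ← hq] at hell
  have hfun : (fun t : ℂ => aeval (fun s => z s + t * κ s) (EQ1 m)) = fun t => t * (Complex.I * (p + q)) := by
    ext t
    rw [E1_eval]
    have e : (Matrix.of fun i j => z (Sum.inr (jA i j)) + t * κ (Sum.inr (jA i j))) = cm A + t • vecMulVec (fun i => (k i : ℂ)) (fun i => (k i : ℂ)) := by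
      ext i j; simp [hz, cm, hκ, jA, vecMulVec_apply]
    rw [e]
    have e1 : 1 + Complex.I • (cm A + t • vecMulVec (fun i => (k i : ℂ)) (fun i => (k i : ℂ))) = (1 + Complex.I • cm A) + vecMulVec ((t * Complex.I) • (fun i => (k i : ℂ))) (fun i => (k i : ℂ)) := by
      rw [smul_vecMulVec, smul_add, smul_smul, add_assoc, mul_comm t]
    have e2 : 1 - Complex.I • (cm A + t • vecMulVec (fun i => (k i : ℂ)) (fun i => (k i : ℂ))) = (1 - Complex.I • cm A) + vecMulVec ((-(t * Complex.I)) • (fun i => (k i : ℂ))) (fun i => (k i : ℂ)) := by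
      rw [smul_vecMulVec, smul_add, smul_smul, neg_smul, mul_comm t]; abel
    rw [e1, e2, det_rank_one, det_rank_one, mulVec_smul, mulVec_smul, dotProduct_smul, dotProduct_smul, ← hp, ← hq, hE, smul_eq_mul, smul_eq_mul]
    ring
  rw [hfun] at hdd
  have h2 : HasDerivAt (fun t : ℂ => t * (Complex.I * (p + q))) (Complex.I * (p+q)) 0 := by
    simpa using (hasDerivAt_id (0:ℂ)).mul_const (Complex.I * (p + q))
  rw [hdd.unique h2]
  exact mul_ne_zero Complex.I_ne_zero hell
end ellip2
end Lawlor

namespace Lawlor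
open MeasureTheory Set Filter Topology
open scoped Real ContDiff
noncomputable section interior
variable {m : ℕ}
open Matrix MvPolynomial

lemma cut_good {h : XX m → ℂ} (hh : ContDiffOn ℝ ∞ h (Metric.ball 0 1)) : Good (fun x => chi x * h x) := by
  refine ⟨contDiff_iff_contDiffAt.2 fun x => ?_, fun x hx => by rw [chi_zero x (by linarith), zero_mul]⟩
  by_cases hx : ‖x‖ < 1
  · exact good_chi.smooth.contDiffAt.mul (hh.contDiffAt (Metric.isOpen_ball.mem_nhds (by simpa using hx)))
  · have : (fun x => chi x * h x) =ᶠ[𝓝 x] fun _ => 0 := by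
      have : ∀ᶠ y in 𝓝 x, 3/10 < ‖y‖ := continuous_norm.continuousAt.eventually (lt_mem_nhds (by push Not at hx; linarith))
      filter_upwards [this] with y hy
      rw [chi_zero y hy.le, zero_mul]
    exact contDiffAt_const.congr_of_eventuallyEq this

lemma DD_affine {u : XX m → ℂ} (x0 : XX m) (s : ℝ) (c : ℂ) {x : XX m} (hu : DifferentiableAt ℝ u (x0 + s • x)) (i : Fin m) :
    DD i (fun x => c * u (x0 + s • x)) x = c * s * DD i u (x0 + s • x) := by
  have h1 : HasFDerivAt (fun x : XX m => x0 + s • x) (s • ContinuousLinearMap.id ℝ (XX m)) x :=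
    ((hasFDerivAt_id x).const_smul s).const_add x0
  have h2 := (hu.hasFDerivAt.comp x h1).const_mul c
  unfold DD
  rw [HasFDerivAt.fderiv (f := fun x => c * u (x0 + s • x)) h2]
  simp; ring

lemma jet_good {g : XX m → ℂ} (hg : Good g) (α : JJ m) : Good (jet g α) := by
  rcases α with _ | i | ⟨i, j⟩
  · exact hg
  · exact hg.DD i
  · exact (hg.DD i).DD j

lemma ds_symm (i j : Fin m) (k : KK m) : ds (jA i j) k = ds (jA j i) k := by
  simp only [ds, jA]; ring

theorem interior_analytic [hm : Fact (2 ≤ m)] {u : XX m → ℂ} {O : Set (XX m)} (hO : IsOpen O) (hu : ContDiffOn ℝ ∞ u O)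
    {x0 : XX m} (hx0 : x0 ∈ O) (hreal : ∀ i j, ∃ a : ℝ, DD j (DD i u) x0 = a)
    (hE : ∀ x ∈ O, (1 + Complex.I • (Matrix.of fun i j => DD j (DD i u) x)).det - (1 - Complex.I • (Matrix.of fun i j => DD j (DD i u) x)).det = 0) :
    AnalyticAt ℝ u x0 := by
  obtain ⟨s, hs, hsO⟩ := Metric.isOpen_iff.1 hO x0 hx0
  have hs' : (s : ℂ) ≠ 0 := by exact_mod_cast hs.ne'
  have hmem : ∀ x : XX m, ‖x‖ < 1 → x0 + s • x ∈ O := fun x hx => hsO (by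
    rw [mem_ball_iff_norm, add_sub_cancel_left, norm_smul, Real.norm_of_nonneg hs.le]; nlinarith)
  obtain ⟨h, hh⟩ : ∃ h : XX m → ℂ, h = fun x => ((s : ℂ)^2)⁻¹ * u (x0 + s • x) := ⟨_, rfl⟩
  have hhs : ContDiffOn ℝ ∞ h (Metric.ball 0 1) := by
    rw [hh]
    refine contDiffOn_const.mul (hu.comp (by fun_prop) fun x hx => hmem x (by simpa using hx))
  obtain ⟨g, hg⟩ : ∃ g : XX m → ℂ, g = fun x => chi x * h x := ⟨_, rfl⟩
  have hgood : Good g := by rw [hg]; exact cut_good hhs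
  have hgh : EqOn g h (Metric.ball 0 (2/10)) := fun x hx => by
    rw [hg]; simp only; rw [chi_one x (by simpa using (le_of_lt (by simpa using hx : ‖x‖ < 2/10))), one_mul]
  obtain ⟨c, hc⟩ : ∃ c : JJ m → Wn m, c = fun α => wc (jet g α) := ⟨_, rfl⟩
  have hreal' : ∀ α, EqOn (real (c α)) (jet g α) (cell m) := fun α => by rw [hc]; exact real_wc (jet_good hgood α)
  have hco : ∀ α k, co (c α) k = coef (jet g α) k := fun α k => by
    rw [← coef_real, coef_congr (hreal' α)]
  have hds : ∀ α k, co (c α) k = ds α k * co (c jU) k := fun α k => by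
    rw [hco, hco, jet_coef (hgood.smooth.of_le (WithTop.coe_le_coe.2 le_top)) hgood.supp]
  have hA : ∀ i j, ∀ x : XX m, ‖x‖ < 2/10 → real (c (jA i j)) x = DD j (DD i u) (x0 + s • x) := by
    intro i j x hx
    have hxb : x ∈ Metric.ball (0 : XX m) (2/10) := by simpa using hx
    rw [hreal' _ (mem_cell_of (by linarith)), jet_congr Metric.isOpen_ball hgh _ hxb]
    show DD j (DD i h) x = _
    have e1 : EqOn (DD i h) (fun x => ((s:ℂ)^2)⁻¹ * s * DD i u (x0 + s • x)) (Metric.ball 0 1) := fun y hy => by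
      rw [hh]
      refine DD_affine x0 s _ ?_ i
      exact (hu.contDiffAt (hO.mem_nhds (hmem y (by simpa using hy)))).differentiableAt (by simp)
    rw [DD_congr Metric.isOpen_ball e1 j (by simp; linarith)]
    rw [DD_affine x0 s _ (((DD_contDiffOn hO hu i).contDiffAt (hO.mem_nhds (hmem x (by linarith)))).differentiableAt (by simp)) j]
    field_simp
  have hzero : aeval (Sum.elim (fun _ => (0:ℂ)) (fun α => real (c α) 0)) (EQ1 m) = 0 := by
    rw [E1_eval]
    simp only [Sum.elim_inr, hA _ _ 0 (by simp : ‖(0:XX m)‖ < 2/10)]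
    exact hE _ (hmem 0 (by simp))
  have hell : ∃ c0, Ell (fun i j => aeval (Sum.elim (fun _ => (0:ℂ)) (fun α => real (c α) 0)) (pderiv (Sum.inr (jA i j)) (EQ1 m))) c0 := by
    choose a ha using hreal
    refine E1_ell (A := Matrix.of fun i j => a i j) ?_ (fun i j => ?_) hzero
    · ext i j
      simp only [transpose_apply, of_apply]
      have : c (jA i j) = c (jA j i) := Wn.ext (fun k => by rw [hds, hds (jA j i), ds_symm])
      have h1 := hA i j 0 (by simp)
      have h2 := hA j i 0 (by simp)
      rw [this, h2] at h1
      simp only [smul_zero, add_zero, ha] at h1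
      exact_mod_cast h1
    · simp only [Sum.elim_inr, of_apply]; rw [hA i j 0 (by simp), smul_zero, add_zero, ha]
  obtain ⟨c0, hell⟩ := hell
  have han := AN (EQ1 m) c hds (r := 2/10) (by norm_num) (fun x hx => by
    rw [E1_eval]
    simp only [Sum.elim_inr, hA _ _ x hx]
    exact hE _ (hmem x (by linarith))) hell
  have hlin : AnalyticAt ℝ (fun y : XX m => s⁻¹ • (y - x0)) x0 := by
    have : ContDiffAt ℝ ω (fun y : XX m => s⁻¹ • (y - x0)) x0 := by fun_prop
    exact this.analyticAt
  have h0 : s⁻¹ • (x0 - x0) = 0 := by simp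
  have han2 : AnalyticAt ℝ (fun y => (s:ℂ)^2 * real (c jU) (s⁻¹ • (y - x0))) x0 := by
    refine analyticAt_const.mul ?_
    refine AnalyticAt.fun_comp (g := real (c jU)) ?_ hlin
    rw [h0]; exact han
  refine han2.congr ?_
  filter_upwards [Metric.ball_mem_nhds x0 (show 0 < s * (2/10) by positivity)] with y hy
  have hy' : ‖s⁻¹ • (y - x0)‖ < 2/10 := by
    rw [norm_smul, norm_inv, Real.norm_of_nonneg hs.le, ← div_eq_inv_mul, div_lt_iff₀ hs]
    rw [mem_ball_iff_norm] at hy; linarith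
  rw [hreal' _ (mem_cell_of (by linarith))]
  show (s:ℂ)^2 * g _ = _
  rw [hgh (by simpa using hy'), hh]
  simp only
  rw [smul_inv_smul₀ hs.ne', add_sub_cancel, mul_inv_cancel_left₀ (pow_ne_zero 2 hs')]
end interior
end Lawlor

namespace Lawlor
open MeasureTheory Set Filter Topology
open scoped Real ContDiff
noncomputable section poly2
variable {m : ℕ}
open Matrix

section gen
variable {S T : Type*} [CommRing S] [CommRing T]

def HP (y : Fin m → S) (K : Matrix (Fin m) (Fin m) S) (cc : S) : Polynomial S :=
  Polynomial.C (∑ i, y i ^ 2) * (1 + (Polynomial.X : Polynomial S) • K.map Polynomial.C).det +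
    Polynomial.C cc * Polynomial.X * ((fun i => Polynomial.C (y i)) ⬝ᵥ ((1 + (Polynomial.X : Polynomial S) • K.map Polynomial.C).adjugate *ᵥ (fun i => Polynomial.C (y i))))

lemma map_mv (φ : S →+* T) (M : Matrix (Fin m) (Fin m) S) (v : Fin m → S) : φ ∘ (M *ᵥ v) = (φ.mapMatrix M) *ᵥ (φ ∘ v) :=
  funext fun i => RingHom.map_mulVec φ M v i

lemma mat_map (φ : S →+* T) (K : Matrix (Fin m) (Fin m) S) :
    (Polynomial.mapRingHom φ).mapMatrix (1 + (Polynomial.X : Polynomial S) • K.map Polynomial.C) = 1 + (Polynomial.X : Polynomial T) • (K.map φ).map Polynomial.C := by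
  ext1 i j
  simp [Matrix.one_apply, apply_ite (Polynomial.map φ)]

lemma HP_map (φ : S →+* T) (y : Fin m → S) (K : Matrix (Fin m) (Fin m) S) (cc : S) :
    (HP y K cc).map φ = HP (fun i => φ (y i)) (K.map φ) (φ cc) := by
  rw [← Polynomial.coe_mapRingHom]
  unfold HP
  rw [map_add, map_mul, RingHom.map_det, mat_map, map_mul, map_mul, RingHom.map_dotProduct, map_mv, RingHom.map_adjugate, mat_map]
  simp only [Polynomial.coe_mapRingHom, Polynomial.map_C, Polynomial.map_X, map_sum, map_pow]
  congr!
  · ext; simp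
  · ext; simp

lemma mat_eval (K : Matrix (Fin m) (Fin m) S) (τ : S) :
    (Polynomial.evalRingHom τ).mapMatrix (1 + (Polynomial.X : Polynomial S) • K.map Polynomial.C) = 1 + τ • K := by
  ext1 i j
  simp [Matrix.one_apply, apply_ite (Polynomial.eval τ)]
  ring

lemma HP_eval (y : Fin m → S) (K : Matrix (Fin m) (Fin m) S) (cc τ : S) :
    (HP y K cc).eval τ = (∑ i, y i^2) * (1 + τ • K).det + cc * τ * (y ⬝ᵥ ((1 + τ • K).adjugate *ᵥ y)) := by
  rw [← Polynomial.coe_evalRingHom]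
  unfold HP
  rw [map_add, map_mul, RingHom.map_det, mat_eval, map_mul, map_mul, RingHom.map_dotProduct, map_mv, RingHom.map_adjugate, mat_eval]
  simp only [Polynomial.coe_evalRingHom, Polynomial.eval_C, Polynomial.eval_X]
  congr!
  · ext; simp
  · ext; simp

lemma HP_coeff_one (y : Fin m → S) (K : Matrix (Fin m) (Fin m) S) (cc : S) :
    (HP y K cc).coeff 1 = (∑ i, y i^2) * (K.trace + cc) := by
  unfold HP
  rw [Polynomial.coeff_add, Polynomial.coeff_C_mul, Matrix.coeff_det_one_add_X_smul_one, mul_assoc, Polynomial.coeff_C_mul,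
    mul_add, show (1:ℕ) = 0 + 1 from rfl, Polynomial.coeff_X_mul]
  have h : ((fun i => Polynomial.C (y i)) ⬝ᵥ ((1 + (Polynomial.X : Polynomial S) • K.map Polynomial.C).adjugate *ᵥ (fun i => Polynomial.C (y i)))).coeff 0 = ∑ i, y i^2 := by
    rw [Polynomial.coeff_zero_eq_eval_zero, ← Polynomial.coe_evalRingHom, RingHom.map_dotProduct, map_mv, RingHom.map_adjugate, mat_eval, zero_smul, add_zero, adjugate_one, one_mulVec]
    simp [dotProduct, sq]
  rw [h]; ring
end gen

lemma odd_sum {p : Polynomial ℂ} {τ : ℂ} (hτ : τ ≠ 0) (h : p.eval τ = p.eval (-τ)) {L : ℕ} (hL : p.natDegree ≤ L) :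
    p.coeff 1 + ∑ j ∈ Finset.range L, (τ^2)^(j+1) * p.coeff (2*(j+1)+1) = 0 := by
  have h1 : ∀ x : ℂ, p.eval x = ∑ j ∈ Finset.range (L+1), (p.coeff (2*j) * x^(2*j) + p.coeff (2*j+1) * x^(2*j+1)) := by
    intro x
    rw [Polynomial.eval_eq_sum_range' (n := 2 * (L+1)) (by omega)]
    generalize L + 1 = M
    induction M with
    | zero => simp
    | succ M ih => rw [show 2 * (M+1) = 2*M+1+1 by ring, Finset.sum_range_succ, Finset.sum_range_succ, Finset.sum_range_succ, ih]; ring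
  rw [h1, h1, ← sub_eq_zero, ← Finset.sum_sub_distrib] at h
  have h2 : ∀ j, (p.coeff (2*j) * τ^(2*j) + p.coeff (2*j+1) * τ^(2*j+1)) - (p.coeff (2*j) * (-τ)^(2*j) + p.coeff (2*j+1) * (-τ)^(2*j+1)) = (2 * τ) * ((τ^2)^j * p.coeff (2*j+1)) := by
    intro j
    rw [show (-τ)^(2*j) = τ^(2*j) from (even_two_mul j).neg_pow τ, show (-τ)^(2*j+1) = -τ^(2*j+1) from (odd_two_mul_add_one j).neg_pow τ]
    ring
  simp only [h2] at h
  rw [← Finset.mul_sum, mul_eq_zero] at h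
  rcases h with h | h
  · simp [hτ] at h
  · rw [Finset.sum_range_succ'] at h
    rw [← h]; simp [add_comm]

abbrev RR (m : ℕ) := MvPolynomial (Fin m ⊕ JJ m) ℂ
open MvPolynomial

def Kmat {S : Type*} [CommRing S] (r F s : S) (y g : Fin m → S) (D : Fin m → Fin m → S) : Matrix (Fin m) (Fin m) S :=
  Matrix.of fun i j => r * D i j + m * (g i * y j + y i * g j) - (((m:S)-2) * F + 2 * s) * (if i = j then 1 else 0)

def yv (i : Fin m) : RR m := X (Sum.inl i)
def gv (i : Fin m) : RR m := X (Sum.inr (jP i))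
def Dv (i j : Fin m) : RR m := X (Sum.inr (jA j i))
def rv (m : ℕ) : RR m := ∑ i, yv i ^ 2
def sv (m : ℕ) : RR m := ∑ i, yv i * gv i
def Fv (m : ℕ) : RR m := X (Sum.inr jU)
def Hv (m : ℕ) : Polynomial (RR m) := HP yv (Kmat (rv m) (Fv m) (sv m) yv gv Dv) ((m:RR m) * ((m:RR m)-2) * Fv m)

def EQ2 (m : ℕ) : RR m := ∑ i, Dv i i + ∑ j ∈ Finset.range (Hv m).natDegree, (-1)^(j+1) * (rv m ^ (m * (j+1) - 2) * (Hv m).coeff (2*(j+1)+1))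

lemma EQ2_pderiv (hm : 3 ≤ m) {z : Fin m ⊕ JJ m → ℂ} (hz : ∀ i, z (Sum.inl i) = 0) (i j : Fin m) :
    aeval z (pderiv (Sum.inr (jA i j)) (EQ2 m)) = if i = j then 1 else 0 := by
  unfold EQ2
  rw [map_add, map_add, map_sum, map_sum, map_sum, map_sum]
  have h1 : ∀ x : ℕ, aeval z (pderiv (Sum.inr (jA i j)) ((-1)^(x+1) * (rv m ^ (m * (x+1) - 2) * (Hv m).coeff (2*(x+1)+1)))) = 0 := by
    intro x
    have hr : pderiv (Sum.inr (jA i j)) (rv m) = 0 := by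
      rw [rv, map_sum]; refine Finset.sum_eq_zero fun l _ => ?_
      rw [yv, pderiv_pow, pderiv_X_of_ne (by simp)]; simp
    have hr0 : aeval z (rv m) = 0 := by simp [rv, yv, hz]
    have hn : m * (x+1) - 2 ≠ 0 := by
      have : m * (x+1) ≥ 3 * 1 := Nat.mul_le_mul hm (by omega)
      omega
    rw [mul_left_comm, pderiv_mul, pderiv_pow, hr]
    simp only [map_add, map_mul, map_pow, hr0, zero_pow hn, mul_zero, map_zero, zero_mul, add_zero]
  rw [Finset.sum_congr rfl (fun x _ => h1 x), Finset.sum_const_zero, add_zero]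
  have h2 : ∀ l, aeval z (pderiv (Sum.inr (jA i j)) (Dv l l)) = if l = i ∧ l = j then 1 else 0 := by
    intro l
    rw [Dv]
    split_ifs with h
    · rw [← h.1, ← h.2, pderiv_X_self]; simp
    · rw [pderiv_X_of_ne (by
        intro h'; simp [jA] at h'; exact h h')]; simp
  simp only [h2]
  by_cases hij : i = j
  · subst hij; simp
  · rw [if_neg hij]; refine Finset.sum_eq_zero fun l _ => ?_
    rw [if_neg]; rintro ⟨rfl, rfl⟩; exact hij rfl

lemma EQ2_zero (hm : 3 ≤ m) {z : Fin m ⊕ JJ m → ℂ} {r s F t : ℂ} {y g : Fin m → ℂ} {D : Fin m → Fin m → ℂ}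
    (hy : ∀ i, z (Sum.inl i) = y i) (hg : ∀ i, z (Sum.inr (jP i)) = g i) (hD : ∀ i j, z (Sum.inr (jA j i)) = D i j) (hF : z (Sum.inr jU) = F)
    (hr : r = ∑ i, y i^2) (hs : s = ∑ i, y i * g i) (hr0 : r ≠ 0) (ht : t^2 = r^(m-2)) 
    (hdet : (1 + (Complex.I * t) • (r • Kmat r F s y g D + ((m:ℂ) * (m - 2) * F) • vecMulVec y y)).det = (1 + (-(Complex.I * t)) • (r • Kmat r F s y g D + ((m:ℂ) * (m - 2) * F) • vecMulVec y y)).det) :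
    aeval z (EQ2 m) = 0 := by
  obtain ⟨K, hK⟩ : ∃ K, K = Kmat r F s y g D := ⟨_, rfl⟩
  obtain ⟨cc, hcc⟩ : ∃ cc : ℂ, cc = (m:ℂ) * (m - 2) * F := ⟨_, rfl⟩
  have erv : aeval z (rv m) = r := by simp [rv, yv, hy, hr]
  have hmap : (Hv m).map (aeval z : RR m →ₐ[ℂ] ℂ).toRingHom = HP y K cc := by
    rw [Hv, HP_map]
    have e1 : (fun i => (aeval z : RR m →ₐ[ℂ] ℂ).toRingHom (yv i)) = y := by ext i; simp [yv, hy]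
    have e2 : (Kmat (rv m) (Fv m) (sv m) yv gv Dv).map (aeval z : RR m →ₐ[ℂ] ℂ).toRingHom = K := by
      ext i j
      simp only [Kmat, hK, Matrix.map_apply, Matrix.of_apply]
      simp only [AlgHom.toRingHom_eq_coe, RingHom.coe_coe, map_sub, map_add, map_mul, map_natCast, erv, map_ofNat]
      have e3 : aeval z (sv m) = s := by simp [sv, yv, gv, hy, hg, hs]
      rw [e3]
      have e4 : ∀ i, aeval z (gv i) = g i := fun i => by simp [gv, hg]
      have e5 : ∀ i, aeval z (yv i) = y i := fun i => by simp [yv, hy]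
      have e6 : aeval z (Dv i j) = D i j := by simp [Dv, hD]
      have e7 : aeval z (Fv m) = F := by simp [Fv, hF]
      have e8 : aeval z (if i = j then (1 : RR m) else 0) = if i = j then (1:ℂ) else 0 := by split_ifs <;> simp
      rw [e4, e4, e5, e5, e6, e7, e8]
    have e3 : (aeval z : RR m →ₐ[ℂ] ℂ).toRingHom ((m:RR m) * ((m:RR m)-2) * Fv m) = cc := by
      simp [Fv, hF, hcc]
    rw [e1, e2, e3]
  have hcoef : ∀ n, aeval z ((Hv m).coeff n) = (HP y K cc).coeff n := by
    intro n; rw [← hmap, Polynomial.coeff_map]; rfl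
  have ht0 : t ≠ 0 := by
    rintro rfl
    rw [zero_pow two_ne_zero] at ht
    exact pow_ne_zero _ hr0 ht.symm
  obtain ⟨τ, hτ⟩ : ∃ τ, τ = Complex.I * t * r := ⟨_, rfl⟩
  have hτ0 : τ ≠ 0 := by rw [hτ]; exact mul_ne_zero (mul_ne_zero Complex.I_ne_zero ht0) hr0
  have hτ2 : τ^2 = - r^m := by
    rw [hτ, mul_pow, mul_pow, Complex.I_sq, ht, mul_assoc, ← pow_add, show m - 2 + 2 = m by omega]; ring
  have hev : ∀ σ : ℂ, (HP y K cc).eval (σ * r) = r * (1 + σ • (r • K + cc • vecMulVec y y)).det := by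
    intro σ
    rw [HP_eval, ← hr]
    have : 1 + σ • (r • K + cc • vecMulVec y y) = (1 + (σ * r) • K) + vecMulVec ((σ * cc) • y) y := by
      rw [smul_vecMulVec, smul_add, smul_smul, smul_smul, add_assoc]
    rw [this, det_rank_one, mulVec_smul, dotProduct_smul, smul_eq_mul]; ring
  have hodd := odd_sum (p := HP y K cc) hτ0 (by
    rw [show -τ = (-(Complex.I * t)) * r by rw [hτ]; ring, hτ, hev, hev, hK, hcc, hdet]) (L := (Hv m).natDegree) (by
    rw [← hmap]; exact Polynomial.natDegree_map_le)
  have htr : K.trace + cc = r * ∑ i, D i i := by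
    rw [hK, hcc, Matrix.trace]
    simp only [Kmat, Matrix.diag_apply, Matrix.of_apply, if_true, mul_one]
    rw [Finset.sum_sub_distrib, Finset.sum_add_distrib, ← Finset.mul_sum, ← Finset.mul_sum]
    simp only [Finset.sum_const, Finset.card_univ, Fintype.card_fin, nsmul_eq_mul]
    have : ∑ i, (g i * y i + y i * g i) = 2 * s := by
      rw [hs, Finset.mul_sum]; exact Finset.sum_congr rfl fun i _ => by ring
    rw [this]; ring
  rw [HP_coeff_one, ← hr, htr, hτ2] at hodd
  have hE : r^2 * aeval z (EQ2 m) = 0 := by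
    rw [← hodd, EQ2, map_add, map_sum, map_sum, mul_add, Finset.mul_sum (Finset.range _)]
    congr 1
    · rw [← mul_assoc, ← sq]; congr 1
      exact Finset.sum_congr rfl fun i _ => by simp [Dv, hD]
    · refine Finset.sum_congr rfl fun j _ => ?_
      rw [map_mul, map_mul, map_pow, map_pow, map_neg, map_one, erv, hcoef, neg_pow (r^m), ← pow_mul]
      have : r^(m*(j+1)) = r^2 * r^(m*(j+1)-2) := by
        rw [← pow_add]; congr 1
        have : m * (j+1) ≥ 3 * 1 := Nat.mul_le_mul hm (by omega)
        omega
      rw [this]; ring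
  exact (mul_eq_zero.1 hE).resolve_left (pow_ne_zero _ hr0)
end poly2
end Lawlor

namespace Lawlor
open MeasureTheory Set Filter Topology
open scoped Real ContDiff
noncomputable section calc13
variable {m : ℕ}

def ee (i : Fin m) : XX m := Pi.single i 1

def HD (i : Fin m) (g : XX m → ℂ) (y : XX m) (d : ℂ) : Prop := HasDerivAt (fun t : ℝ => g (y + t • ee i)) d 0

lemma hd_of {g : XX m → ℂ} {y : XX m} (h : DifferentiableAt ℝ g y) (i : Fin m) : HD i g y (DD i g y) := by
  have h1 : HasDerivAt (fun t : ℝ => y + t • ee i) (ee i) 0 := by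
    simpa using ((hasDerivAt_id (0:ℝ)).smul_const (ee i)).const_add y
  have h2 : HasFDerivAt g (fderiv ℝ g y) (y + (0:ℝ) • ee i) := by simpa using h.hasFDerivAt
  exact h2.comp_hasDerivAt (0:ℝ) h1

lemma hd_eq {g : XX m → ℂ} {y : XX m} {d : ℂ} (h : DifferentiableAt ℝ g y) {i : Fin m} (hd : HD i g y d) : DD i g y = d :=
  (hd_of h i).unique hd

lemma HD.mul {i : Fin m} {g h : XX m → ℂ} {y : XX m} {d e : ℂ} (hg : HD i g y d) (hh : HD i h y e) :
    HD i (fun x => g x * h x) y (d * h y + g y * e) := by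
  have := HasDerivAt.fun_mul hg hh
  refine HasDerivAt.congr_deriv this ?_
  simp

lemma HD.add {i : Fin m} {g h : XX m → ℂ} {y : XX m} {d e : ℂ} (hg : HD i g y d) (hh : HD i h y e) :
    HD i (fun x => g x + h x) y (d + e) := HasDerivAt.add hg hh
lemma HD.sub {i : Fin m} {g h : XX m → ℂ} {y : XX m} {d e : ℂ} (hg : HD i g y d) (hh : HD i h y e) :
    HD i (fun x => g x - h x) y (d - e) := HasDerivAt.sub hg hh
lemma HD.cmul {i : Fin m} {h : XX m → ℂ} {y : XX m} {e : ℂ} (c : ℂ) (hh : HD i h y e) :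
    HD i (fun x => c * h x) y (c * e) := HasDerivAt.const_mul c hh
lemma HD.sum {i : Fin m} {ι : Type*} {s : Finset ι} {h : ι → XX m → ℂ} {y : XX m} {e : ι → ℂ} (hh : ∀ k ∈ s, HD i (h k) y (e k)) :
    HD i (fun x => ∑ k ∈ s, h k x) y (∑ k ∈ s, e k) := HasDerivAt.fun_sum hh
lemma hd_coord (i j : Fin m) (y : XX m) : HD i (fun x => (x j : ℂ)) y (if i = j then 1 else 0) := by
  have h : HasDerivAt (fun t : ℝ => y j + t * (ee i) j) ((ee i) j) 0 := by
    simpa using ((hasDerivAt_id (0:ℝ)).mul_const (ee i j)).const_add (y j)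
  have := h.ofReal_comp
  unfold HD
  convert! this using 1
  simp only [ee, Pi.single_apply, eq_comm]; split_ifs <;> simp

def rr (y : XX m) : ℝ := ∑ i, y i ^ 2
def rc (y : XX m) : ℂ := ∑ i, (y i : ℂ) ^ 2
lemma rc_eq (y : XX m) : rc y = (rr y : ℂ) := by simp [rc, rr]
lemma rr_pos {y : XX m} (hy : y ≠ 0) : 0 < rr y := by
  obtain ⟨i, hi⟩ := Function.ne_iff.1 hy
  exact Finset.sum_pos' (fun i _ => sq_nonneg _) ⟨i, Finset.mem_univ _, by have : y i ≠ 0 := hi; positivity⟩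
lemma rc_ne {y : XX m} (hy : y ≠ 0) : rc y ≠ 0 := by
  rw [rc_eq]; exact_mod_cast (rr_pos hy).ne'

lemma rr_contDiff {n : WithTop ℕ∞} : ContDiff ℝ n (rr (m := m)) := by unfold rr; fun_prop
lemma rc_contDiff {n : WithTop ℕ∞} : ContDiff ℝ n (rc (m := m)) := by
  rw [show (rc (m := m)) = fun y => ((rr y : ℝ) : ℂ) from funext rc_eq]
  exact Complex.ofRealCLM.contDiff.comp rr_contDiff
lemma coord_contDiff {n : WithTop ℕ∞} (i : Fin m) : ContDiff ℝ n (fun y : XX m => (y i : ℂ)) :=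
  Complex.ofRealCLM.contDiff.comp (contDiff_apply ℝ ℝ i)

lemma hd_rc (i : Fin m) (y : XX m) : HD i rc y (2 * y i) := by
  have : HD i rc y (∑ k, ((if i = k then 1 else 0) * (y k : ℂ) + (y k : ℂ) * (if i = k then 1 else 0))) := by
    have h := HD.sum (i := i) (y := y) (s := Finset.univ) (h := fun k x => (x k : ℂ) * (x k : ℂ)) (fun k _ => (hd_coord i k y).mul (hd_coord i k y))
    rw [show (rc (m := m)) = fun x => ∑ k, (x k : ℂ) * (x k : ℂ) from funext fun x => by simp [rc, sq]]
    exact h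
  convert this using 1
  rw [Finset.sum_eq_single i] <;> simp +contextual [eq_comm]
  ring

def pw (s : ℝ) (y : XX m) : ℂ := ((rr y ^ s : ℝ) : ℂ)

lemma pw_contDiffAt {n : WithTop ℕ∞} (s : ℝ) {y : XX m} (hy : y ≠ 0) : ContDiffAt ℝ n (pw s) y := by
  have : ContDiffAt ℝ n (fun y : XX m => rr y ^ s) y := rr_contDiff.contDiffAt.rpow_const_of_ne (rr_pos hy).ne'
  exact Complex.ofRealCLM.contDiff.contDiffAt.comp y this

lemma pw_add (s t : ℝ) {y : XX m} (hy : y ≠ 0) : pw s y * pw t y = pw (s+t) y := by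
  unfold pw; rw [Real.rpow_add (rr_pos hy)]; push_cast; ring

lemma pw_one (y : XX m) : pw 1 y = rc y := by simp [pw, rc_eq]
lemma pw_zero (y : XX m) : pw 0 y = 1 := by simp [pw]
lemma pw_neg_one (y : XX m) : pw (-1) y = (rc y)⁻¹ := by simp [pw, rc_eq, Real.rpow_neg_one]

lemma pw_nat (n : ℕ) (y : XX m) : pw n y = rc y ^ n := by simp [pw, rc_eq]

lemma hd_pw (s : ℝ) (i : Fin m) {y : XX m} (hy : y ≠ 0) : HD i (pw s) y (2 * s * y i * pw (s-1) y) := by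
  have h : HasDerivAt (fun t : ℝ => rr (y + t • ee i)) (2 * y i) 0 := by
    have h1 := hd_rc i y
    have h2 := Complex.reCLM.hasFDerivAt.comp_hasDerivAt (0:ℝ) h1
    have h3 : (Complex.reCLM ∘ fun t : ℝ => rc (y + t • ee i)) = fun t : ℝ => rr (y + t • ee i) := by
      ext t; simp [rc_eq]
    rw [h3] at h2
    refine h2.congr_deriv ?_
    simp
  have h3 := (h.rpow_const (p := s) (Or.inl (by simpa using (rr_pos hy).ne'))).ofReal_comp
  unfold HD pw
  convert! h3 using 1
  simp only [zero_smul, add_zero]; push_cast; ring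

def inv (y : XX m) : XX m := (rr y)⁻¹ • y

lemma inv_contDiffAt {n : WithTop ℕ∞} {y : XX m} (hy : y ≠ 0) : ContDiffAt ℝ n inv y :=
  (rr_contDiff.contDiffAt.inv (rr_pos hy).ne').smul contDiffAt_id

/-- chain rule for the inversion -/
lemma DD_inv {g : XX m → ℂ} {y : XX m} (hy : y ≠ 0) (hg : DifferentiableAt ℝ g (inv y)) (j : Fin m) :
    DD j (fun x => g (inv x)) y = (rc y)⁻¹ * DD j g (inv y) - 2 * y j * (rc y)⁻¹^2 * ∑ k, (y k : ℂ) * DD k g (inv y) := by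
  have hI : HasDerivAt (fun t : ℝ => inv (y + t • ee j)) ((rr y)⁻¹ • ee j - (2 * y j * (rr y)⁻¹^2) • y) 0 := by
    have h : HasDerivAt (fun t : ℝ => rr (y + t • ee j)) (2 * y j) 0 := by
      have h1 := hd_rc j y
      have h2 := Complex.reCLM.hasFDerivAt.comp_hasDerivAt (0:ℝ) h1
      have h3 : (Complex.reCLM ∘ fun t : ℝ => rc (y + t • ee j)) = fun t : ℝ => rr (y + t • ee j) := by
        ext t; simp [rc_eq]
      rw [h3] at h2
      refine h2.congr_deriv ?_
      simp
    have h1 : HasDerivAt (fun t : ℝ => y + t • ee j) (ee j) 0 := by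
      simpa using ((hasDerivAt_id (0:ℝ)).smul_const (ee j)).const_add y
    have h4 := (h.fun_inv (by simpa using (rr_pos hy).ne')).fun_smul h1
    refine HasDerivAt.congr_deriv h4 ?_
    simp only [zero_smul, add_zero]
    rw [sub_eq_add_neg, ← neg_smul]; congr 2
    rw [neg_div, div_eq_mul_inv, inv_pow]
  have h2 : HasFDerivAt g (fderiv ℝ g (inv y)) (inv (y + (0:ℝ) • ee j)) := by simpa using hg.hasFDerivAt
  have h3 : HD j (fun x => g (inv x)) y _ := h2.comp_hasDerivAt (0:ℝ) hI
  rw [hd_eq (g := fun x => g (inv x)) (DifferentiableAt.comp y hg ((inv_contDiffAt (n := 1) hy).differentiableAt (by simp))) h3]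
  rw [map_sub, map_smul, map_smul, fderiv_eq_sum g _ y, rc_eq]
  simp only [Complex.real_smul, DD, ee]; push_cast; ring

def MM (j : Fin m) (h : XX m → ℂ) (y : XX m) : ℂ :=
  rc y * DD j h y - 2 * ((y j : ℂ) * ∑ k, (y k : ℂ) * DD k h y) - ((m:ℂ) - 2) * ((y j : ℂ) * h y)

/-- gradient of the conjugated function -/
lemma grad_conj {g h : XX m → ℂ} {y : XX m} (hy : y ≠ 0) (hg : DifferentiableAt ℝ g (inv y)) (hh : DifferentiableAt ℝ h y)
    (he : (fun x => g (inv x)) =ᶠ[𝓝 y] fun x => pw (((m:ℝ)-2)/2) x * h x) (j : Fin m) :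
    DD j g (inv y) = pw (((m:ℝ)-2)/2) y * MM j h y := by
  obtain ⟨a, ha⟩ : ∃ a : ℝ, a = ((m:ℝ)-2)/2 := ⟨_, rfl⟩
  rw [← ha] at he ⊢
  have h1 : ∀ k, DD k (fun x => pw a x * h x) y = 2 * a * y k * pw (a-1) y * h y + pw a y * DD k h y := by
    intro k
    rw [DD_mul ((pw_contDiffAt (n := 1) a hy).differentiableAt (by simp)) hh, hd_eq ((pw_contDiffAt (n := 1) a hy).differentiableAt (by simp)) (hd_pw a k hy)]
  have h2 : ∀ k, DD k (fun x => g (inv x)) y = DD k (fun x => pw a x * h x) y := fun k => by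
    unfold DD; rw [he.fderiv_eq]
  obtain ⟨S, hS⟩ : ∃ S, S = ∑ k, (y k : ℂ) * DD k g (inv y) := ⟨_, rfl⟩
  have h3 : ∀ k, (rc y)⁻¹ * DD k g (inv y) - 2 * y k * (rc y)⁻¹^2 * S = 2 * a * y k * pw (a-1) y * h y + pw a y * DD k h y := by
    intro k; rw [← h1, ← h2, DD_inv hy hg, hS]
  have hr := rc_ne hy
  have hpw : pw a y = pw (a-1) y * rc y := by rw [← pw_one, pw_add _ _ hy]; congr 1; ring
  have hrs : ∑ k, (y k : ℂ) * y k = rc y := by simp [rc, sq]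
  have h4 : ∑ k, (y k : ℂ) * ((rc y)⁻¹ * DD k g (inv y) - 2 * y k * (rc y)⁻¹^2 * S) = -(rc y)⁻¹ * S := by
    have : ∀ k, (y k : ℂ) * ((rc y)⁻¹ * DD k g (inv y) - 2 * y k * (rc y)⁻¹^2 * S) = (rc y)⁻¹ * ((y k : ℂ) * DD k g (inv y)) - (2 * (rc y)⁻¹^2 * S) * ((y k : ℂ) * y k) := fun k => by ring
    simp only [this, Finset.sum_sub_distrib, ← Finset.mul_sum, ← hS, hrs]
    field_simp; ring
  have h5 : ∑ k, (y k : ℂ) * ((rc y)⁻¹ * DD k g (inv y) - 2 * y k * (rc y)⁻¹^2 * S) = 2 * a * pw (a-1) y * h y * rc y + pw a y * ∑ k, (y k : ℂ) * DD k h y := by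
    simp only [h3]
    have : ∀ k, (y k : ℂ) * (2 * a * y k * pw (a-1) y * h y + pw a y * DD k h y) = (2 * a * pw (a-1) y * h y) * ((y k : ℂ) * y k) + pw a y * ((y k : ℂ) * DD k h y) := fun k => by ring
    simp only [this, Finset.sum_add_distrib, ← Finset.mul_sum, hrs]
  rw [h4] at h5
  have h6 := h3 j
  have ha2 : (2 * a : ℂ) = (m:ℂ) - 2 := by rw [ha]; push_cast; ring
  unfold MM
  obtain ⟨s, hs⟩ : ∃ s, s = ∑ k, (y k : ℂ) * DD k h y := ⟨_, rfl⟩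
  rw [← hs] at h5 ⊢
  rw [← ha2]
  have hSs : S = - rc y * (2 * a * pw (a-1) y * h y * rc y + pw a y * s) := by
    rw [← h5]; field_simp
  have h7 : DD j g (inv y) = 2 * y j * (rc y)⁻¹ * S + rc y * (2 * a * y j * pw (a-1) y * h y + pw a y * DD j h y) := by
    rw [← h6]; field_simp; ring
  rw [h7, hSs, hpw]; field_simp; ring

lemma MM_contDiffOn {h : XX m → ℂ} {O : Set (XX m)} (hO : IsOpen O) (hh : ContDiffOn ℝ ∞ h O) (j : Fin m) : ContDiffOn ℝ ∞ (MM j h) O := by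
  unfold MM
  refine ((rc_contDiff.contDiffOn.mul (DD_contDiffOn hO hh j)).sub (contDiffOn_const.mul ((coord_contDiff j).contDiffOn.mul (ContDiffOn.sum fun k _ => (coord_contDiff k).contDiffOn.mul (DD_contDiffOn hO hh k))))).sub (contDiffOn_const.mul ((coord_contDiff j).contDiffOn.mul hh))

lemma MM_MM {h : XX m → ℂ} {O : Set (XX m)} (hO : IsOpen O) (hh : ContDiffOn ℝ ∞ h O) {y : XX m} (hy : y ∈ O) (i j : Fin m) :
    MM i (MM j h) y = rc y ^2 * DD i (DD j h) y - 2 * rc y * (y j * ∑ k, (y k : ℂ) * DD i (DD k h) y + y i * ∑ k, (y k : ℂ) * DD k (DD j h) y)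
      + 4 * (∑ k, ∑ l, (y k : ℂ) * y l * DD k (DD l h) y) * (y i * y j) - m * rc y * (y i * DD j h y + y j * DD i h y)
      + 4 * m * (∑ k, (y k : ℂ) * DD k h y) * (y i * y j) - rc y * (((m:ℂ)-2) * h y + 2 * (∑ k, (y k : ℂ) * DD k h y)) * (if i = j then 1 else 0)
      + m * ((m:ℂ)-2) * h y * (y i * y j) := by
  have dh : ∀ k, DifferentiableAt ℝ (DD k h) y := fun k => ((DD_contDiffOn hO hh k).contDiffAt (hO.mem_nhds hy)).differentiableAt (by simp)
  have dh0 : DifferentiableAt ℝ h y := (hh.contDiffAt (hO.mem_nhds hy)).differentiableAt (by simp)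
  have dM : DifferentiableAt ℝ (MM j h) y := ((MM_contDiffOn hO hh j).contDiffAt (hO.mem_nhds hy)).differentiableAt (by simp)
  obtain ⟨s, hs⟩ : ∃ s, s = ∑ k, (y k : ℂ) * DD k h y := ⟨_, rfl⟩
  have hrs : ∑ k, (y k : ℂ) * y k = rc y := by simp [rc, sq]
  have h1 : ∀ l, DD l (MM j h) y = (2 * y l * DD j h y + rc y * DD l (DD j h) y) - 2 * ((if l = j then 1 else 0) * s + y j * (DD l h y + ∑ k, (y k : ℂ) * DD l (DD k h) y))
      - ((m:ℂ)-2) * ((if l = j then 1 else 0) * h y + y j * DD l h y) := by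
    intro l
    refine hd_eq dM ?_
    have hS : HD l (fun x => ∑ k, (x k : ℂ) * DD k h x) y (DD l h y + ∑ k, (y k : ℂ) * DD l (DD k h) y) := by
      have := HD.sum (i := l) (y := y) (s := Finset.univ) (h := fun k x => (x k : ℂ) * DD k h x) (fun k _ => (hd_coord l k y).mul (hd_of (dh k) l))
      rw [Finset.sum_add_distrib] at this
      simpa using this
    have h2 := (((hd_rc l y).mul (hd_of (dh j) l)).sub (((hd_coord l j y).mul hS).cmul 2)).sub (((hd_coord l j y).mul (hd_of dh0 l)).cmul ((m:ℂ)-2))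
    rw [← hs] at h2
    exact h2
  obtain ⟨q, hq⟩ : ∃ q, q = ∑ k, ∑ l, (y k : ℂ) * y l * DD k (DD l h) y := ⟨_, rfl⟩
  have h3 : ∑ l, (y l : ℂ) * DD l (MM j h) y = 2 * rc y * DD j h y + rc y * ∑ k, (y k : ℂ) * DD k (DD j h) y - 2 * (y j * s + y j * (s + q)) - ((m:ℂ)-2) * (y j * h y + y j * s) := by
    have e1 : ∑ l, (y l : ℂ) * (if l = j then 1 else 0) = y j := by simp
    have e2 : ∑ l, (y l : ℂ) * ∑ k, (y k : ℂ) * DD l (DD k h) y = q := by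
      rw [hq]; simp only [Finset.mul_sum, mul_assoc]
    have : ∀ l, (y l : ℂ) * DD l (MM j h) y = 2 * DD j h y * ((y l : ℂ) * y l) + rc y * ((y l : ℂ) * DD l (DD j h) y) - 2 * s * ((y l : ℂ) * (if l = j then 1 else 0)) - 2 * y j * ((y l : ℂ) * DD l h y) - 2 * y j * ((y l : ℂ) * ∑ k, (y k : ℂ) * DD l (DD k h) y) - ((m:ℂ)-2) * h y * ((y l : ℂ) * (if l = j then 1 else 0)) - ((m:ℂ)-2) * y j * ((y l : ℂ) * DD l h y) := by
      intro l; rw [h1]; ring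
    simp only [this, Finset.sum_sub_distrib, Finset.sum_add_distrib, ← Finset.mul_sum, e1, e2, hrs, ← hs]
    ring
  rw [MM, h3, h1, MM, ← hs, ← hq]
  by_cases hij : i = j
  · subst hij; simp only [if_true]; ring
  · simp only [hij, if_false]; ring

end calc13
end Lawlor

namespace Lawlor
open MeasureTheory Set Filter Topology
open scoped Real ContDiff
noncomputable section pde0
variable {m : ℕ}
open Matrix

def OO (r : ℂ) (y : Fin m → ℂ) : Matrix (Fin m) (Fin m) ℂ := 1 - (2/r) • vecMulVec y y

lemma OO_sq {r : ℂ} {y : Fin m → ℂ} (hr : r = ∑ i, y i^2) (hr0 : r ≠ 0) : OO r y * OO r y = 1 := by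
  have h : vecMulVec y y * vecMulVec y y = r • vecMulVec y y := by
    rw [vecMulVec_mul_vecMulVec, hr]
    simp [dotProduct, sq]
  unfold OO
  rw [sub_mul, mul_sub, mul_sub, one_mul, one_mul, mul_one, smul_mul_smul_comm, h, smul_smul]
  have : 2 / r * (2/r) * r = 2/r + 2/r := by field_simp; norm_num
  rw [this, add_smul]; abel

lemma OO_det {r : ℂ} {y : Fin m → ℂ} (hr : r = ∑ i, y i^2) (hr0 : r ≠ 0) (τ : ℂ) (Q : Matrix (Fin m) (Fin m) ℂ) :
    (1 + τ • (OO r y * Q * OO r y)).det = (1 + τ • Q).det := by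
  have : 1 + τ • (OO r y * Q * OO r y) = OO r y * (1 + τ • Q) * OO r y := by
    rw [mul_add, mul_one, add_mul, OO_sq hr hr0, mul_smul_comm, smul_mul_assoc]
  rw [this, det_mul, det_mul, mul_right_comm, ← det_mul, OO_sq hr hr0, det_one, one_mul]

lemma OO_conj {r s F q : ℂ} {y g : Fin m → ℂ} {D : Fin m → Fin m → ℂ} (hr : r = ∑ i, y i^2) (hs : s = ∑ i, y i * g i) (hr0 : r ≠ 0) 
    (hq : q = ∑ k, ∑ l, y k * y l * D k l) (i j : Fin m) :
    (OO r y * (r • Kmat r F s y g D + ((m:ℂ) * (m - 2) * F) • vecMulVec y y) * OO r y) i j =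
     r ^2 * D i j - 2 * r * (y j * ∑ k, y k * D i k + y i * ∑ k, y k * D k j)
      + 4 * q * (y i * y j) - m * r * (y i * g j + y j * g i)
      + 4 * m * s * (y i * y j) - r * (((m:ℂ)-2) * F + 2 * s) * (if i = j then 1 else 0)
      + m * ((m:ℂ)-2) * F * (y i * y j) := by
  have hrs : ∑ k, y k * y k = r := by simp [hr, sq]
  obtain ⟨Q, hQ⟩ : ∃ Q, Q = r • Kmat r F s y g D + ((m:ℂ) * (m - 2) * F) • vecMulVec y y := ⟨_, rfl⟩
  have hQe : ∀ i j, Q i j = r^2 * D i j + r * m * (g i * y j + y i * g j) - r * (((m:ℂ)-2) * F + 2 * s) * (if i = j then 1 else 0) + (m:ℂ) * (m-2) * F * (y i * y j) := by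
    intro i j
    simp only [hQ, Kmat, Matrix.add_apply, Matrix.smul_apply, Matrix.of_apply, smul_eq_mul, vecMulVec_apply]; ring
  have hL : ∀ j, ∑ k, y k * Q k j = r^2 * ∑ k, y k * D k j + r * m * (s * y j + r * g j) - r * (((m:ℂ)-2) * F + 2 * s) * y j + (m:ℂ) * (m-2) * F * (r * y j) := by
    intro j
    have : ∀ k, y k * Q k j = r^2 * (y k * D k j) + r * m * y j * (y k * g k) + r * m * g j * (y k * y k) - r * (((m:ℂ)-2) * F + 2 * s) * (y k * (if k = j then 1 else 0)) + (m:ℂ) * (m-2) * F * y j * (y k * y k) := by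
      intro k; rw [hQe]; ring
    simp only [this, Finset.sum_sub_distrib, Finset.sum_add_distrib, ← Finset.mul_sum, hrs, ← hs]
    simp; ring
  have hR : ∀ i, ∑ k, Q i k * y k = r^2 * ∑ k, y k * D i k + r * m * (s * y i + r * g i) - r * (((m:ℂ)-2) * F + 2 * s) * y i + (m:ℂ) * (m-2) * F * (r * y i) := by
    intro i
    have : ∀ k, Q i k * y k = r^2 * (y k * D i k) + r * m * y i * (y k * g k) + r * m * g i * (y k * y k) - r * (((m:ℂ)-2) * F + 2 * s) * (y k * (if i = k then 1 else 0)) + (m:ℂ) * (m-2) * F * y i * (y k * y k) := by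
      intro k; rw [hQe]; ring
    simp only [this, Finset.sum_sub_distrib, Finset.sum_add_distrib, ← Finset.mul_sum, hrs, ← hs]
    simp; ring
  have hLR : ∑ i, y i * ∑ k, Q i k * y k = r^2 * q + r * m * (s * r + r * s) - r * (((m:ℂ)-2) * F + 2 * s) * r + (m:ℂ) * (m-2) * F * (r * r) := by
    have e2 : ∑ i, y i * ∑ k, y k * D i k = q := by
      rw [hq]; simp only [Finset.mul_sum, mul_assoc]
    have : ∀ i, y i * ∑ k, Q i k * y k = r^2 * (y i * ∑ k, y k * D i k) + (r * m * s) * (y i * y i) + r * m * r * (y i * g i) - r * (((m:ℂ)-2) * F + 2 * s) * (y i * y i) + (m:ℂ) * (m-2) * F * r * (y i * y i) := by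
      intro i; rw [hR]; ring
    simp only [this, Finset.sum_sub_distrib, Finset.sum_add_distrib, ← Finset.mul_sum, hrs, ← hs, e2]
    ring
  rw [← hQ]
  have hO : ∀ M : Matrix (Fin m) (Fin m) ℂ, ∀ i j, (OO r y * M) i j = M i j - 2 / r * (y i * ∑ k, y k * M k j) := by
    intro M i j
    rw [OO, sub_mul, one_mul, smul_mul_assoc, Matrix.sub_apply, Matrix.smul_apply, Matrix.mul_apply, smul_eq_mul]
    simp only [vecMulVec_apply, Finset.mul_sum, mul_assoc]
  have hO' : ∀ M : Matrix (Fin m) (Fin m) ℂ, ∀ i j, (M * OO r y) i j = M i j - 2 / r * ((∑ k, M i k * y k) * y j) := by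
    intro M i j
    rw [OO, mul_sub, mul_one, mul_smul_comm, Matrix.sub_apply, Matrix.smul_apply, Matrix.mul_apply, smul_eq_mul]
    simp only [vecMulVec_apply, Finset.sum_mul, mul_assoc]
  have hMid : ∑ k, (OO r y * Q) i k * y k = ∑ k, Q i k * y k - 2 / r * (y i * ∑ l, y l * ∑ k, Q l k * y k) := by
    simp only [hO, sub_mul, Finset.sum_sub_distrib]
    congr 1
    simp only [Finset.mul_sum, Finset.sum_mul]
    rw [Finset.sum_comm]
    exact Finset.sum_congr rfl fun _ _ => Finset.sum_congr rfl fun _ _ => by ring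
  rw [hO', hMid, hO, hLR, hR, hL, hQe]
  field_simp
  ring

theorem pde_transfer (hm : 3 ≤ m) {u : XX m → ℂ} {W O : Set (XX m)} (hW : IsOpen W) (hu : ContDiffOn ℝ ∞ u W) (hO : IsOpen O) (hO0 : ∀ y ∈ O, y ≠ 0 ∧ inv y ∈ W)
    (hE : ∀ x ∈ W, (1 + Complex.I • (Matrix.of fun i j => DD j (DD i u) x)).det - (1 - Complex.I • (Matrix.of fun i j => DD j (DD i u) x)).det = 0)
    {F : XX m → ℂ} (hF : ContDiffOn ℝ ∞ F O) (hFu : ∀ y ∈ O, u (inv y) = pw (((m:ℝ)-2)/2) y * F y) {y : XX m} (hy : y ∈ O) :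
    MvPolynomial.aeval (Sum.elim (fun i => (y i:ℂ)) (fun α => jet F α y)) (EQ2 m) = 0 := by
  have h1 : ∀ j, ∀ x ∈ O, DD j u (inv x) = pw (((m:ℝ)-2)/2) x * MM j F x := by
    intro j x hx
    refine grad_conj (hO0 x hx).1 ((hu.contDiffAt (hW.mem_nhds (hO0 x hx).2)).differentiableAt (by simp)) ((hF.contDiffAt (hO.mem_nhds hx)).differentiableAt (by simp)) ?_ j
    filter_upwards [hO.mem_nhds hx] with z hz using hFu z hz
  have h2 : ∀ i j, ∀ x ∈ O, DD i (DD j u) (inv x) = pw (((m:ℝ)-2)/2) x * MM i (MM j F) x := by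
    intro i j x hx
    refine grad_conj (hO0 x hx).1 (((DD_contDiffOn hW hu j).contDiffAt (hW.mem_nhds (hO0 x hx).2)).differentiableAt (by simp)) (((MM_contDiffOn hO hF j).contDiffAt (hO.mem_nhds hx)).differentiableAt (by simp)) ?_ i
    filter_upwards [hO.mem_nhds hx] with z hz using h1 j z hz
  have hy0 := (hO0 y hy).1
  refine EQ2_zero hm (r := rc y) (s := ∑ k, (y k : ℂ) * DD k F y) (F := F y) (t := pw (((m:ℝ)-2)/2) y) (y := fun i => (y i : ℂ)) (g := fun i => DD i F y) (D := fun i j => DD i (DD j F) y)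
    (fun i => rfl) (fun i => rfl) (fun i j => rfl) rfl rfl rfl (rc_ne hy0) ?_ ?_
  · rw [sq, pw_add _ _ hy0, ← pw_nat]; congr 1
    rw [Nat.cast_sub (by omega)]; push_cast; ring
  · have hP : OO (rc y) (fun i => (y i : ℂ)) * (rc y • Kmat (rc y) (F y) (∑ k, (y k : ℂ) * DD k F y) (fun i => (y i : ℂ)) (fun i => DD i F y) (fun i j => DD i (DD j F) y) + ((m:ℂ) * (m - 2) * F y) • vecMulVec (fun i => (y i : ℂ)) (fun i => (y i : ℂ))) * OO (rc y) (fun i => (y i : ℂ)) = Matrix.of fun i j => MM i (MM j F) y := by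
      ext i j
      rw [OO_conj (r := rc y) rfl rfl (rc_ne hy0) rfl, Matrix.of_apply, MM_MM hO hF hy]
    rw [← OO_det (r := rc y) (y := fun i => (y i : ℂ)) rfl (rc_ne hy0) (Complex.I * _), ← OO_det (r := rc y) (y := fun i => (y i : ℂ)) rfl (rc_ne hy0) (-(Complex.I * _)), hP]
    have h3 := hE _ (hO0 y hy).2
    have h4 : (Matrix.of fun i j => DD j (DD i u) (inv y)) = (pw (((m:ℝ)-2)/2) y • (Matrix.of fun i j => MM i (MM j F) y))ᵀ := by
      ext i j; simp [h2 _ _ y hy]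
    rw [h4, sub_eq_zero] at h3
    have e1 : ∀ c : ℂ, ∀ M : Matrix (Fin m) (Fin m) ℂ, (1 + c • Mᵀ).det = (1 + c • M).det := by
      intro c M; rw [← det_transpose]; simp
    rw [sub_eq_add_neg (1 : Matrix (Fin m) (Fin m) ℂ), ← neg_smul, e1, e1, smul_smul, smul_smul] at h3
    rw [h3, neg_mul]
end pde0
end Lawlor

namespace Lawlor
open MeasureTheory Set Filter Topology
open scoped Real ContDiff
noncomputable section symb
variable {m : ℕ}

def Om (m : ℕ) : Set (XX m) := {y | y ≠ 0 ∧ ‖y‖ < 1}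
lemma isOpen_Om : IsOpen (Om m) := isOpen_compl_singleton.inter (isOpen_lt continuous_norm continuous_const)

def SB (a : ℝ) (g : XX m → ℂ) : Prop := ContDiffOn ℝ ∞ g (Om m) ∧ ∀ ε, 0 < ε → ε < 1 → ∃ C, 0 ≤ C ∧ ∀ y ∈ Om m, ‖g y‖ ≤ C * ‖y‖ ^ (a - ε)

def SC : ℕ → ℝ → (XX m → ℂ) → Prop
  | 0, a, g => SB a g
  | n+1, a, g => SB a g ∧ ∀ i, SC n (a-1) (DD i g)

lemma SC.sb {n : ℕ} {a : ℝ} {g : XX m → ℂ} (h : SC n a g) : SB a g := by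
  cases n with
  | zero => exact h
  | succ n => exact h.1

lemma SC.smooth {n : ℕ} {a : ℝ} {g : XX m → ℂ} (h : SC n a g) : ContDiffOn ℝ ∞ g (Om m) := h.sb.1

lemma SC.diffAt {n : ℕ} {a : ℝ} {g : XX m → ℂ} (h : SC n a g) {y : XX m} (hy : y ∈ Om m) : DifferentiableAt ℝ g y :=
  (h.smooth.contDiffAt (isOpen_Om.mem_nhds hy)).differentiableAt (by simp)

lemma SC.pred {n : ℕ} {a : ℝ} {g : XX m → ℂ} (h : SC (n+1) a g) : SC n a g := by
  induction n generalizing a g with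
  | zero => exact h.1
  | succ n ih => exact ⟨h.1, fun i => ih (h.2 i)⟩

lemma SC.le {n k : ℕ} {a : ℝ} {g : XX m → ℂ} (h : SC n a g) (hk : k ≤ n) : SC k a g := by
  induction n with
  | zero => obtain rfl : k = 0 := by omega
            exact h
  | succ n ih =>
    rcases Nat.lt_or_ge k (n+1) with h1 | h1
    · exact ih h.pred (by omega)
    · obtain rfl : k = n + 1 := by omega
      exact h

lemma SB.mono {a b : ℝ} {g : XX m → ℂ} (h : SB a g) (hab : b ≤ a) : SB b g := by
  refine ⟨h.1, fun ε h0 h1 => ?_⟩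
  obtain ⟨C, hC, hb⟩ := h.2 ε h0 h1
  refine ⟨C, hC, fun y hy => (hb y hy).trans ?_⟩
  gcongr C * ?_
  exact Real.rpow_le_rpow_of_exponent_ge (norm_pos_iff.2 hy.1) hy.2.le (by linarith)

lemma SC.mono {n : ℕ} {a b : ℝ} {g : XX m → ℂ} (h : SC n a g) (hab : b ≤ a) : SC n b g := by
  induction n generalizing a b g with
  | zero => exact SB.mono h hab
  | succ n ih => exact ⟨h.1.mono hab, fun i => ih (h.2 i) (by linarith)⟩

lemma SB.congr {a : ℝ} {g h : XX m → ℂ} (hg : SB a g) (e : EqOn h g (Om m)) : SB a h := by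
  refine ⟨hg.1.congr e, fun ε h0 h1 => ?_⟩
  obtain ⟨C, hC, hb⟩ := hg.2 ε h0 h1
  exact ⟨C, hC, fun y hy => by rw [e hy]; exact hb y hy⟩

lemma SC.congr {n : ℕ} {a : ℝ} {g h : XX m → ℂ} (hg : SC n a g) (e : EqOn h g (Om m)) : SC n a h := by
  induction n generalizing a g h with
  | zero => exact SB.congr hg e
  | succ n ih => exact ⟨hg.1.congr e, fun i => ih (hg.2 i) (DD_congr isOpen_Om e i)⟩

lemma SB.add {a : ℝ} {g h : XX m → ℂ} (hg : SB a g) (hh : SB a h) : SB a (fun y => g y + h y) := by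
  refine ⟨hg.1.add hh.1, fun ε h0 h1 => ?_⟩
  obtain ⟨C, hC, hb⟩ := hg.2 ε h0 h1
  obtain ⟨C', hC', hb'⟩ := hh.2 ε h0 h1
  refine ⟨C + C', by positivity, fun y hy => (norm_add_le _ _).trans ?_⟩
  rw [add_mul]; exact add_le_add (hb y hy) (hb' y hy)

lemma SC.add {n : ℕ} {a : ℝ} {g h : XX m → ℂ} (hg : SC n a g) (hh : SC n a h) : SC n a (fun y => g y + h y) := by
  induction n generalizing a g h with
  | zero => exact SB.add hg hh
  | succ n ih => 
    refine ⟨hg.1.add hh.1, fun i => (ih (hg.2 i) (hh.2 i)).congr fun y hy => ?_⟩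
    exact DD_add' (hg.diffAt hy) (hh.diffAt hy) i

lemma SB.mul {a b : ℝ} {g h : XX m → ℂ} (hg : SB a g) (hh : SB b h) : SB (a+b) (fun y => g y * h y) := by
  refine ⟨hg.1.mul hh.1, fun ε h0 h1 => ?_⟩
  obtain ⟨C, hC, hb⟩ := hg.2 (ε/2) (by linarith) (by linarith)
  obtain ⟨C', hC', hb'⟩ := hh.2 (ε/2) (by linarith) (by linarith)
  refine ⟨C * C', by positivity, fun y hy => ?_⟩
  rw [norm_mul, show a + b - ε = (a - ε/2) + (b - ε/2) by ring, Real.rpow_add (norm_pos_iff.2 hy.1), mul_mul_mul_comm]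
  exact mul_le_mul (hb y hy) (hb' y hy) (norm_nonneg _) (by positivity)

lemma SC.mul {n : ℕ} {a b : ℝ} {g h : XX m → ℂ} (hg : SC n a g) (hh : SC n b h) : SC n (a+b) (fun y => g y * h y) := by
  induction n generalizing a b g h with
  | zero => exact SB.mul hg hh
  | succ n ih => 
    refine ⟨hg.1.mul hh.1, fun i => ?_⟩
    have h1 := ih (hg.2 i) hh.pred
    have h2 := ih hg.pred (hh.2 i)
    rw [show a - 1 + b = a + b - 1 by ring] at h1
    rw [show a + (b-1) = a + b - 1 by ring] at h2
    exact (h1.add h2).congr fun y hy => DD_mul (hg.diffAt hy) (hh.diffAt hy) i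

lemma DD_const (i : Fin m) (c : ℂ) : DD i (fun _ : XX m => c) = fun _ => 0 := by
  ext y; simp [DD]

lemma SC_zero (n : ℕ) (a : ℝ) : SC n a (fun _ : XX m => 0) := by
  have h0 : ∀ a : ℝ, SB a (fun _ : XX m => (0:ℂ)) := fun a => ⟨contDiffOn_const, fun ε _ _ => ⟨0, le_rfl, fun y _ => by simp⟩⟩
  induction n generalizing a with
  | zero => exact h0 a
  | succ n ih => exact ⟨h0 a, fun i => by rw [DD_const]; exact ih _⟩

/-- a bounded smooth function -/
lemma SB_of_bdd {g : XX m → ℂ} (hg : ContDiffOn ℝ ∞ g (Om m)) {a C : ℝ} (hb : ∀ y ∈ Om m, ‖g y‖ ≤ C * ‖y‖ ^ a) : SB a g := by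
  refine ⟨hg, fun ε h0 h1 => ⟨|C|, abs_nonneg _, fun y hy => (hb y hy).trans ?_⟩⟩
  have : ‖y‖ ^ a ≤ ‖y‖ ^ (a - ε) := Real.rpow_le_rpow_of_exponent_ge (norm_pos_iff.2 hy.1) hy.2.le (by linarith)
  exact mul_le_mul (le_abs_self _) this (by positivity) (abs_nonneg _)

lemma SC_const (n : ℕ) (c : ℂ) : SC n 0 (fun _ : XX m => c) := by
  have h0 : SB 0 (fun _ : XX m => c) := SB_of_bdd contDiffOn_const (C := ‖c‖) fun y hy => by simp
  cases n with
  | zero => exact h0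
  | succ n => exact ⟨h0, fun i => by rw [DD_const]; exact SC_zero _ _⟩

lemma SC.cmul {n : ℕ} {a : ℝ} {g : XX m → ℂ} (c : ℂ) (hg : SC n a g) : SC n a (fun y => c * g y) := by
  have := (SC_const n c).mul hg
  rwa [zero_add] at this

lemma SC.sum {n : ℕ} {a : ℝ} {ι : Type*} {s : Finset ι} {g : ι → XX m → ℂ} (hg : ∀ k ∈ s, SC n a (g k)) : SC n a (fun y => ∑ k ∈ s, g k y) := by
  classical
  induction s using Finset.induction_on with
  | empty => simpa using SC_zero n a
  | insert k s hk ih =>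
    simp only [Finset.sum_insert hk]
    exact (hg k (Finset.mem_insert_self _ _)).add (ih fun l hl => hg l (Finset.mem_insert_of_mem hl))

lemma SC_coord (n : ℕ) (i : Fin m) : SC n 1 (fun y : XX m => (y i : ℂ)) := by
  have h0 : SB 1 (fun y : XX m => (y i : ℂ)) := SB_of_bdd (coord_contDiff i).contDiffOn (C := 1) fun y hy => by
    rw [Complex.norm_real, Real.rpow_one, one_mul]; exact norm_le_pi_norm y i
  cases n with
  | zero => exact h0
  | succ n =>
    refine ⟨h0, fun j => ?_⟩
    have : DD j (fun y : XX m => (y i : ℂ)) = fun _ => if j = i then 1 else 0 := by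
      ext y; exact hd_eq (((coord_contDiff (n := 1) i).contDiffAt).differentiableAt (by simp)) (hd_coord j i y)
    rw [this, sub_self]; exact SC_const _ _

lemma norm_sq_le_rr (y : XX m) : ‖y‖^2 ≤ rr y := by
  by_cases hy : y = 0
  · subst hy; simp [rr]
  rw [← Real.le_sqrt (norm_nonneg _) (rr_pos hy).le]
  refine (pi_norm_le_iff_of_nonneg (Real.sqrt_nonneg _)).2 fun i => ?_
  rw [Real.norm_eq_abs]
  refine Real.abs_le_sqrt ?_
  exact Finset.single_le_sum (f := fun i => y i ^2) (fun i _ => sq_nonneg _) (Finset.mem_univ i)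

lemma rr_le (y : XX m) : rr y ≤ m * ‖y‖^2 := by
  have : ∀ i ∈ Finset.univ, y i ^ 2 ≤ ‖y‖^2 := fun i _ => by
    rw [← sq_abs, ← Real.norm_eq_abs]; gcongr; exact norm_le_pi_norm y i
  refine (Finset.sum_le_sum this).trans ?_
  simp

lemma pw_contDiffOn (s : ℝ) : ContDiffOn ℝ ∞ (pw s) (Om m) := fun y hy => (pw_contDiffAt s hy.1).contDiffWithinAt

lemma SC_pw (n : ℕ) (s : ℝ) : SC n (2*s) (pw (m := m) s) := by
  have h0 : ∀ s, SB (2*s) (pw (m := m) s) := fun s => by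
    refine SB_of_bdd (pw_contDiffOn s) (C := max 1 ((m:ℝ)^s)) fun y hy => ?_
    have hn := norm_pos_iff.2 hy.1
    rw [pw, Complex.norm_real, Real.norm_of_nonneg (by have := rr_pos hy.1; positivity), Real.rpow_mul hn.le, Real.rpow_two]
    rcases le_total 0 s with hs | hs
    · calc rr y ^ s ≤ (m * ‖y‖^2)^s := Real.rpow_le_rpow (rr_pos hy.1).le (rr_le y) hs
        _ = m^s * (‖y‖^2)^s := Real.mul_rpow (by positivity) (by positivity)
        _ ≤ _ := by gcongr; exact le_max_right _ _
    · calc rr y ^ s ≤ (‖y‖^2)^s := Real.rpow_le_rpow_of_nonpos (by positivity) (norm_sq_le_rr y) hs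
        _ ≤ _ := le_mul_of_one_le_left (by positivity) (le_max_left _ _)
  induction n generalizing s with
  | zero => exact h0 s
  | succ n ih =>
    refine ⟨h0 s, fun i => ?_⟩
    have h1 := ((SC_coord n i).mul (ih (s-1))).cmul (2 * s)
    rw [show 1 + 2 * (s-1) = 2*s - 1 by ring] at h1
    refine h1.congr fun y hy => ?_
    rw [hd_eq (((pw_contDiffAt (n := 1) s hy.1)).differentiableAt (by simp)) (hd_pw s i hy.1)]
    ring

lemma SC_rc (n : ℕ) : SC n 2 (rc (m := m)) := by
  have := SC_pw (m := m) n 1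
  rw [mul_one] at this
  exact this.congr fun y _ => (pw_one y).symm

lemma SC_good (n : ℕ) {ψ : XX m → ℂ} (h : Good ψ) : SC n 0 ψ := by
  have h0 : ∀ ψ : XX m → ℂ, Good ψ → SB 0 ψ := fun ψ h => by
    obtain ⟨C, hC⟩ := h.supp.hcs.exists_bound_of_continuous h.smooth.continuous
    exact SB_of_bdd h.smooth.contDiffOn (C := C) fun y hy => by simpa using hC y
  induction n generalizing ψ with
  | zero => exact h0 ψ h
  | succ n ih => exact ⟨h0 ψ h, fun i => (ih (h.DD i)).mono (by norm_num)⟩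

lemma SC_good_far (n : ℕ) (b : ℝ) {ψ : XX m → ℂ} (h : Good ψ) (hz : ∀ y, ‖y‖ < 2/10 → ψ y = 0) : SC n b ψ := by
  have h0 : ∀ b, ∀ ψ : XX m → ℂ, Good ψ → (∀ y, ‖y‖ < 2/10 → ψ y = 0) → SB b ψ := fun b ψ h hz => by
    obtain ⟨C, hC⟩ := h.supp.hcs.exists_bound_of_continuous h.smooth.continuous
    have hC0 : 0 ≤ C := (norm_nonneg _).trans (hC 0)
    refine SB.mono (SB_of_bdd (a := max b 0) h.smooth.contDiffOn (C := C * ((2/10:ℝ)^(max b 0))⁻¹) fun y hy => ?_) (le_max_left _ _)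
    by_cases hy2 : ‖y‖ < 2/10
    · rw [hz y hy2, norm_zero]; positivity
    · push Not at hy2
      refine (hC y).trans ?_
      rw [mul_assoc]
      refine le_mul_of_one_le_right hC0 ?_
      rw [← div_eq_inv_mul, one_le_div (by positivity)]
      exact Real.rpow_le_rpow (by norm_num) hy2 (le_max_right _ _)
  induction n generalizing ψ b with
  | zero => exact h0 b ψ h hz
  | succ n ih =>
    refine ⟨h0 b ψ h hz, fun i => ih _ (h.DD i) fun y hy => ?_⟩
    have e : EqOn ψ (fun _ => 0) (Metric.ball 0 (2/10)) := fun y hy => hz y (by simpa using hy)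
    rw [DD_congr Metric.isOpen_ball e i (by simpa using hy), DD_const]

/-! exterior class -/
def Wx (m : ℕ) : Set (XX m) := {x | 1 < m * rr x}
lemma isOpen_Wx : IsOpen (Wx m) := isOpen_lt continuous_const (continuous_const.mul (rr_contDiff (n := 0)).continuous)

def EB (a : ℝ) (g : XX m → ℂ) : Prop := ContDiffOn ℝ ∞ g (Wx m) ∧ ∀ ε, 0 < ε → ε < 1 → ∃ C, 0 ≤ C ∧ ∀ x ∈ Wx m, ‖g x‖ ≤ C * rr x ^ (-(a - ε)/2)
def EC : ℕ → ℝ → (XX m → ℂ) → Prop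
  | 0, a, g => EB a g
  | n+1, a, g => EB a g ∧ ∀ i, EC n (a+1) (DD i g)

lemma EC.eb {n : ℕ} {a : ℝ} {g : XX m → ℂ} (h : EC n a g) : EB a g := by
  cases n with
  | zero => exact h
  | succ n => exact h.1

lemma EC.pred {n : ℕ} {a : ℝ} {g : XX m → ℂ} (h : EC (n+1) a g) : EC n a g := by
  induction n generalizing a g with
  | zero => exact h.1
  | succ n ih => exact ⟨h.1, fun i => ih (h.2 i)⟩

lemma rr_inv {y : XX m} (hy : y ≠ 0) : rr (inv y) = (rr y)⁻¹ := by
  have : rr (inv y) = (rr y)⁻¹^2 * rr y := by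
    simp only [rr, inv, Pi.smul_apply, smul_eq_mul, mul_pow, ← Finset.mul_sum]
  rw [this]; have := (rr_pos hy).ne'; field_simp

lemma inv_mem {y : XX m} (hy : y ∈ Om m) : inv y ∈ Wx m := by
  show 1 < m * rr (inv y)
  have hp := rr_pos hy.1
  rw [rr_inv hy.1, ← div_eq_mul_inv, one_lt_div hp]
  have hm : 0 < (m:ℝ) := by
    have := hp.trans_le (rr_le y)
    by_contra h
    have : (m:ℝ) * ‖y‖^2 ≤ 0 := mul_nonpos_of_nonpos_of_nonneg (not_lt.1 h) (by positivity)
    linarith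
  have h1 := norm_nonneg y
  have h2 := hy.2
  calc rr y ≤ m * ‖y‖^2 := rr_le y
    _ < m * 1 := by gcongr; nlinarith
    _ = m := mul_one _

lemma EB.sb {a : ℝ} {g : XX m → ℂ} (h : EB a g) : SB a (fun y => g (inv y)) := by
  refine ⟨fun y hy => ?_, fun ε h0 h1 => ?_⟩
  · exact (((h.1.contDiffAt (isOpen_Wx.mem_nhds (inv_mem hy))).comp y (inv_contDiffAt hy.1))).contDiffWithinAt
  · obtain ⟨C, hC, hb⟩ := h.2 (ε/2) (by linarith) (by linarith)
    obtain ⟨C', hC', hb'⟩ := (SC_pw (m := m) 0 ((a - ε/2)/2)).2 (ε/2) (by linarith) (by linarith)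
    refine ⟨C * C', by positivity, fun y hy => (hb _ (inv_mem hy)).trans ?_⟩
    rw [mul_assoc]; gcongr
    have := hb' y hy
    rw [pw, Complex.norm_real, Real.norm_of_nonneg (by have := rr_pos hy.1; positivity)] at this
    rw [rr_inv hy.1, Real.inv_rpow (rr_pos hy.1).le, ← Real.rpow_neg (rr_pos hy.1).le]
    rw [show -(-(a - ε/2)/2) = (a - ε/2)/2 by ring, show a - ε = 2*((a - ε/2)/2) - ε/2 by ring]; exact this

lemma EC.sc {n : ℕ} {a : ℝ} {g : XX m → ℂ} (h : EC n a g) : SC n a (fun y => g (inv y)) := by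
  induction n generalizing a g with
  | zero => exact EB.sb h
  | succ n ih =>
    refine ⟨h.1.sb, fun j => ?_⟩
    have h1 := (SC_pw (m := m) n (-1)).mul (ih (h.2 j))
    rw [show 2 * (-1:ℝ) + (a+1) = a - 1 by ring] at h1
    have h2 := ((((SC_coord n j).mul (SC_pw (m := m) n (-1))).mul (SC_pw (m := m) n (-1))).mul (SC.sum (s := Finset.univ) fun k _ => (SC_coord n k).mul (ih (h.2 k)))).cmul (-2)
    rw [show 1 + 2 * (-1:ℝ) + 2 * (-1:ℝ) + (1 + (a+1)) = a - 1 by ring] at h2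
    refine (h1.add h2).congr fun y hy => ?_
    rw [DD_inv hy.1 ((h.1.1.contDiffAt (isOpen_Wx.mem_nhds (inv_mem hy))).differentiableAt (by simp)) j]
    simp only [pw_neg_one]
    ring
end symb
end Lawlor

namespace Lawlor
open MeasureTheory Set Filter Topology
open scoped Real ContDiff
noncomputable section lapF
variable {m : ℕ}
open Matrix MvPolynomial

lemma Hv_coeff_eval {z : Fin m ⊕ JJ m → ℂ} {r s F : ℂ} {y g : Fin m → ℂ} {D : Fin m → Fin m → ℂ}
    (hy : ∀ i, z (Sum.inl i) = y i) (hg : ∀ i, z (Sum.inr (jP i)) = g i) (hD : ∀ i j, z (Sum.inr (jA j i)) = D i j) (hF : z (Sum.inr jU) = F)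
    (hr : r = ∑ i, y i^2) (hs : s = ∑ i, y i * g i) (n : ℕ) :
    aeval z (rv m) = r ∧ aeval z ((Hv m).coeff n) = (HP y (Kmat r F s y g D) ((m:ℂ) * (m - 2) * F)).coeff n := by
  have erv : aeval z (rv m) = r := by simp [rv, yv, hy, hr]
  refine ⟨erv, ?_⟩
  have hmap : (Hv m).map (aeval z : RR m →ₐ[ℂ] ℂ).toRingHom = HP y (Kmat r F s y g D) ((m:ℂ) * (m - 2) * F) := by
    rw [Hv, HP_map]
    have e1 : (fun i => (aeval z : RR m →ₐ[ℂ] ℂ).toRingHom (yv i)) = y := by ext i; simp [yv, hy]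
    have e2 : (Kmat (rv m) (Fv m) (sv m) yv gv Dv).map (aeval z : RR m →ₐ[ℂ] ℂ).toRingHom = Kmat r F s y g D := by
      ext i j
      simp only [Kmat, Matrix.map_apply, Matrix.of_apply]
      simp only [AlgHom.toRingHom_eq_coe, RingHom.coe_coe, map_sub, map_add, map_mul, map_natCast, erv, map_ofNat]
      have e3 : aeval z (sv m) = s := by simp [sv, yv, gv, hy, hg, hs]
      rw [e3]
      have e4 : ∀ i, aeval z (gv i) = g i := fun i => by simp [gv, hg]
      have e5 : ∀ i, aeval z (yv i) = y i := fun i => by simp [yv, hy]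
      have e6 : aeval z (Dv i j) = D i j := by simp [Dv, hD]
      have e7 : aeval z (Fv m) = F := by simp [Fv, hF]
      have e8 : aeval z (if i = j then (1 : RR m) else 0) = if i = j then (1:ℂ) else 0 := by split_ifs <;> simp
      rw [e4, e4, e5, e5, e6, e7, e8]
    have e3 : (aeval z : RR m →ₐ[ℂ] ℂ).toRingHom ((m:RR m) * ((m:RR m)-2) * Fv m) = (m:ℂ) * (m - 2) * F := by
      simp [Fv, hF]
    rw [e1, e2, e3]
  rw [← hmap, Polynomial.coeff_map]; rfl

lemma EQ2_solve {z : Fin m ⊕ JJ m → ℂ} {r s F : ℂ} {y g : Fin m → ℂ} {D : Fin m → Fin m → ℂ}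
    (hy : ∀ i, z (Sum.inl i) = y i) (hg : ∀ i, z (Sum.inr (jP i)) = g i) (hD : ∀ i j, z (Sum.inr (jA j i)) = D i j) (hF : z (Sum.inr jU) = F)
    (hr : r = ∑ i, y i^2) (hs : s = ∑ i, y i * g i) (h : aeval z (EQ2 m) = 0) :
    ∑ i, D i i = ∑ j ∈ Finset.range (Hv m).natDegree, (-(-1)^(j+1)) * (r ^ (m * (j+1) - 2) * (HP y (Kmat r F s y g D) ((m:ℂ) * (m - 2) * F)).coeff (2 * (j+1) + 1)) := by
  have e := Hv_coeff_eval hy hg hD hF hr hs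
  have e1 : ∀ i, aeval z (Dv i i) = D i i := fun i => by simp [Dv, hD]
  rw [EQ2, map_add, map_sum, map_sum] at h
  simp only [e1, map_mul, map_pow, (e 0).1, (e _).2, map_neg, map_one] at h
  rw [eq_neg_of_add_eq_zero_left h, ← Finset.sum_neg_distrib]
  exact Finset.sum_congr rfl fun j _ => by ring

def SR (n : ℕ) : Subring (XX m → ℂ) where
  carrier := {g | SC n 0 g}
  mul_mem' := fun {a b} ha hb => by
    have : SC n (0+0) (fun y => a y * b y) := SC.mul ha hb
    rw [add_zero] at this; exact this
  one_mem' := SC_const n 1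
  add_mem' := fun {a b} ha hb => SC.add ha hb
  zero_mem' := SC_zero n 0
  neg_mem' := fun {a} ha => by
    have : SC n 0 (fun y => (-1) * a y) := SC.cmul (-1) ha
    exact this.congr fun y _ => by simp

lemma HP_SC {n : ℕ} {y : Fin m → XX m → ℂ} {K : Fin m → Fin m → XX m → ℂ} {cc : XX m → ℂ} (hy : ∀ i, SC n 0 (y i)) (hK : ∀ i j, SC n 0 (K i j))
    (hcc : SC n 0 cc) (k : ℕ) : SC n 0 (fun x => (HP (fun i => y i x) (Matrix.of fun i j => K i j x) (cc x)).coeff k) := by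
  obtain ⟨P, hP⟩ : ∃ P : Polynomial (SR (m := m) n), P = HP (fun i => (⟨y i, hy i⟩ : SR (m := m) n)) (Matrix.of fun i j => ⟨K i j, hK i j⟩) ⟨cc, hcc⟩ := ⟨_, rfl⟩
  have : SC n 0 (P.coeff k : XX m → ℂ) := (P.coeff k).2
  refine this.congr fun x _ => ?_
  have e := HP_map ((Pi.evalRingHom (fun _ : XX m => ℂ) x).comp (SR (m := m) n).subtype) (fun i => (⟨y i, hy i⟩ : SR (m := m) n)) (Matrix.of fun i j => ⟨K i j, hK i j⟩) ⟨cc, hcc⟩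
  rw [← hP] at e
  have e2 := congrArg (fun q => Polynomial.coeff q k) e
  simp only [Polynomial.coeff_map] at e2
  exact e2.symm

lemma SC.DD {n : ℕ} {a : ℝ} {g : XX m → ℂ} (h : SC (n+1) a g) (i : Fin m) : SC n (a-1) (DD i g) := h.2 i

set_option maxHeartbeats 400000 in
theorem lap_SC (hm : 3 ≤ m) {F : XX m → ℂ} (hF : ∀ n, SC n 0 F)
    (hE : ∀ y ∈ Om m, aeval (Sum.elim (fun i => (y i:ℂ)) (fun α => jet F α y)) (EQ2 m) = 0) (n : ℕ) :
    SC n (2 * (m - 2)) (fun y => ∑ i, DD i (DD i F) y) := by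
  have hm' : (3:ℝ) ≤ m := by exact_mod_cast hm
  have hD : ∀ i j, SC n (-2) (Lawlor.DD i (Lawlor.DD j F)) := fun i j => by
    have := ((hF (n+2)).DD j).DD i
    rwa [show (0:ℝ) - 1 - 1 = -2 by norm_num] at this
  have hg : ∀ i, SC n (-1) (Lawlor.DD i F) := fun i => by
    have := ((hF (n+1)).DD i)
    rwa [show (0:ℝ) - 1 = -1 by norm_num] at this
  have hs : SC n 0 (fun y : XX m => ∑ i, (y i : ℂ) * Lawlor.DD i F y) := SC.sum fun i _ => by
    have := (SC_coord n i).mul (hg i)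
    rwa [show (1:ℝ) + -1 = 0 by norm_num] at this
  obtain ⟨K, hKd⟩ : ∃ K : Fin m → Fin m → XX m → ℂ, K = fun i j y => (rc y * Lawlor.DD i (Lawlor.DD j F) y + (m:ℂ) * (Lawlor.DD i F y * y j + y i * Lawlor.DD j F y)) + (-1) * ((((m:ℂ)-2) * F y + 2 * ∑ i, (y i : ℂ) * Lawlor.DD i F y) * (if i = j then 1 else 0)) := ⟨_, rfl⟩
  have hK : ∀ i j, SC n 0 (K i j) := by
    intro i j
    rw [hKd]
    have h1 := (SC_rc n).mul (hD i j)
    rw [show (2:ℝ) + -2 = 0 by norm_num] at h1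
    have h2 := (hg i).mul (SC_coord n j)
    have h3 := (SC_coord n i).mul (hg j)
    rw [show -1 + (1:ℝ) = 0 by norm_num] at h2
    rw [show (1:ℝ) + -1 = 0 by norm_num] at h3
    have h4 := ((((hF n).cmul ((m:ℂ)-2)).add (hs.cmul 2)).mul (SC_const n (if i = j then 1 else 0)))
    rw [show (0:ℝ) + 0 = 0 by norm_num] at h4
    exact (h1.add ((h2.add h3).cmul _)).add (h4.cmul (-1))
  have hc := fun k => HP_SC (fun i => (SC_coord n i).mono (zero_le_one)) hK ((hF n).cmul ((m:ℂ) * (m - 2))) k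
  have hS : SC n (2 * (m - 2)) (fun y => ∑ j ∈ Finset.range (Hv m).natDegree, (-(-1)^(j+1)) * (pw ((m * (j+1) - 2 : ℕ) : ℝ) y *
     (HP (fun i => (y i : ℂ)) (Matrix.of fun i j => K i j y) (m * (m-2) * F y)).coeff (2 * (j+1) + 1))) := by
    refine SC.sum fun j _ => SC.cmul _ ?_
    refine ((SC_pw n _).mul (hc _)).mono ?_
    rw [Nat.cast_sub (by nlinarith)]
    push_cast
    have : (0:ℝ) ≤ j := by positivity
    nlinarith
  refine hS.congr fun y hy => ?_
  have h := EQ2_solve (z := Sum.elim (fun i => (y i:ℂ)) (fun α => jet F α y)) (r := rc y) (s := ∑ i, (y i : ℂ) * Lawlor.DD i F y) (F := F y)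
    (y := fun i => (y i : ℂ)) (g := fun i => Lawlor.DD i F y) (D := fun i j => Lawlor.DD i (Lawlor.DD j F) y) (fun i => rfl) (fun i => rfl) (fun i j => rfl) rfl rfl rfl (hE y hy)
  have hKe : (Matrix.of fun i j => K i j y) = Kmat (rc y) (F y) (∑ i, (y i : ℂ) * Lawlor.DD i F y) (fun i => (y i : ℂ)) (fun i => Lawlor.DD i F y) (fun i j => Lawlor.DD i (Lawlor.DD j F) y) := by
    ext i j
    simp only [Kmat, Matrix.of_apply, hKd]
    ring
  simp only [hKe, pw_nat]
  exact h
end lapF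
end Lawlor

namespace Lawlor
open MeasureTheory Set Filter Topology
open scoped Real ContDiff
noncomputable section rem0
variable {m : ℕ}

lemma int_sing [hm : Fact (2 ≤ m)] {g : XX m → ℂ} (hg : ContDiffOn ℝ ∞ g {0}ᶜ) (hs : SuppIn (9/20) g) {n : ℕ} {a : ℝ} (h : SC n a g)
    (ha : -(m:ℝ) < a - 1/2) : Integrable g := by
  have hm2 := hm.out
  have : Nonempty (Fin m) := ⟨⟨0, by omega⟩⟩
  have hae : ∀ᵐ x : XX m, x ∈ ({0}ᶜ : Set (XX m)) := by
    rw [ae_iff]; simp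
  have hmeas : AEStronglyMeasurable g := by
    have := (hg.continuousOn).aestronglyMeasurable (μ := volume) (isOpen_compl_singleton.measurableSet)
    rwa [Measure.restrict_eq_self_of_ae_mem hae] at this
  obtain ⟨C, hC, hb⟩ := h.sb.2 (1/2) (by norm_num) (by norm_num)
  have h1 : IntegrableOn g (Metric.ball 0 1) := by
    refine integrableOn_ball_of_norm_le_rpow (C := C) (α := -(a - 1/2)) (by simp; omega) (by simp; linarith) ?_ hmeas
    rw [ae_restrict_iff' Metric.isOpen_ball.measurableSet]
    filter_upwards [hae] with x hx hx1
    rw [neg_neg]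
    exact hb x ⟨hx, by simpa using hx1⟩
  rw [← integrableOn_univ]
  refine h1.of_forall_sdiff_eq_zero MeasurableSet.univ fun x hx => hs x ?_
  have : 1 ≤ ‖x‖ := by simpa using hx.2
  linarith

lemma SC_iter {n : ℕ} {a : ℝ} {g : XX m → ℂ} (j : ℕ) (h : SC (n+j) a g) (i : Fin m) : SC n (a - j) ((DD i)^[j] g) := by
  induction j generalizing a g with
  | zero => simpa using h
  | succ j ih =>
    have := ih (h.2 i)
    rw [Function.iterate_succ_apply]
    convert this using 1
    push_cast; ring

lemma iter_sing {g : XX m → ℂ} (hg : ContDiffOn ℝ ∞ g {0}ᶜ) {ρ : ℝ} (hs : SuppIn ρ g) (i : Fin m) (j : ℕ) :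
    ContDiffOn ℝ ∞ ((DD i)^[j] g) {0}ᶜ ∧ SuppIn ρ ((DD i)^[j] g) := by
  induction j generalizing g with
  | zero => exact ⟨hg, hs⟩
  | succ j ih => exact ih (DD_contDiffOn isOpen_compl_singleton hg i) (hs.DD i)

lemma cut_sing {F : XX m → ℂ} (hF : ContDiffOn ℝ ∞ F (Om m)) : ContDiffOn ℝ ∞ (fun x => chi x * F x) {0}ᶜ := by
  intro x hx0
  by_cases hx : ‖x‖ < 1
  · exact (good_chi.smooth.contDiffAt.mul (hF.contDiffAt (isOpen_Om.mem_nhds ⟨hx0, hx⟩))).contDiffWithinAt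
  · have : (fun x => chi x * F x) =ᶠ[𝓝 x] fun _ => 0 := by
      have : ∀ᶠ y in 𝓝 x, 3/10 < ‖y‖ := continuous_norm.continuousAt.eventually (lt_mem_nhds (by push Not at hx; linarith))
      filter_upwards [this] with y hy
      rw [chi_zero y hy.le, zero_mul]
    exact (contDiffAt_const.congr_of_eventuallyEq this).contDiffWithinAt

lemma lap_cut {F : XX m → ℂ} (hF : ∀ n, SC n 0 F) {b : ℝ} (hL : ∀ n, SC n b (fun y => ∑ i, DD i (DD i F) y)) (n : ℕ) :
    SC n b (fun y => ∑ i, DD i (DD i (fun x => chi x * F x)) y) := by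
  have hfar : ∀ i, ∀ y : XX m, ‖y‖ < 2/10 → DD i chi y = 0 := fun i y hy => by
    have e : EqOn (chi (m := m)) (fun _ => 1) (Metric.ball 0 (2/10)) := fun y hy => chi_one y (by simpa using (le_of_lt (by simpa using hy : ‖y‖ < 2/10)))
    rw [DD_congr Metric.isOpen_ball e i (by simpa using hy), DD_const]
  have hfar2 : ∀ i, ∀ y : XX m, ‖y‖ < 2/10 → DD i (DD i chi) y = 0 := fun i y hy => by
    have e : EqOn (DD i (chi (m := m))) (fun _ => 0) (Metric.ball 0 (2/10)) := fun y hy => hfar i y (by simpa using hy)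
    rw [DD_congr Metric.isOpen_ball e i (by simpa using hy), DD_const]
  have h1 : SC n b (fun y => ∑ i, (DD i (DD i chi) y * F y + 2 * (DD i chi y * DD i F y))) := SC.sum fun i _ => by
    have a1 := (SC_good_far n b ((good_chi.DD i).DD i) (hfar2 i)).mul (hF n)
    rw [add_zero] at a1
    have a2 := (SC_good_far n (b+1) (good_chi.DD i) (hfar i)).mul ((hF (n+1)).2 i)
    rw [show b + 1 + (0 - 1) = b by ring] at a2
    exact a1.add (a2.cmul 2)
  have h2 := (SC_good n (good_chi (m := m))).mul (hL n)
  rw [zero_add] at h2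
  refine (h1.add h2).congr fun y hy => ?_
  have hd : ∀ {ψ : XX m → ℂ}, Good ψ → ∀ y, DifferentiableAt ℝ ψ y := fun h y => h.smooth.contDiffAt.differentiableAt (by simp)
  simp only [Finset.mul_sum, ← Finset.sum_add_distrib]
  refine Finset.sum_congr rfl fun i _ => ?_
  have e1 : EqOn (DD i (fun x => chi x * F x)) (fun y => DD i chi y * F y + chi y * DD i F y) (Om m) := fun y hy =>
    DD_mul (hd good_chi y) ((hF 0).diffAt hy) i
  rw [DD_congr isOpen_Om e1 i hy]
  have dF := (hF 0).diffAt hy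
  have dDF := ((hF 1).2 i).diffAt hy
  rw [DD_add' (g := fun y => DD i chi y * F y) (h := fun y => chi y * DD i F y) ((hd (good_chi.DD i) y).mul dF) ((hd good_chi y).mul dDF), DD_mul (hd (good_chi.DD i) y) dF, DD_mul (hd good_chi y) dDF]
  ring

lemma kr_apply_c (k : KK m) (i : Fin m) : ((kr k i : ℝ) : ℂ) = (k i : ℂ) := by simp [kr]

lemma ds_le (α : JJ m) (k : KK m) : ‖ds α k‖ ≤ (2*π)^2 * (1 + ‖k‖)^2 := by
  have hpi := Real.pi_gt_three
  have hk := norm_nonneg k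
  have h1 : 1 ≤ 2 * π * (1 + ‖k‖) := by nlinarith
  have hd : ∀ i, ‖dk i k‖ ≤ 2 * π * (1 + ‖k‖) := fun i => (norm_dk_le i k).trans (by gcongr; linarith)
  rw [← mul_pow]
  rcases α with _ | i | ⟨i, j⟩
  · simp only [ds, norm_one]; nlinarith
  · simp only [ds]; exact (hd i).trans (by nlinarith)
  · simp only [ds, norm_mul, sq]; exact mul_le_mul (hd i) (hd j) (norm_nonneg _) (by positivity)

lemma coef_v [hm : Fact (2 ≤ m)] (hm3 : 3 ≤ m) {v : XX m → ℂ} (hv : ContDiffOn ℝ ∞ v {0}ᶜ) (hs : SuppIn (9/20) v) (hS : ∀ n, SC n 0 v)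
    (hL : ∀ n, SC n (2 * (m - 2)) (fun y => ∑ i, DD i (DD i v) y)) : ∃ C, 0 ≤ C ∧ ∀ k, ‖coef v k‖ ≤ C * ((1 + ‖k‖)^(m+3))⁻¹ := by
  have hm' : (3:ℝ) ≤ m := by exact_mod_cast hm3
  have h1 : ∀ i, ContDiffOn ℝ ∞ (DD i v) {0}ᶜ := fun i => DD_contDiffOn isOpen_compl_singleton hv i
  have h2 : ∀ i, ContDiffOn ℝ ∞ (DD i (DD i v)) {0}ᶜ := fun i => DD_contDiffOn isOpen_compl_singleton (h1 i) i
  have i0 : Integrable v := int_sing hv hs (hS 0) (by linarith)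
  have i1 : ∀ i, Integrable (DD i v) := fun i => int_sing (h1 i) (hs.DD i) ((hS 1).2 i) (by linarith)
  have i2 : ∀ i, Integrable (DD i (DD i v)) := fun i => int_sing (h2 i) ((hs.DD i).DD i) (((hS 2).2 i).2 i) (by linarith)
  have hLs : SuppIn (9/20) (fun y => ∑ i, DD i (DD i v) y) := fun x hx => Finset.sum_eq_zero fun i _ => (hs.DD i).DD i x hx
  have hLc : ContDiffOn ℝ ∞ (fun y => ∑ i, DD i (DD i v) y) {0}ᶜ := ContDiffOn.sum fun i _ => h2 i
  obtain ⟨C, hC, hd⟩ := FT_decay hm.out (m+1) hLc hLs fun i j hj => by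
    obtain ⟨a1, a2⟩ := iter_sing hLc hLs i j
    refine int_sing a1 a2 (SC_iter (n := 0) j (hL _) i) ?_
    have : (j:ℝ) ≤ m + 1 := by exact_mod_cast hj
    linarith
  have hFT : ∀ ζ : XX m, FT (fun y => ∑ i, DD i (DD i v) y) ζ = -(4 * π^2 * (∑ i, (ζ i : ℂ)^2)) * FT v ζ := by
    intro ζ
    have : FT (fun y => ∑ i, DD i (DD i v) y) ζ = ∑ i, FT (DD i (DD i v)) ζ := by
      unfold FT
      simp only [Finset.mul_sum]
      exact integral_finsetSum _ fun i _ => integrable_ech_mul (i2 i) _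
    rw [this, Finset.mul_sum, ← Finset.sum_neg_distrib, Finset.sum_mul]
    refine Finset.sum_congr rfl fun i _ => ?_
    rw [FT_DD hm.out i ((h1 i).of_le (WithTop.coe_le_coe.2 le_top)) (hs.DD i) (i1 i) (i2 i), FT_DD hm.out i (hv.of_le (WithTop.coe_le_coe.2 le_top)) hs i0 (i1 i)]
    linear_combination (4 * (π:ℂ)^2 * (ζ i)^2 * FT v ζ) * Complex.I_sq
  refine ⟨C + ‖coef v 0‖, by positivity, fun k => ?_⟩
  rw [← div_eq_mul_inv, le_div_iff₀ (by positivity)]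
  by_cases hk : k = 0
  · rw [hk]; simp [hC]
  · have hk1 := one_le_norm hk
    have h := hd (kr k)
    rw [hFT, norm_kr, norm_mul, norm_neg, ← coef_eq_FT (hs.cell (by norm_num))] at h
    have hs2 : ‖k‖^2 ≤ rr (kr k) := by rw [← norm_kr]; exact norm_sq_le_rr _
    have e : ‖(4 * (π:ℂ)^2 * (∑ i, (kr k i : ℂ)^2))‖ = 4 * π^2 * rr (kr k) := by
      rw [show ∑ i, (kr k i : ℂ)^2 = ((rr (kr k) : ℝ) : ℂ) from rc_eq _, norm_mul, norm_mul, norm_pow, Complex.norm_real, Complex.norm_real, Real.norm_of_nonneg (by positivity), Real.norm_of_nonneg (le_trans (by positivity) hs2)]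
      simp
    rw [e] at h
    have hpi := Real.pi_gt_three
    have h4 : (1 + ‖k‖)^2 ≤ 4 * π^2 * rr (kr k) := by
      have : (1 + ‖k‖)^2 ≤ 4 * ‖k‖^2 := by nlinarith
      have h9 : 1 ≤ π^2 := by nlinarith
      have : 0 ≤ rr (kr k) := le_trans (by positivity) hs2
      nlinarith
    calc ‖coef v k‖ * (1 + ‖k‖)^(m+3) = (1+‖k‖)^(m+1) * ((1+‖k‖)^2 * ‖coef v k‖) := by ring
      _ ≤ (1+‖k‖)^(m+1) * ((4 * π^2 * rr (kr k)) * ‖coef v k‖) := by gcongr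
      _ ≤ C := h
      _ ≤ _ := by linarith [norm_nonneg (coef v 0)]

theorem removable [hm : Fact (2 ≤ m)] (hm3 : 3 ≤ m) {F : XX m → ℂ} (hF : ∀ n, SC n 0 F)
    (hE : ∀ y ∈ Om m, MvPolynomial.aeval (Sum.elim (fun i => (y i:ℂ)) (fun α => jet F α y)) (EQ2 m) = 0) :
    ∃ G : XX m → ℂ, AnalyticAt ℝ G 0 ∧ ∀ y, y ≠ 0 → ‖y‖ < 2/10 → G y = F y := by
  obtain ⟨v, hv⟩ : ∃ v : XX m → ℂ, v = fun x => chi x * F x := ⟨_, rfl⟩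
  have hvc : ContDiffOn ℝ ∞ v {0}ᶜ := by rw [hv]; exact cut_sing (hF 0).smooth
  have hvs : SuppIn (9/20) v := fun x hx => by rw [hv]; simp only; rw [chi_zero x (by linarith), zero_mul]
  have hvS : ∀ n, SC n 0 v := fun n => by
    have := (SC_good n (good_chi (m := m))).mul (hF n)
    rw [zero_add] at this; rw [hv]; exact this
  obtain ⟨C, hC, hb⟩ := coef_v hm3 hvc hvs hvS fun n => by rw [hv]; exact lap_cut hF (lap_SC hm3 hF hE) n
  have hsum : ∀ α : JJ m, Summable fun k => ‖ds α k * coef v k‖ := fun α => by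
    refine Summable.of_nonneg_of_le (fun _ => norm_nonneg _) (fun k => ?_) ((summable_lattice (m := m) (m+1) (by omega)).mul_left ((2*π)^2 * C))
    rw [norm_mul]
    refine (mul_le_mul (ds_le α k) (hb k) (norm_nonneg _) (by positivity)).trans (le_of_eq ?_)
    have : (1 + ‖k‖) ≠ 0 := by positivity
    field_simp
    ring
  obtain ⟨c, hc⟩ : ∃ c : JJ m → Wn m, c = fun α => mkW (fun k => ds α k * coef v k) (hsum α) := ⟨_, rfl⟩
  have hco : ∀ α k, co (c α) k = ds α k * coef v k := fun α k => by rw [hc]; exact co_mkW _ _ _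
  have hcU : ∀ k, co (c jU) k = coef v k := fun k => by rw [hco]; simp [ds, jU]
  have hds : ∀ α k, co (c α) k = ds α k * co (c jU) k := fun α k => by rw [hco, hcU]
  have hmem : MemLp v 2 (volume.restrict (cell m)) := by
    have hm' : (3:ℝ) ≤ m := by exact_mod_cast hm3
    have hmeas : AEStronglyMeasurable v := (int_sing hvc hvs (hvS 0) (by linarith)).1
    have h2 : Integrable (fun x => v x * v x) := by
      have := (hvS 0).mul (hvS 0)
      exact int_sing (hvc.mul hvc) (fun x hx => by simp [hvs x hx]) this (by linarith)
    refine MemLp.restrict _ ((memLp_two_iff_integrable_sq_norm hmeas).2 ?_)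
    refine h2.norm.congr (ae_of_all _ fun x => ?_)
    simp [sq]
  have heq : EqOn v (real (c jU)) (cell m ∩ {0}ᶜ) := eq_real hmem (fun k => (hcU k).symm) (isOpen_cell.inter isOpen_compl_singleton)
    inter_subset_left (hvc.continuousOn.mono inter_subset_right)
  have hop : IsOpen (Metric.ball (0 : XX m) (2/10) ∩ {0}ᶜ) := Metric.isOpen_ball.inter isOpen_compl_singleton
  have hGF : EqOn (real (c jU)) F (Metric.ball (0 : XX m) (2/10) ∩ {0}ᶜ) := fun x hx => by
    have hx2 : ‖x‖ < 2/10 := by simpa using hx.1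
    rw [← heq ⟨mem_cell_of (by linarith), hx.2⟩, hv]
    simp only; rw [chi_one x hx2.le, one_mul]
  have hne : ∀ x : XX m, x ≠ 0 → ‖x‖ < 2/10 → MvPolynomial.aeval (Sum.elim (fun i => (x i : ℂ)) (fun α => real (c α) x)) (EQ2 m) = 0 := by
    intro x hx0 hx
    rw [← hE x ⟨hx0, by linarith⟩]
    congr 2
    ext α
    rcases α with i | α
    · rfl
    · show real (c α) x = jet F α x
      rw [← jet_real hds, jet_congr hop hGF α ⟨by simpa using hx, hx0⟩]
  have hcont : Continuous (fun x : XX m => MvPolynomial.aeval (Sum.elim (fun i => (x i : ℂ)) (fun α => real (c α) x)) (EQ2 m)) := by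
    refine (continuous_aevalC (EQ2 m)).comp (continuous_pi fun α => ?_)
    rcases α with i | α
    · exact Complex.continuous_ofReal.comp (continuous_apply i)
    · exact continuous_real _
  have h0 : MvPolynomial.aeval (Sum.elim (fun i => ((0 : XX m) i : ℂ)) (fun α => real (c α) 0)) (EQ2 m) = 0 := by
    have : Nonempty (Fin m) := ⟨⟨0, by omega⟩⟩
    have t1 := (hcont.tendsto 0).mono_left (nhdsWithin_le_nhds (s := {0}ᶜ))
    refine tendsto_nhds_unique t1 (Tendsto.congr' ?_ tendsto_const_nhds)
    filter_upwards [self_mem_nhdsWithin, nhdsWithin_le_nhds (Metric.ball_mem_nhds (0 : XX m) (by norm_num : (0:ℝ) < 2/10))] with x hx hx2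
    exact (hne x hx (by simpa using hx2)).symm
  obtain ⟨c0, hell⟩ := ell_of_ne (m := m) (a := fun i j => if i = j then 1 else 0) fun k hk => by
    have : ∑ i, ∑ j, (if i = j then (1:ℂ) else 0) * ((k i : ℂ) * (k j : ℂ)) = rc k := by simp [rc, sq]
    rw [this]; exact rc_ne hk
  refine ⟨real (c jU), AN (EQ2 m) c hds (r := 2/10) (by norm_num) (fun x hx => ?_) (c0 := c0) ?_, fun y hy0 hy => hGF ⟨by simpa using hy, hy0⟩⟩
  · by_cases hx0 : x = 0
    · rw [hx0]; exact h0
    · exact hne x hx0 hx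
  · have : (fun i j => MvPolynomial.aeval (Sum.elim (fun _ : Fin m => (0:ℂ)) (fun α => real (c α) 0)) (MvPolynomial.pderiv (Sum.inr (jA i j)) (EQ2 m))) = fun i j => if i = j then (1:ℂ) else 0 := by
      ext i j
      exact EQ2_pderiv hm3 (fun i => rfl) i j
    rw [this]; exact hell
end rem0
end Lawlor

namespace Lawlor
open MeasureTheory Set Filter Topology
open scoped Real ContDiff
noncomputable section transf
variable {m : ℕ}

abbrev EE (m : ℕ) := EuclideanSpace ℝ (Fin m)

def Lm (s : ℝ) : XX m →L[ℝ] EE m := s • ((EuclideanSpace.equiv (Fin m) ℝ).symm : XX m →L[ℝ] EE m)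
def Li (s : ℝ) : EE m →L[ℝ] XX m := s • ((EuclideanSpace.equiv (Fin m) ℝ) : EE m →L[ℝ] XX m)

lemma Lm_apply (s : ℝ) (x : XX m) (i : Fin m) : Lm s x i = s * x i := by simp [Lm]
lemma Li_apply (s : ℝ) (x : EE m) (i : Fin m) : Li s x i = s * x i := by simp [Li]

lemma Lm_single (s : ℝ) (i : Fin m) : Lm s (Pi.single i 1) = s • EuclideanSpace.single i (1:ℝ) := by
  ext j; simp [Lm_apply, Pi.single_apply]

lemma norm_rr (X : EE m) : ‖X‖^2 = ∑ i, X i ^ 2 := by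
  rw [EuclideanSpace.real_norm_sq_eq]

lemma Lm_norm {s : ℝ} (hs : 0 < s) (x : XX m) : ‖Lm s x‖ = s * rr x ^ ((1:ℝ)/2) := by
  have h0 : 0 ≤ rr x := Finset.sum_nonneg fun i _ => sq_nonneg _
  rw [← Real.sqrt_eq_rpow, ← sq_eq_sq₀ (norm_nonneg _) (by positivity), mul_pow, Real.sq_sqrt h0, norm_rr]
  simp [Lm_apply, mul_pow, rr, Finset.mul_sum]

def dv (g : XX m → ℂ) : (n : ℕ) → (Fin n → Fin m) → XX m → ℂ
  | 0, _ => g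
  | n+1, v => DD (v 0) (dv g n (Fin.tail v))

lemma dv_smooth {W : Set (XX m)} (hW : IsOpen W) {g : XX m → ℂ} (hg : ContDiffOn ℝ ∞ g W) (n : ℕ) (v : Fin n → Fin m) : ContDiffOn ℝ ∞ (dv g n v) W := by
  induction n with
  | zero => exact hg
  | succ n ih => exact DD_contDiffOn hW (ih _) _

lemma dv_eq {U : Set (EE m)} (hU : IsOpen U) {f : EE m → ℝ} (hf : ContDiffOn ℝ ∞ f U) (s c : ℝ) (n : ℕ) (v : Fin n → Fin m) :
    ∀ x ∈ Lm s ⁻¹' U, dv (fun x => ((c * f (Lm s x) : ℝ) : ℂ)) n v x = ((c * s^n * (iteratedFDerivWithin ℝ n f U (Lm s x)) (fun l => EuclideanSpace.single (v l) (1:ℝ)) : ℝ) : ℂ) := by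
  induction n with
  | zero => intro x hx; simp [dv]
  | succ n ih =>
    intro x hx
    have hW : IsOpen (Lm (m := m) s ⁻¹' U) := hU.preimage (Lm s).continuous
    show DD (v 0) (dv _ n (Fin.tail v)) x = _
    rw [DD_congr hW (ih (Fin.tail v)) (v 0) hx]
    have hd : DifferentiableAt ℝ (iteratedFDerivWithin ℝ n f U) (Lm s x) :=
      ((hf.differentiableOn_iteratedFDerivWithin (m := n) (WithTop.coe_lt_coe.2 (by exact_mod_cast WithTop.coe_lt_top n)) hU.uniqueDiffOn).differentiableAt (hU.mem_nhds hx))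
    have h1 : HasFDerivAt (fun x => iteratedFDerivWithin ℝ n f U (Lm s x)) _ x := hd.hasFDerivAt.comp x (Lm s).hasFDerivAt
    have h2 := ((ContinuousMultilinearMap.apply ℝ (fun _ : Fin n => EE m) ℝ (fun l => EuclideanSpace.single (Fin.tail v l) (1:ℝ))).hasFDerivAt.comp x h1).const_mul (c * s^n)
    have h3 := Complex.ofRealCLM.hasFDerivAt.comp x h2
    have e : fderiv ℝ (fun x => ((c * s^n * (iteratedFDerivWithin ℝ n f U (Lm s x)) (fun l => EuclideanSpace.single (Fin.tail v l) (1:ℝ)) : ℝ) : ℂ)) x = _ := h3.fderiv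
    rw [DD, e, iteratedFDerivWithin_succ_apply_left, fderivWithin_of_isOpen hU hx]
    simp only [ContinuousLinearMap.comp_apply, ContinuousLinearMap.smul_apply, Lm_single, map_smul, ContinuousMultilinearMap.smul_apply, ContinuousMultilinearMap.apply_apply, Complex.ofRealCLM_apply, smul_eq_mul]
    congr 1
    rw [pow_succ]
    simp only [Fin.tail_def]
    ring

lemma dv_EC {g : XX m → ℂ} {a : ℝ} (h : ∀ k (v : Fin k → Fin m), EB (a + k) (dv g k v)) (n : ℕ) : ∀ k (v : Fin k → Fin m), EC n (a+k) (dv g k v) := by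
  induction n with
  | zero => exact h
  | succ n ih =>
    refine fun k v => ⟨h k v, fun i => ?_⟩
    have := ih (k+1) (Fin.cons i v)
    rw [show a + ((k+1 : ℕ):ℝ) = a + k + 1 by push_cast; ring] at this
    simpa [dv] using this

lemma conj_det (A : Fin m → Fin m → ℝ) (h : ((1 + Complex.I • Matrix.of (fun i j => (A i j : ℂ)) : Matrix (Fin m) (Fin m) ℂ).det).im = 0) :
    (1 + Complex.I • (Matrix.of fun i j => (A j i : ℂ)) : Matrix (Fin m) (Fin m) ℂ).det - (1 - Complex.I • (Matrix.of fun i j => (A j i : ℂ)) : Matrix (Fin m) (Fin m) ℂ).det = 0 := by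
  have e1 : (1 + Complex.I • (Matrix.of fun i j => (A j i : ℂ)) : Matrix (Fin m) (Fin m) ℂ) = (1 + Complex.I • Matrix.of (fun i j => (A i j : ℂ)) : Matrix (Fin m) (Fin m) ℂ).transpose := by
    ext i j; simp [Matrix.one_apply, eq_comm]
  have e2 : (1 - Complex.I • (Matrix.of fun i j => (A j i : ℂ)) : Matrix (Fin m) (Fin m) ℂ) = (starRingEnd ℂ).mapMatrix (1 + Complex.I • Matrix.of (fun i j => (A i j : ℂ)) : Matrix (Fin m) (Fin m) ℂ).transpose := by
    ext i j
    simp [Matrix.one_apply, apply_ite (starRingEnd ℂ), eq_comm, sub_eq_add_neg]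
  rw [e2, e1, ← RingHom.map_det, Matrix.det_transpose, Complex.conj_eq_iff_im.2 h, sub_self]

end transf
end Lawlor

namespace Lawlor
open MeasureTheory Set Filter Topology
open scoped Real ContDiff
theorem final_thm
    (m : ℕ) (hm : 3 ≤ m) (R : ℝ) (hR : 0 < R)
    (U : Set (EuclideanSpace ℝ (Fin m)))
    (hU : U = {x : EuclideanSpace ℝ (Fin m) | R < ‖x‖})
    (f : EuclideanSpace ℝ (Fin m) → ℝ)
    (hf : ContDiffOn ℝ (⊤ : ℕ∞) f U)
    (hSL : ∀ x ∈ U,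
      ((1 + Complex.I •
          Matrix.of (fun i j : Fin m =>
            (((iteratedFDerivWithin ℝ 2 f U x)
              ![EuclideanSpace.single i (1:ℝ), EuclideanSpace.single j (1:ℝ)] : ℝ) : ℂ)) :
          Matrix (Fin m) (Fin m) ℂ).det).im = 0)
    (hdecay : ∀ ρ ∈ Set.Ioo ((2:ℝ) - m) 0, ∀ n : ℕ, ∀ v : Fin n → Fin m,
      ∃ C : ℝ, 0 ≤ C ∧ ∀ x ∈ U,
        |(iteratedFDerivWithin ℝ n f U x)
            (fun l => EuclideanSpace.single (v l) (1:ℝ))|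
          ≤ C * ‖x‖ ^ (ρ - n)) :
    ∃ F : EuclideanSpace ℝ (Fin m) → ℝ,
      AnalyticOn ℝ F (Metric.ball 0 (1 / R)) ∧
      ∀ y : EuclideanSpace ℝ (Fin m), y ≠ 0 → ‖y‖ < 1 / R →
        F y = ‖y‖ ^ ((2:ℝ) - m) * f ((‖y‖ ^ 2)⁻¹ • y) := by
  have hF2 : Fact (2 ≤ m) := ⟨by omega⟩
  have hm' : (3:ℝ) ≤ m := by exact_mod_cast hm
  have hUo : IsOpen U := by rw [hU]; exact isOpen_lt continuous_const continuous_norm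
  obtain ⟨s, hsd⟩ : ∃ s, s = R * m := ⟨_, rfl⟩
  have hs : 0 < s := by rw [hsd]; positivity
  obtain ⟨c, hcd⟩ : ∃ c, c = (s^2)⁻¹ := ⟨_, rfl⟩
  have hc : 0 < c := by rw [hcd]; positivity
  obtain ⟨u, hu⟩ : ∃ u : XX m → ℂ, u = fun x => ((c * f (Lm s x) : ℝ) : ℂ) := ⟨_, rfl⟩
  obtain ⟨W, hWd⟩ : ∃ W : Set (XX m), W = Lm s ⁻¹' U := ⟨_, rfl⟩
  have hW : IsOpen W := by rw [hWd]; exact hUo.preimage (Lm s).continuous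
  have hus : ContDiffOn ℝ ∞ u W := by
    rw [hu, hWd]
    exact Complex.ofRealCLM.contDiff.comp_contDiffOn (contDiffOn_const.mul (hf.comp (Lm s).contDiff.contDiffOn (mapsTo_preimage _ _)))
  have hdv : ∀ n (v : Fin n → Fin m), ∀ x ∈ W, dv u n v x = ((c * s^n * (iteratedFDerivWithin ℝ n f U (Lm s x)) (fun l => EuclideanSpace.single (v l) (1:ℝ)) : ℝ) : ℂ) := by
    rw [hu, hWd]; exact dv_eq hUo hf s c
  have hH : ∀ i j, ∀ x ∈ W, DD j (DD i u) x = (((iteratedFDerivWithin ℝ 2 f U (Lm s x)) ![EuclideanSpace.single j (1:ℝ), EuclideanSpace.single i (1:ℝ)] : ℝ) : ℂ) := by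
    intro i j x hx
    have := hdv 2 ![j, i] x hx
    rw [show dv u 2 ![j, i] = DD j (DD i u) from rfl] at this
    rw [this, hcd, inv_mul_cancel₀ (by positivity), one_mul]
    congr 3
    ext l; fin_cases l <;> rfl
  have hE : ∀ x ∈ W, (1 + Complex.I • (Matrix.of fun i j => DD j (DD i u) x)).det - (1 - Complex.I • (Matrix.of fun i j => DD j (DD i u) x)).det = 0 := by
    intro x hx
    simp only [fun i j => hH i j x hx]
    exact conj_det _ (hSL _ (by rw [hWd] at hx; exact hx))
  have hWx : Wx m ⊆ W := by
    intro x hx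
    have hx : 1 < m * rr x := hx
    rw [hWd, hU]
    show R < ‖Lm s x‖
    have h0 : 0 ≤ rr x := Finset.sum_nonneg fun i _ => sq_nonneg _
    rw [Lm_norm hs, ← sq_lt_sq₀ hR.le (by positivity), mul_pow, ← Real.sqrt_eq_rpow, Real.sq_sqrt h0, hsd, mul_pow]
    have : 0 < R^2 := by positivity
    calc R^2 = R^2 * 1 := by ring
      _ < R^2 * (m * rr x) := by gcongr
      _ ≤ R^2 * (m * (m * rr x)) := by
        gcongr
        refine le_mul_of_one_le_left (by positivity) (by linarith)
      _ = _ := by ring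
  have hEB : ∀ k (v : Fin k → Fin m), EB ((m:ℝ) - 2 + k) (dv u k v) := by
    intro k v
    refine ⟨(dv_smooth hW hus k v).mono hWx, fun ε h0 h1 => ?_⟩
    obtain ⟨C, hC, hb⟩ := hdecay (2 - m + ε) ⟨by linarith, by linarith⟩ k v
    refine ⟨c * s^k * C * s^((2:ℝ) - m + ε - k), by positivity, fun x hx => ?_⟩
    have hr : 0 ≤ rr x := Finset.sum_nonneg fun i _ => sq_nonneg _
    have h := hb (Lm s x) (by have := hWx hx; rw [hWd] at this; exact this)
    rw [hdv k v x (hWx hx), Complex.norm_real, Real.norm_eq_abs, abs_mul, abs_of_pos (by positivity)]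
    rw [Lm_norm hs, Real.mul_rpow hs.le (by positivity), ← Real.rpow_mul hr, show (1:ℝ)/2 * (2 - m + ε - k) = -((m:ℝ) - 2 + k - ε)/2 by ring] at h
    calc _ ≤ c * s^k * (C * (s^((2:ℝ) - m + ε - k) * rr x ^ (-((m:ℝ) - 2 + k - ε)/2))) := by gcongr
      _ = _ := by ring
  obtain ⟨F', hF'⟩ : ∃ F' : XX m → ℂ, F' = fun y => pw (-((m:ℝ)-2)/2) y * u (inv y) := ⟨_, rfl⟩
  have hSC : ∀ n, SC n 0 F' := by
    intro n
    have h1 := dv_EC hEB n 0 Fin.elim0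
    have h2 := (SC_pw n (-((m:ℝ)-2)/2)).mul h1.sc
    rw [show 2 * (-((m:ℝ) - 2)/2) + ((m:ℝ) - 2 + (0:ℕ)) = 0 by push_cast; ring] at h2
    rw [hF']; exact h2
  have hpde := fun y (hy : y ∈ Om m) => pde_transfer hm isOpen_Wx (hus.mono hWx) isOpen_Om (fun y hy => ⟨hy.1, inv_mem hy⟩) (fun x hx => hE x (hWx hx)) (hSC 0).smooth (fun y hy => by
    rw [hF']; simp only
    rw [← mul_assoc, pw_add _ _ hy.1, show ((m:ℝ)-2)/2 + -((m:ℝ)-2)/2 = 0 by ring, pw_zero, one_mul]) hy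
  obtain ⟨G, hG, hGF⟩ := removable hm hSC hpde
  -- the key identity
  have hkey : ∀ Y : EE m, Y ≠ 0 → ‖Y‖ ^ ((2:ℝ) - m) * f ((‖Y‖ ^ 2)⁻¹ • Y) = s^m * (F' (Li s Y)).re := by
    intro Y hY
    have hn : 0 < ‖Y‖ := norm_pos_iff.2 hY
    have h1 : rr (Li s Y) = s^2 * ‖Y‖^2 := by
      rw [norm_rr, rr, Finset.mul_sum]; simp [Li_apply, mul_pow]
    have h2 : Lm s (inv (Li s Y)) = (‖Y‖^2)⁻¹ • Y := by
      ext i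
      rw [Lm_apply]
      simp only [inv, h1, Pi.smul_apply, Li_apply, smul_eq_mul, PiLp.smul_apply]
      field_simp
    rw [hF']; simp only
    rw [hu]; simp only
    rw [h2, pw, ← Complex.ofReal_mul, Complex.ofReal_re, h1, ← mul_pow, ← Real.rpow_natCast (s * ‖Y‖) 2, ← Real.rpow_mul (by positivity),
      Real.mul_rpow hs.le hn.le, show ((2:ℕ):ℝ) * (-((m:ℝ)-2)/2) = 2 - m by push_cast; ring, hcd]
    have h3 : s^m * s^((2:ℝ) - m) * (s^2)⁻¹ = 1 := by
      rw [← Real.rpow_natCast s m, ← Real.rpow_natCast s 2, ← Real.rpow_neg hs.le, ← Real.rpow_add hs, ← Real.rpow_add hs]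
      rw [show (m:ℝ) + (2 - m) + -((2:ℕ):ℝ) = 0 by push_cast; ring, Real.rpow_zero]
    linear_combination (-(‖Y‖ ^ ((2:ℝ) - m) * f ((‖Y‖ ^ 2)⁻¹ • Y))) * h3
  -- interior analyticity
  have hfa : ∀ X ∈ U, AnalyticAt ℝ f X := by
    intro X hX
    have hLL : ∀ X : EE m, Lm s (Li s⁻¹ X) = X := fun X => by
      ext i; rw [Lm_apply, Li_apply]; field_simp
    have hXW : Li s⁻¹ X ∈ W := by rw [hWd]; show Lm s (Li s⁻¹ X) ∈ U; rw [hLL]; exact hX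
    have h1 := interior_analytic hW hus hXW (fun i j => ⟨_, hH i j _ hXW⟩) hE
    have h2 : AnalyticAt ℝ (fun X => (u (Li s⁻¹ X)).re) X :=
      (Complex.reCLM.analyticAt _).comp (h1.comp ((Li s⁻¹).analyticAt X))
    have h3 : f = fun X => c⁻¹ * (u (Li s⁻¹ X)).re := by
      funext X
      rw [hu]; simp only
      rw [Complex.ofReal_re, hLL]; field_simp
    rw [h3]
    exact analyticAt_const.mul h2
  classical
  refine ⟨fun Y => if Y = 0 then s^m * (G 0).re else ‖Y‖ ^ ((2:ℝ) - m) * f ((‖Y‖ ^ 2)⁻¹ • Y), fun Y hY => AnalyticAt.analyticWithinAt ?_, fun y hy _ => if_neg hy⟩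
  by_cases hY0 : Y = 0
  · subst hY0
    have h1 : AnalyticAt ℝ (fun Y => s^m * (G (Li s Y)).re) (0 : EE m) := by
      refine analyticAt_const.mul ((Complex.reCLM.analyticAt _).comp (AnalyticAt.comp (g := G) ?_ ((Li s).analyticAt 0)))
      rw [map_zero]; exact hG
    refine h1.congr ?_
    have : ∀ᶠ Y : EE m in 𝓝 0, Li s Y ∈ Metric.ball (0 : XX m) (2/10) :=
      (Li s).continuous.continuousAt.eventually (by rw [map_zero]; exact Metric.ball_mem_nhds _ (by norm_num))
    filter_upwards [this] with Y hY
    by_cases h : Y = 0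
    · simp [h]
    · rw [if_neg h, hkey Y h, hGF _ ?_ (by simpa using hY)]
      intro h0
      apply h
      ext i
      have := congrFun h0 i
      rw [Li_apply] at this
      simpa [hs.ne'] using this
  · have hn : 0 < ‖Y‖ := norm_pos_iff.2 hY0
    have hYn : ‖Y‖ < 1/R := by simpa using hY
    have hsq : AnalyticAt ℝ (fun Y : EE m => ‖Y‖^2) Y := by
      have : (fun Y : EE m => ‖Y‖^2) = fun Y => ∑ i, Y i ^ 2 := funext norm_rr
      rw [this]
      refine Finset.analyticAt_fun_sum _ fun i _ => AnalyticAt.pow ((EuclideanSpace.proj (𝕜 := ℝ) i : EE m →L[ℝ] ℝ).analyticAt Y) 2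
    have hne : ‖Y‖^2 ≠ 0 := by positivity
    have hinv : AnalyticAt ℝ (fun Y : EE m => (‖Y‖^2)⁻¹ • Y) Y := (hsq.inv hne).smul analyticAt_id
    have hU1 : (‖Y‖^2)⁻¹ • Y ∈ U := by
      rw [hU]; show R < ‖(‖Y‖^2)⁻¹ • Y‖
      rw [norm_smul, norm_inv, norm_pow, norm_norm, sq, mul_inv, mul_assoc, inv_mul_cancel₀ hn.ne', mul_one]
      rwa [lt_inv_comm₀ hR hn, ← one_div]
    have h1 : AnalyticAt ℝ (fun Y : EE m => Real.exp (Real.log (‖Y‖^2) * (((2:ℝ) - m)/2)) * f ((‖Y‖ ^ 2)⁻¹ • Y)) Y := by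
      have g1 : AnalyticAt ℝ (fun Y : EE m => Real.log (‖Y‖^2)) Y :=
        AnalyticAt.comp (g := Real.log) (f := fun Y : EE m => ‖Y‖^2) (analyticAt_log (by positivity)) hsq
      have g2 : AnalyticAt ℝ (fun Y : EE m => Real.log (‖Y‖^2) * (((2:ℝ) - m)/2)) Y := g1.mul analyticAt_const
      exact g2.rexp'.mul (AnalyticAt.comp (g := f) (f := fun Y : EE m => (‖Y‖^2)⁻¹ • Y) (hfa _ hU1) hinv)
    refine h1.congr ?_
    filter_upwards [isOpen_compl_singleton.mem_nhds hY0] with Z hZ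
    have hZ : Z ≠ 0 := hZ
    have hz : 0 < ‖Z‖ := norm_pos_iff.2 hZ
    rw [if_neg hZ, ← Real.rpow_def_of_pos (by positivity), ← Real.rpow_natCast, ← Real.rpow_mul hz.le]
    congr 2
    push_cast; ring
end Lawlor

/-- Let `m ≥ 3`, `R > 0`, `U = {x ∈ ℝ^m : |x| > R}`. If `f : U → ℝ` is smooth,
satisfies the special Lagrangian graph equation `Im det_ℂ(I + i Hess f) = 0` on `U`, and decays
at every rate `ρ ∈ (2 - m, 0)` together with all its derivatives, then
`F(y) = |y|^{2-m} f(y/|y|²)` extends to a real analytic function on the ball `{|y| < 1/R}`. -/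
theorem lawlor_inversion_analytic_extension
    (m : ℕ) (hm : 3 ≤ m) (R : ℝ) (hR : 0 < R)
    (U : Set (EuclideanSpace ℝ (Fin m)))
    (hU : U = {x : EuclideanSpace ℝ (Fin m) | R < ‖x‖})
    (f : EuclideanSpace ℝ (Fin m) → ℝ)
    (hf : ContDiffOn ℝ (⊤ : ℕ∞) f U)
    (hSL : ∀ x ∈ U,
      ((1 + Complex.I •
          Matrix.of (fun i j : Fin m =>
            (((iteratedFDerivWithin ℝ 2 f U x)
              ![EuclideanSpace.single i (1:ℝ), EuclideanSpace.single j (1:ℝ)] : ℝ) : ℂ)) :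
          Matrix (Fin m) (Fin m) ℂ).det).im = 0)
    (hdecay : ∀ ρ ∈ Set.Ioo ((2:ℝ) - m) 0, ∀ n : ℕ, ∀ v : Fin n → Fin m,
      ∃ C : ℝ, 0 ≤ C ∧ ∀ x ∈ U,
        |(iteratedFDerivWithin ℝ n f U x)
            (fun l => EuclideanSpace.single (v l) (1:ℝ))|
          ≤ C * ‖x‖ ^ (ρ - n)) :
    ∃ F : EuclideanSpace ℝ (Fin m) → ℝ,
      AnalyticOn ℝ F (Metric.ball 0 (1 / R)) ∧
      ∀ y : EuclideanSpace ℝ (Fin m), y ≠ 0 → ‖y‖ < 1 / R →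
        F y = ‖y‖ ^ ((2:ℝ) - m) * f ((‖y‖ ^ 2)⁻¹ • y) := by
  exact Lawlor.final_thm m hm R hR U hU f hf hSL hdecay
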